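/- There exist ε₀ > 0 and F₀ > 0 with the following property. Let 0 < ε ≤ ε₀, and let f, g : ℕ → ℝ_{>0} be functions such that f(q) ≥ F₀ for all q and (log q)/(ε·φ(q)) ≤ g(q) ≤ log q for all q. If GRH is true, then there exist constants c₁, c₂ > 0 depending only on ε such that for each sufficiently large q there exists a real number x_q satisfying c₁·φ(q)·f(q)·g(q)·(1 + log f(q)/log q) ≤ log log x_q ≤ c₂·φ(q)·f(q)·g(q)·(1 + log f(q)/log q) and G(x_q; q)/x_q ≥ (1/4 − 2ε)·g(q)·(log(q²·f(q)))²/log q. Under the weaker assumption that GRH(χ) holds for every nonprincipal character χ, the same statement holds with V_Λ(x_q;q) in place of G(x_q;q). -/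

import Mathlib

open Filter Real Complex
open scoped Classical

/-- `θ(x;q,a) = ∑_{p ≤ x, p ≡ a (mod q)} log p`. -/
noncomputable def thetaQA (x : ℝ) (q a : ℕ) : ℝ :=
  ∑ p ∈ (Finset.range (Nat.floor x + 1)).filter (fun p => p.Prime ∧ p % q = a), Real.log p

/-- The variance `G(x;q)` of primes in arithmetic progressions mod `q`, weighted by `log p`. -/
noncomputable def Gvar (x : ℝ) (q : ℕ) : ℝ :=
  ∑ a ∈ (Finset.range q).filter (fun a => Nat.Coprime a q),
    (thetaQA x q a - x / (Nat.totient q)) ^ 2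

/-- The variance `V_Λ(x;q)`. -/
noncomputable def Vvar (x : ℝ) (q : ℕ) : ℝ :=
  ∑ a ∈ (Finset.range q).filter (fun a => Nat.Coprime a q),
    ((∑ n ∈ (Finset.range (Nat.floor x + 1)).filter (fun n => n % q = a),
        ArithmeticFunction.vonMangoldt n)
      - (1 / (Nat.totient q : ℝ)) *
        ∑ n ∈ (Finset.range (Nat.floor x + 1)).filter (fun n => Nat.Coprime n q),
          ArithmeticFunction.vonMangoldt n) ^ 2

/-- The analytically continued Dirichlet L-function `L(s,χ)`
(with junk value `1` for the modulus `0`). -/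
noncomputable def Lfunc (q : ℕ) (χ : DirichletCharacter ℂ q) (s : ℂ) : ℂ :=
  if h : q = 0 then 1 else
    letI : NeZero q := ⟨h⟩
    DirichletCharacter.LFunction χ s

/-- The generalized Riemann hypothesis for the character `χ`: every zero of `L(s,χ)`
with `0 < Re s < 1` lies on the critical line. -/
def GRHchi {q : ℕ} (χ : DirichletCharacter ℂ q) : Prop :=
  ∀ s : ℂ, 0 < s.re → s.re < 1 → Lfunc q χ s = 0 → s.re = 1 / 2

/-- The generalized Riemann hypothesis for all Dirichlet L-functions. -/
def GRH : Prop := ∀ (q : ℕ) (χ : DirichletCharacter ℂ q), GRHchi χ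

/-- Splitting off the exact power of `z - w` from an entire function. -/
lemma entire_split_zero {h : ℂ → ℂ} (hh : Differentiable ℂ h) (hne : ∃ z, h z ≠ 0) (w : ℂ) :
    ∃ (n : ℕ) (k : ℂ → ℂ), Differentiable ℂ k ∧ k w ≠ 0 ∧ ∀ z, h z = (z - w) ^ n * k z := by
  obtain ⟨p, hp⟩ := (hh.analyticAt w)
  have hp0 : p ≠ 0 := by
    rintro rfl
    obtain ⟨z, hz⟩ := hne
    have h1 : h =ᶠ[nhds w] 0 := hp.eventually_eq_zero
    have h2 : AnalyticOnNhd ℂ h Set.univ := fun x _ => hh.analyticAt x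
    exact hz (h2.eqOn_zero_of_preconnected_of_eventuallyEq_zero isPreconnected_univ
      (Set.mem_univ w) h1 (Set.mem_univ z))
  refine ⟨p.order, (Function.swap dslope w)^[p.order] h, ?_, hp.iterate_dslope_fslope_ne_zero hp0,
    fun z => hp.eq_pow_order_mul_iterate_dslope z⟩
  have : ∀ n : ℕ, Differentiable ℂ ((Function.swap dslope w)^[n] h) := by
    intro n
    induction n with
    | zero => exact hh
    | succ n ih =>
      rw [Function.iterate_succ_apply']
      rw [← differentiableOn_univ] at ih ⊢
      exact (Complex.differentiableOn_dslope univ_mem).2 ih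
  exact this _

lemma entire_order_ne_top {f : ℂ → ℂ} (hf : Differentiable ℂ f) (hne : ∃ z, f z ≠ 0) (w : ℂ) :
    analyticOrderAt f w ≠ ⊤ := by
  intro h
  rw [analyticOrderAt_eq_top] at h
  obtain ⟨z, hz⟩ := hne
  have h2 : AnalyticOnNhd ℂ f Set.univ := fun x _ => hf.analyticAt x
  exact hz (h2.eqOn_zero_of_preconnected_of_eventuallyEq_zero isPreconnected_univ
      (Set.mem_univ w) h (Set.mem_univ z))

/-- Finite Weierstrass factorization of an entire function over a finite set. -/
lemma entire_factor {f : ℂ → ℂ} (hf : Differentiable ℂ f) (hne : ∃ z, f z ≠ 0) (Z : Finset ℂ) :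
    ∃ h : ℂ → ℂ, Differentiable ℂ h ∧ (∀ ρ ∈ Z, h ρ ≠ 0) ∧
      ∀ z, f z = (∏ ρ ∈ Z, (z - ρ) ^ analyticOrderNatAt f ρ) * h z := by
  induction Z using Finset.induction_on with
  | empty => exact ⟨f, hf, by simp, by simp⟩
  | insert w Z hw ih =>
    obtain ⟨h, hd, hZ, hfac⟩ := ih
    have hne' : ∃ z, h z ≠ 0 := by
      obtain ⟨z, hz⟩ := hne
      refine ⟨z, fun h0 => hz ?_⟩
      rw [hfac, h0, mul_zero]
    obtain ⟨n, k, hk, hkw, hnk⟩ := entire_split_zero hd hne' w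
    have hord : analyticOrderNatAt f w = n := by
      rw [(hf.analyticAt w).analyticOrderNatAt_eq_iff (entire_order_ne_top hf hne w)]
      refine ⟨fun z => (∏ ρ ∈ Z, (z - ρ) ^ analyticOrderNatAt f ρ) * k z, ?_, ?_, ?_⟩
      · apply Differentiable.analyticAt
        fun_prop
      · refine mul_ne_zero (Finset.prod_ne_zero_iff.2 fun ρ hρ => pow_ne_zero _ ?_) hkw
        exact sub_ne_zero.2 fun h => hw (h ▸ hρ)
      · refine Eventually.of_forall fun z => ?_
        rw [hfac, hnk, smul_eq_mul]; ring
    refine ⟨k, hk, ?_, ?_⟩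
    · intro ρ hρ
      rcases Finset.mem_insert.1 hρ with rfl | hρ
      · exact hkw
      · have := hZ ρ hρ
        rw [hnk] at this
        exact right_ne_zero_of_mul this
    · intro z
      rw [Finset.prod_insert hw, hord, hfac z, hnk z]; ring

lemma entire_zeros_finite {f : ℂ → ℂ} (hf : Differentiable ℂ f) (hne : ∃ z, f z ≠ 0) (c : ℂ)
    (R : ℝ) : {ρ | ‖ρ - c‖ ≤ R ∧ f ρ = 0}.Finite := by
  obtain ⟨z, hz⟩ := hne
  have h2 : AnalyticOnNhd ℂ f Set.univ := fun x _ => hf.analyticAt x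
  have h3 := h2.preimage_zero_mem_codiscrete hz
  have hK : IsCompact (Metric.closedBall c R) := isCompact_closedBall c R
  have h4 := hK.finite_sdiff_of_mem_codiscreteWithin
    (Filter.codiscreteWithin_mono (Set.subset_univ _) h3)
  refine h4.subset fun ρ hρ => ⟨?_, ?_⟩
  · simpa [dist_eq_norm] using hρ.1
  · simpa using hρ.2

/-- Variation of the logarithmic derivative of a zero-free function on a disc. -/
lemma logDeriv_variation {h : ℂ → ℂ} (hd : Differentiable ℂ h) {c s : ℂ} {R M : ℝ} (hR : 0 < R)
    (hM : 0 < M) (h0 : ∀ z ∈ Metric.ball c R, h z ≠ 0)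
    (hb : ∀ z ∈ Metric.ball c R, ‖h z‖ ≤ Real.exp M * ‖h c‖) (hs : ‖s - c‖ ≤ R / 8) :
    ‖logDeriv h s - logDeriv h c‖ ≤ 64 * M / R ^ 2 * ‖s - c‖ := by
  have hk : DifferentiableOn ℂ (logDeriv h) (Metric.ball c R) := by
    intro z hz
    exact ((hd.deriv z).div (hd z) (h0 z hz)).differentiableWithinAt
  obtain ⟨g, hg0, hg⟩ := hk.isExactOn_ball.with_val_at c 0
  have hc : c ∈ Metric.ball c R := Metric.mem_ball_self hR
  have hexp : ∀ z ∈ Metric.ball c R, h z * Complex.exp (-g z) = h c := by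
    have hD : ∀ z ∈ Metric.ball c R, HasDerivAt (fun z => h z * Complex.exp (-g z)) 0 z := by
      intro z hz
      have h1 : HasDerivAt (fun z => h z * Complex.exp (-g z))
          (deriv h z * Complex.exp (-g z) + h z * (Complex.exp (-g z) * -logDeriv h z)) z :=
        (hd z).hasDerivAt.mul ((hg z hz).neg.cexp)
      have h2 := h0 z hz
      have h3 : deriv h z * Complex.exp (-g z) + h z * (Complex.exp (-g z) * -logDeriv h z) = 0 := by
        rw [show logDeriv h z = deriv h z / h z from rfl]
        field_simp
        ring
      rwa [h3] at h1
    intro z hz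
    have := Convex.norm_image_sub_le_of_norm_deriv_le (𝕜 := ℂ) (C := 0)
      (fun x hx => (hD x hx).differentiableAt) (fun x hx => by rw [(hD x hx).deriv]; simp)
      (convex_ball c R) hc hz
    have h5 : h z * Complex.exp (-g z) - h c * Complex.exp (-g c) = 0 := by
      rw [← norm_le_zero_iff]; simpa using this
    rw [hg0] at h5
    simpa [sub_eq_zero] using h5
  have hre : ∀ z ∈ Metric.ball c R, (g z).re ≤ M := by
    intro z hz
    have h1 := hb z hz
    have h2 : ‖h c‖ * Real.exp ((g z).re) = ‖h z‖ := by
      rw [← hexp z hz, norm_mul, Complex.norm_exp, mul_assoc, ← Real.exp_add]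
      simp
    rw [← h2, mul_comm] at h1
    have h3 := le_of_mul_le_mul_right h1 (norm_pos_iff.2 (h0 c hc))
    exact Real.exp_le_exp.1 h3
  have hBC : ∀ z, ‖z - c‖ ≤ R / 2 → ‖g z‖ ≤ 2 * M := by
    intro z hz
    have hmap : ∀ w ∈ Metric.ball (0:ℂ) R, c + w ∈ Metric.ball c R := by
      intro w hw; simpa [dist_eq_norm] using hw
    have := borelCaratheodory_zero (f := fun w => g (c + w)) (z := z - c) hM
      (R := R) (fun w hw => by
        have := (hg (c + w) (hmap w hw))
        exact (this.comp_const_add c w).differentiableAt.differentiableWithinAt)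
      (fun w hw => hre _ (hmap w hw)) hR (by simpa using lt_of_le_of_lt hz (by linarith))
      (by simpa using hg0)
    simp only [add_sub_cancel] at this
    refine this.trans ?_
    rw [div_le_iff₀ (by linarith)]
    nlinarith
  have hder : ∀ z, ‖z - c‖ ≤ R / 4 → ‖logDeriv h z‖ ≤ 8 * M / R := by
    intro z hz
    have hsub : ∀ w ∈ Metric.closedBall z (R/4), ‖w - c‖ ≤ R / 2 := by
      intro w hw
      rw [Metric.mem_closedBall, dist_eq_norm] at hw
      calc ‖w - c‖ = ‖(w - z) + (z - c)‖ := by ring_nf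
        _ ≤ _ := norm_add_le _ _
        _ ≤ _ := by linarith
    have hmem : ∀ w, ‖w - c‖ ≤ R / 2 → w ∈ Metric.ball c R := fun w hw => by
      rw [Metric.mem_ball, dist_eq_norm]; linarith
    have h1 := Complex.norm_deriv_le_of_forall_mem_sphere_norm_le (f := g) (c := z) (R := R/4)
      (C := 2 * M) (by positivity)
      (DifferentiableOn.diffContOnCl (fun w hw => by
        rw [closure_ball _ (by positivity)] at hw
        exact (hg w (hmem w (hsub w hw))).differentiableAt.differentiableWithinAt))
      (fun w hw => hBC w (hsub w (Metric.sphere_subset_closedBall hw)))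
    rw [(hg z (hmem z (by linarith))).deriv] at h1
    refine h1.trans (le_of_eq ?_)
    field_simp; ring
  have hdd : ∀ z ∈ Metric.closedBall c (R/8), ‖deriv (logDeriv h) z‖ ≤ 64 * M / R ^ 2 := by
    intro z hz
    rw [Metric.mem_closedBall, dist_eq_norm] at hz
    have hsub : ∀ w ∈ Metric.closedBall z (R/8), ‖w - c‖ ≤ R / 4 := by
      intro w hw
      rw [Metric.mem_closedBall, dist_eq_norm] at hw
      calc ‖w - c‖ = ‖(w - z) + (z - c)‖ := by ring_nf
        _ ≤ _ := norm_add_le _ _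
        _ ≤ _ := by linarith
    have h1 := Complex.norm_deriv_le_of_forall_mem_sphere_norm_le (f := logDeriv h) (c := z)
      (R := R/8) (C := 8 * M / R) (by positivity)
      (DifferentiableOn.diffContOnCl (fun w hw => by
        rw [closure_ball _ (by positivity)] at hw
        refine ((hk w ?_).differentiableAt ?_).differentiableWithinAt
        · rw [Metric.mem_ball, dist_eq_norm]; have := hsub w hw; linarith
        · apply Metric.isOpen_ball.mem_nhds
          rw [Metric.mem_ball, dist_eq_norm]; have := hsub w hw; linarith))
      (fun w hw => hder w (hsub w (Metric.sphere_subset_closedBall hw)))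
    refine h1.trans (le_of_eq ?_)
    field_simp; ring
  refine Convex.norm_image_sub_le_of_norm_deriv_le (𝕜 := ℂ) (s := Metric.closedBall c (R/8))
    ?_ hdd (convex_closedBall c _) (Metric.mem_closedBall_self (by positivity)) ?_
  · intro z hz
    refine (hk z ?_).differentiableAt (Metric.isOpen_ball.mem_nhds ?_) <;>
    · rw [Metric.mem_closedBall] at hz
      rw [Metric.mem_ball]; linarith
  · simpa [dist_eq_norm] using hs

/-- The finite set of zeros of an entire function in a closed disc. -/
noncomputable def zeroSet (f : ℂ → ℂ) (c : ℂ) (R : ℝ) : Finset ℂ :=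
  if h : {ρ | ‖ρ - c‖ ≤ R ∧ f ρ = 0}.Finite then h.toFinset else ∅

lemma mem_zeroSet {f : ℂ → ℂ} (hf : Differentiable ℂ f) (hne : ∃ z, f z ≠ 0) {c : ℂ} {R : ℝ}
    {ρ : ℂ} : ρ ∈ zeroSet f c R ↔ ‖ρ - c‖ ≤ R ∧ f ρ = 0 := by
  rw [zeroSet, dif_pos (entire_zeros_finite hf hne c R)]
  simp

/-- Partial fractions for the logarithmic derivative of an entire function of growth `o(R ^ 2)`. -/
theorem tendsto_sum_zeros_logDeriv {f : ℂ → ℂ} (hf : Differentiable ℂ f) {c s : ℂ} (hc : f c ≠ 0)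
    (hs : f s ≠ 0)
    (hgrow : ∀ ε > 0, ∀ᶠ R : ℝ in atTop, ∀ z, ‖z - c‖ ≤ R → ‖f z‖ ≤ Real.exp (ε * R ^ 2)) :
    Tendsto (fun R : ℝ => ∑ ρ ∈ zeroSet f c R,
      (analyticOrderNatAt f ρ : ℂ) * (1 / (s - ρ) - 1 / (c - ρ))) atTop
      (nhds (logDeriv f s - logDeriv f c)) := by
  have hne : ∃ z, f z ≠ 0 := ⟨c, hc⟩
  rw [tendsto_iff_norm_sub_tendsto_zero]
  have key : ∀ ε > 0, ∀ᶠ R : ℝ in atTop,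
      ‖(∑ ρ ∈ zeroSet f c R, (analyticOrderNatAt f ρ : ℂ) * (1 / (s - ρ) - 1 / (c - ρ))) -
        (logDeriv f s - logDeriv f c)‖ ≤
      64 * (ε * (3 * R) ^ 2 + (|Real.log ‖f c‖| + 1)) / R ^ 2 * ‖s - c‖ := by
    intro ε hε
    have h3 : Tendsto (fun R : ℝ => 3 * R) atTop atTop :=
      tendsto_id.const_mul_atTop (by norm_num)
    filter_upwards [h3.eventually (hgrow ε hε), eventually_gt_atTop (0:ℝ),
      eventually_ge_atTop (8 * ‖s - c‖)] with R hR hR0 hRs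
    obtain ⟨h, hd, hZ, hfac⟩ := entire_factor hf hne (zeroSet f c R)
    have hlog : ∀ z, f z ≠ 0 → logDeriv f z =
        (∑ ρ ∈ zeroSet f c R, (analyticOrderNatAt f ρ : ℂ) * (1 / (z - ρ))) + logDeriv h z := by
      intro z hz
      have hz' := hz
      rw [hfac z] at hz'
      have e1 : f = fun z => (∏ ρ ∈ zeroSet f c R, (z - ρ) ^ analyticOrderNatAt f ρ) * h z :=
        funext hfac
      conv_lhs => rw [e1]
      rw [logDeriv_mul z (left_ne_zero_of_mul hz') (right_ne_zero_of_mul hz')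
        (by fun_prop) (hd z)]
      congr 1
      have e2 := logDeriv_prod (𝕜 := ℂ) (s := zeroSet f c R)
        (f := fun ρ z => (z - ρ) ^ analyticOrderNatAt f ρ) (x := z)
        (fun i hi => Finset.prod_ne_zero_iff.1 (left_ne_zero_of_mul hz') i hi)
        (fun i hi => by fun_prop)
      rw [e2]
      refine Finset.sum_congr rfl fun ρ _ => ?_
      rw [logDeriv_fun_pow (by fun_prop)]
      congr 1
      simp [logDeriv_apply]
    have hh0 : ∀ z ∈ Metric.ball c R, h z ≠ 0 := by
      intro z hz h0
      have : z ∈ zeroSet f c R := (mem_zeroSet hf hne).2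
        ⟨by rw [Metric.mem_ball, dist_eq_norm] at hz; exact hz.le, by rw [hfac, h0, mul_zero]⟩
      exact hZ z this h0
    have hsph : ∀ z ∈ frontier (Metric.ball c (3 * R)),
        ‖h z‖ ≤ Real.exp (ε * (3 * R) ^ 2 + (|Real.log ‖f c‖| + 1)) * ‖h c‖ := by
      intro z hz
      rw [frontier_ball _ (by positivity), mem_sphere_iff_norm] at hz
      have h1 := hR z hz.le
      have hprod : ‖∏ ρ ∈ zeroSet f c R, (c - ρ) ^ analyticOrderNatAt f ρ‖ ≤
          ‖∏ ρ ∈ zeroSet f c R, (z - ρ) ^ analyticOrderNatAt f ρ‖ := by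
        rw [norm_prod, norm_prod]
        refine Finset.prod_le_prod (fun _ _ => norm_nonneg _) fun ρ hρ => ?_
        rw [norm_pow, norm_pow]
        have h2 := ((mem_zeroSet hf hne).1 hρ).1
        refine pow_le_pow_left₀ (norm_nonneg _) ?_ _
        have h4 : ‖z - c‖ ≤ ‖z - ρ‖ + ‖ρ - c‖ := by
          simpa using norm_add_le (z - ρ) (ρ - c)
        rw [norm_sub_rev c ρ]
        linarith
      have hfc : 0 < ‖f c‖ := norm_pos_iff.2 hc
      have h5 : ‖h z‖ * ‖f c‖ ≤ Real.exp (ε * (3 * R) ^ 2) * ‖h c‖ := by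
        calc ‖h z‖ * ‖f c‖ = ‖h z‖ * (‖∏ ρ ∈ zeroSet f c R, (c - ρ) ^ analyticOrderNatAt f ρ‖
              * ‖h c‖) := by rw [hfac c, norm_mul]
          _ ≤ ‖h z‖ * (‖∏ ρ ∈ zeroSet f c R, (z - ρ) ^ analyticOrderNatAt f ρ‖ * ‖h c‖) := by
              gcongr
          _ = ‖f z‖ * ‖h c‖ := by rw [hfac z, norm_mul]; ring
          _ ≤ _ := by gcongr
      have h6 : 1 ≤ Real.exp (|Real.log ‖f c‖| + 1) * ‖f c‖ := by
        nth_rw 2 [← Real.exp_log hfc]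
        rw [← Real.exp_add]
        apply Real.one_le_exp
        linarith [neg_abs_le (Real.log ‖f c‖)]
      calc ‖h z‖ = ‖h z‖ * 1 := by ring
        _ ≤ ‖h z‖ * (Real.exp (|Real.log ‖f c‖| + 1) * ‖f c‖) := by gcongr
        _ = Real.exp (|Real.log ‖f c‖| + 1) * (‖h z‖ * ‖f c‖) := by ring
        _ ≤ Real.exp (|Real.log ‖f c‖| + 1) * (Real.exp (ε * (3 * R) ^ 2) * ‖h c‖) := by gcongr
        _ = _ := by rw [Real.exp_add (ε * (3 * R) ^ 2)]; ring
    have hbd : ∀ z ∈ Metric.ball c R,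
        ‖h z‖ ≤ Real.exp (ε * (3 * R) ^ 2 + (|Real.log ‖f c‖| + 1)) * ‖h c‖ := by
      intro z hz
      refine Complex.norm_le_of_forall_mem_frontier_norm_le Metric.isBounded_ball
        hd.diffContOnCl hsph (subset_closure ?_)
      rw [Metric.mem_ball] at hz ⊢
      linarith
    have hfin := logDeriv_variation hd hR0 (by positivity) hh0 hbd (s := s) (by linarith)
    rw [norm_sub_rev]
    have : logDeriv f s - logDeriv f c -
        (∑ ρ ∈ zeroSet f c R, (analyticOrderNatAt f ρ : ℂ) * (1 / (s - ρ) - 1 / (c - ρ))) =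
        logDeriv h s - logDeriv h c := by
      rw [hlog s hs, hlog c hc]
      simp only [mul_sub, Finset.sum_sub_distrib]
      ring
    rw [this]
    exact hfin
  rw [Metric.tendsto_nhds]
  intro η hη
  obtain ⟨ε, hε, hεη⟩ : ∃ ε > 0, 64 * 9 * ε * ‖s - c‖ < η / 2 := by
    refine ⟨η / (2 * (64 * 9 * (‖s - c‖ + 1))), by positivity, ?_⟩
    rw [show 64 * 9 * (η / (2 * (64 * 9 * (‖s - c‖ + 1)))) * ‖s - c‖
      = η / 2 * (‖s - c‖ / (‖s - c‖ + 1)) by field_simp]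
    have : ‖s - c‖ / (‖s - c‖ + 1) < 1 := by
      rw [div_lt_one (by positivity)]; linarith
    nlinarith
  have hsmall : Tendsto (fun R : ℝ => 64 * (|Real.log ‖f c‖| + 1) * ‖s - c‖ / R ^ 2) atTop (nhds 0) :=
    tendsto_const_nhds.div_atTop (tendsto_pow_atTop (by norm_num))
  filter_upwards [key ε hε, hsmall.eventually_lt_const (show 0 < η / 2 by positivity),
    eventually_gt_atTop 0] with R h1 h2 h3
  rw [Real.dist_eq, sub_zero, abs_of_nonneg (norm_nonneg _)]
  refine h1.trans_lt ?_
  have : 64 * (ε * (3 * R) ^ 2 + (|Real.log ‖f c‖| + 1)) / R ^ 2 * ‖s - c‖ =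
    64 * 9 * ε * ‖s - c‖ + 64 * (|Real.log ‖f c‖| + 1) * ‖s - c‖ / R ^ 2 := by
    field_simp; ring
  rw [this]; linarith

lemma sum_range_char_eq_zero {N : ℕ} [NeZero N] {χ : DirichletCharacter ℂ N} (hχ : χ ≠ 1) :
    ∑ k ∈ Finset.range N, χ (k : ZMod N) = 0 := by
  rw [← MulChar.sum_eq_zero_of_ne_one hχ]
  refine Finset.sum_nbij' (fun k => (k : ZMod N)) (fun a => a.val) ?_ ?_ ?_ ?_ ?_
  · simp
  · intro a _; simpa using ZMod.val_lt a
  · intro k hk; exact ZMod.val_cast_of_lt (Finset.mem_range.1 hk)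
  · intro a _; simp
  · simp

lemma norm_sum_range_char_le {N : ℕ} [NeZero N] {χ : DirichletCharacter ℂ N} (hχ : χ ≠ 1) (n : ℕ) :
    ‖∑ k ∈ Finset.range n, χ (k : ZMod N)‖ ≤ N := by
  induction n using Nat.strong_induction_on with
  | _ n ih =>
    by_cases h : n < N
    · refine (norm_sum_le_of_le _ (fun k _ => χ.norm_le_one _)).trans ?_
      simp; exact_mod_cast h.le
    · obtain ⟨m, rfl⟩ := Nat.exists_eq_add_of_le (not_lt.1 h)
      rw [Finset.sum_range_add, sum_range_char_eq_zero hχ, zero_add]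
      have := ih m (by have := NeZero.pos N; omega)
      simpa using this

lemma norm_sum_Icc_char_le {N : ℕ} [NeZero N] {χ : DirichletCharacter ℂ N} (hχ : χ ≠ 1) (n : ℕ) :
    ‖∑ k ∈ Finset.Icc 1 n, χ (k : ZMod N)‖ ≤ N + 1 := by
  have h : ∑ k ∈ Finset.range (n + 1), χ (k : ZMod N) =
      χ 0 + ∑ k ∈ Finset.Icc 1 n, χ (k : ZMod N) := by
    rw [Finset.sum_range_succ']
    rw [add_comm]
    congr 1
    · simp
    · rw [Finset.range_eq_Ico, Finset.sum_Ico_add' (fun k : ℕ => χ (k : ZMod N)) 0 n 1]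
      rfl
  have h2 := norm_sum_range_char_le hχ (n + 1)
  have h3 : ∑ k ∈ Finset.Icc 1 n, χ (k : ZMod N) =
     (∑ k ∈ Finset.range (n + 1), χ (k : ZMod N)) - χ 0 := by rw [h]; ring
  rw [h3]
  exact (norm_sub_le _ _).trans (add_le_add h2 (χ.norm_le_one _))

/-- The summatory function of `χ`, cut off below `1`. -/
noncomputable def charSum {N : ℕ} (χ : DirichletCharacter ℂ N) : ℝ → ℂ :=
  Set.indicator (Set.Ioi 1) fun t => ∑ k ∈ Finset.Icc 1 ⌊t⌋₊, χ (k : ZMod N)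

lemma norm_charSum_le {N : ℕ} [NeZero N] {χ : DirichletCharacter ℂ N} (hχ : χ ≠ 1) (t : ℝ) :
    ‖charSum χ t‖ ≤ N + 1 := by
  unfold charSum
  rw [Set.indicator_apply]
  split_ifs
  · exact norm_sum_Icc_char_le hχ _
  · simp; positivity

lemma measurable_charSum {N : ℕ} (χ : DirichletCharacter ℂ N) : Measurable (charSum χ) := by
  unfold charSum
  refine Measurable.indicator ?_ measurableSet_Ioi
  exact (measurable_from_nat (f := fun n : ℕ => ∑ k ∈ Finset.Icc 1 n, χ (k : ZMod N))).comp
    Nat.measurable_floor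

lemma LFunction_eq_mellin {N : ℕ} [NeZero N] {χ : DirichletCharacter ℂ N} (hχ : χ ≠ 1) {s : ℂ}
    (hs : 0 < s.re) : DirichletCharacter.LFunction χ s = s * mellin (charSum χ) (-s) := by
  have hloc : MeasureTheory.LocallyIntegrableOn (charSum χ) (Set.Ioi 0) := by
    refine (MeasureTheory.LocallyIntegrable.mono (g := charSum χ) (f := fun _ => ((N : ℝ) + 1))
      (MeasureTheory.locallyIntegrable_const _)
      (measurable_charSum χ).aestronglyMeasurable ?_).locallyIntegrableOn _
    refine Eventually.of_forall fun t => ?_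
    rw [Real.norm_of_nonneg (by positivity)]
    exact norm_charSum_le hχ t
  have hd : ∀ z : ℂ, 0 < z.re → DifferentiableAt ℂ (fun s => s * mellin (charSum χ) (-s)) z := by
    intro z hz
    have h1 : DifferentiableAt ℂ (mellin (charSum χ)) (-z) := by
      refine mellin_differentiableAt_of_isBigO_rpow (a := 0) (b := (-z).re - 1) hloc ?_
        (by simpa using hz) ?_ (by linarith)
      · refine Asymptotics.IsBigO.of_bound (N + 1) (Eventually.of_forall fun t => ?_)
        simpa using norm_charSum_le hχ t
      · refine Asymptotics.IsBigO.of_bound 1 ?_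
        have : ∀ᶠ t : ℝ in nhdsWithin 0 (Set.Ioi 0), t < 1 :=
          nhdsWithin_le_nhds (eventually_lt_nhds (by norm_num))
        filter_upwards [this] with t ht
        have : charSum χ t = 0 := Set.indicator_of_notMem (by simpa using ht.le) _
        rw [this]; simp
    exact differentiableAt_id.mul (h1.comp z differentiableAt_id.neg)
  have hopen : IsOpen {z : ℂ | 0 < z.re} := isOpen_lt continuous_const Complex.continuous_re
  have hA : AnalyticOnNhd ℂ (fun s => s * mellin (charSum χ) (-s)) {z : ℂ | 0 < z.re} :=
    DifferentiableOn.analyticOnNhd (fun z hz => (hd z hz).differentiableWithinAt) hopen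
  have hL : AnalyticOnNhd ℂ (DirichletCharacter.LFunction χ) {z : ℂ | 0 < z.re} :=
    fun z _ => (DirichletCharacter.differentiable_LFunction hχ).analyticAt z
  refine hL.eqOn_of_preconnected_of_eventuallyEq hA
    (convex_halfSpace_re_gt 0).isPreconnected (z₀ := 2) (by simp) ?_ hs
  have : ∀ᶠ z : ℂ in nhds 2, 1 < z.re :=
    (Complex.continuous_re.tendsto 2).eventually (lt_mem_nhds (by simp))
  filter_upwards [this] with z hz
  rw [DirichletCharacter.LFunction_eq_LSeries χ hz,
    LSeries_eq_mul_integral (fun n => χ (n : ZMod N)) (r := 0) le_rfl (by linarith)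
      (DirichletCharacter.LSeriesSummable_of_one_lt_re χ hz) ?_]
  · congr 1
    rw [mellin]
    rw [← MeasureTheory.integral_indicator measurableSet_Ioi,
      ← MeasureTheory.integral_indicator measurableSet_Ioi]
    refine MeasureTheory.integral_congr_ae (Eventually.of_forall fun t => ?_)
    simp only [charSum, Set.indicator_apply, Set.mem_Ioi, smul_eq_mul]
    by_cases ht : 1 < t
    · rw [if_pos ht, if_pos (by linarith), if_pos ht, mul_comm]
      congr 2; ring
    · rw [if_neg ht, if_neg ht, mul_zero, ite_self]
  · refine Asymptotics.IsBigO.of_bound (N + 1) (Eventually.of_forall fun n => ?_)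
    simpa using norm_sum_Icc_char_le hχ n

lemma norm_LFunction_le {N : ℕ} [NeZero N] {χ : DirichletCharacter ℂ N} (hχ : χ ≠ 1) {s : ℂ}
    (hs : 1 / 2 ≤ s.re) : ‖DirichletCharacter.LFunction χ s‖ ≤ 2 * (N + 1) * ‖s‖ := by
  rw [LFunction_eq_mellin hχ (by linarith), norm_mul, mul_comm]
  gcongr
  rw [mellin]
  have h1 : ∀ t : ℝ, ‖(t : ℂ) ^ (-s - 1) • charSum χ t‖ ≤
      Set.indicator (Set.Ioi 1) (fun t : ℝ => (N + 1) * t ^ (-(3 / 2) : ℝ)) t := by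
    intro t
    simp only [charSum, Set.indicator_apply, Set.mem_Ioi, smul_eq_mul]
    split_ifs with ht
    · rw [norm_mul, mul_comm]
      have := norm_sum_Icc_char_le hχ ⌊t⌋₊
      gcongr
      rw [Complex.norm_cpow_eq_rpow_re_of_pos (by linarith)]
      apply Real.rpow_le_rpow_of_exponent_le ht.le
      simp; linarith
    · simp
  have hint : MeasureTheory.IntegrableOn (fun t : ℝ => ((N : ℝ) + 1) * t ^ (-(3 / 2) : ℝ))
      (Set.Ioi 1) := (integrableOn_Ioi_rpow_of_lt (by norm_num) (by norm_num)).const_mul _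
  refine (MeasureTheory.norm_integral_le_of_norm_le
    ((hint.integrable_indicator measurableSet_Ioi).integrableOn (s := Set.Ioi 0))
      (Eventually.of_forall h1)).trans ?_
  rw [MeasureTheory.setIntegral_indicator measurableSet_Ioi]
  have : Set.Ioi (0:ℝ) ∩ Set.Ioi 1 = Set.Ioi 1 := by
    ext x; simp only [Set.mem_inter_iff, Set.mem_Ioi]; constructor
    · exact fun h => h.2
    · exact fun h => ⟨by linarith, h⟩
  rw [this, MeasureTheory.integral_const_mul, integral_Ioi_rpow_of_lt (by norm_num) (by norm_num)]
  norm_num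
  linarith

lemma mul_log_le_mul_log {a b : ℝ} (ha : 1 ≤ a) (hab : a ≤ b) : a * Real.log a ≤ b * Real.log b :=
  mul_le_mul hab (Real.log_le_log (by linarith) hab) (Real.log_nonneg ha) (by linarith)

lemma norm_Gamma_le_Gamma_re {z : ℂ} (hz : 0 < z.re) : ‖Complex.Gamma z‖ ≤ Real.Gamma z.re := by
  rw [Complex.Gamma_eq_integral hz, Complex.GammaIntegral, Real.Gamma_eq_integral hz]
  refine MeasureTheory.norm_integral_le_of_norm_le (Real.GammaIntegral_convergent hz) ?_
  refine (MeasureTheory.ae_restrict_iff' measurableSet_Ioi).2 (Eventually.of_forall fun t ht => ?_)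
  rw [norm_mul, Complex.norm_cpow_eq_rpow_re_of_pos ht]
  rw [Complex.norm_real, Real.norm_of_nonneg (Real.exp_pos _).le]
  simp

lemma Gamma_le_growth {x : ℝ} (hx : 1 / 4 ≤ x) :
    Real.Gamma x ≤ 16 * Real.exp ((x + 4) * Real.log (x + 4)) := by
  have h1 : Real.Gamma (x + 2) = (x + 1) * (x * Real.Gamma x) := by
    rw [← Real.Gamma_add_one (by linarith), ← Real.Gamma_add_one (by linarith)]
    ring_nf
  have hpos : 0 < Real.Gamma x := Real.Gamma_pos_of_pos (by linarith)
  have h2 : Real.Gamma x ≤ 16 * Real.Gamma (x + 2) := by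
    rw [h1]
    nlinarith [mul_le_mul_of_nonneg_right hx hpos.le]
  have h3 : Real.Gamma (x + 2) ≤ Real.Gamma ((⌈x⌉₊ + 1 : ℕ) + 1) := by
    have hc := Nat.le_ceil x
    apply Real.Gamma_strictMonoOn_Ici.monotoneOn
    · simp; linarith
    · simp; linarith [Nat.cast_nonneg (α := ℝ) ⌈x⌉₊]
    · push_cast; linarith
  rw [Real.Gamma_nat_eq_factorial] at h3
  have h4 : ((⌈x⌉₊ + 1).factorial : ℝ) ≤ (x + 4) ^ ((⌈x⌉₊ : ℝ) + 1) := by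
    have hc := Nat.ceil_lt_add_one (show 0 ≤ x by linarith)
    calc ((⌈x⌉₊ + 1).factorial : ℝ) ≤ ((⌈x⌉₊ + 1 : ℕ) : ℝ) ^ (⌈x⌉₊ + 1) := by
          exact_mod_cast Nat.factorial_le_pow _
      _ ≤ (x + 4) ^ (⌈x⌉₊ + 1) := by
          gcongr; push_cast; linarith
      _ = _ := by rw [← Real.rpow_natCast]; push_cast; rfl
  have h5 : (x + 4) ^ ((⌈x⌉₊ : ℝ) + 1) ≤ Real.exp ((x + 4) * Real.log (x + 4)) := by
    rw [Real.rpow_def_of_pos (by linarith)]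
    apply Real.exp_le_exp.2
    rw [mul_comm]
    have hc := Nat.ceil_lt_add_one (show 0 ≤ x by linarith)
    have := Real.log_nonneg (show 1 ≤ x + 4 by linarith)
    exact mul_le_mul_of_nonneg_right (by linarith) this
  linarith

lemma norm_Gammaℝ_le {z : ℂ} (hz : 1 / 2 ≤ z.re) :
    ‖Complex.Gammaℝ z‖ ≤ 16 * Real.exp ((‖z‖ + 4) * Real.log (‖z‖ + 4)) := by
  have hre : (z / 2).re = z.re / 2 := by simp
  rw [Complex.Gammaℝ_def, norm_mul]
  have h1 : ‖(Real.pi : ℂ) ^ (-z / 2)‖ ≤ 1 := by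
    rw [Complex.norm_cpow_eq_rpow_re_of_pos Real.pi_pos]
    apply Real.rpow_le_one_of_one_le_of_nonpos (by linarith [Real.pi_gt_three])
    simp; linarith
  have h2 := norm_Gamma_le_Gamma_re (z := z / 2) (by rw [hre]; linarith)
  rw [hre] at h2
  have h3 := Gamma_le_growth (x := z.re / 2) (by linarith)
  have h4 : z.re / 2 ≤ ‖z‖ := by linarith [Complex.re_le_norm z, norm_nonneg z]
  have h5 : Real.exp ((z.re / 2 + 4) * Real.log (z.re / 2 + 4)) ≤
      Real.exp ((‖z‖ + 4) * Real.log (‖z‖ + 4)) := by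
    exact Real.exp_le_exp.2 (mul_log_le_mul_log (by linarith) (by linarith))
  calc _ ≤ 1 * ‖Complex.Gamma (z / 2)‖ := by gcongr
    _ ≤ _ := by linarith

section
open DirichletCharacter

lemma gammaFactor_cases {N : ℕ} (χ : DirichletCharacter ℂ N) :
    ∃ a : ℝ, (a = 0 ∨ a = 1) ∧ ∀ s : ℂ, χ.gammaFactor s = Complex.Gammaℝ (s + a) := by
  rcases χ.even_or_odd with h | h
  · exact ⟨0, Or.inl rfl, fun s => by simp [h.gammaFactor_def]⟩
  · exact ⟨1, Or.inr rfl, fun s => by simp [h.gammaFactor_def]⟩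

lemma completed_eq_mul {N : ℕ} [NeZero N] (χ : DirichletCharacter ℂ N) {s : ℂ}
    (hs : 0 < s.re) : completedLFunction χ s = LFunction χ s * χ.gammaFactor s := by
  have h0 : s ≠ 0 := by rintro rfl; simp at hs
  obtain ⟨a, ha, hg⟩ := gammaFactor_cases χ
  rw [LFunction_eq_completed_div_gammaFactor χ s (Or.inl h0), div_mul_cancel₀]
  rw [hg]
  apply Complex.Gammaℝ_ne_zero_of_re_pos
  rcases ha with rfl | rfl <;> simp <;> linarith

lemma norm_completed_le_right {N : ℕ} [NeZero N] {χ : DirichletCharacter ℂ N} (hχ : χ ≠ 1) {s : ℂ}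
    (hs : 1 / 2 ≤ s.re) : ‖completedLFunction χ s‖ ≤
      2 * (N + 1) * ‖s‖ * (16 * Real.exp ((‖s‖ + 5) * Real.log (‖s‖ + 5))) := by
  rw [completed_eq_mul χ (by linarith), norm_mul]
  gcongr
  · exact norm_LFunction_le hχ hs
  · obtain ⟨a, ha, hg⟩ := gammaFactor_cases χ
    rw [hg]
    have h0 : 0 ≤ a := by rcases ha with rfl | rfl <;> norm_num
    have h1 : a ≤ 1 := by rcases ha with rfl | rfl <;> norm_num
    refine (norm_Gammaℝ_le (by simp; linarith)).trans ?_
    have h2 : ‖s + a‖ ≤ ‖s‖ + 1 := (norm_add_le _ _).trans (by simpa [abs_of_nonneg h0] using h1)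
    have h3 := mul_log_le_mul_log (a := ‖s + a‖ + 4) (b := ‖s‖ + 5)
      (by linarith [norm_nonneg (s + a)]) (by linarith)
    gcongr

lemma norm_completed_le {N : ℕ} [NeZero N] {χ : DirichletCharacter ℂ N} (hχ : χ ≠ 1)
    (hp : χ.IsPrimitive) : ∃ C : ℝ, 0 < C ∧ ∀ s, ‖completedLFunction χ s‖ ≤
      C * Real.exp (C * ((‖s‖ + 6) * Real.log (‖s‖ + 6))) := by
  have hχ' : χ⁻¹ ≠ 1 := inv_ne_one.2 hχ
  have hN : (0:ℝ) < N := by exact_mod_cast NeZero.pos N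
  have hN1 : (1:ℝ) ≤ N := by exact_mod_cast NeZero.pos N
  have hlogN := Real.log_nonneg hN1
  set W := ‖χ.rootNumber‖
  set E : ℝ → ℝ := fun r => (r + 6) * Real.log (r + 6)
  have hE : ∀ r, 0 ≤ r → r + 6 ≤ E r := by
    intro r hr
    have : 1 ≤ Real.log (r + 6) := by
      rw [Real.le_log_iff_exp_le (by linarith)]
      linarith [Real.exp_one_lt_d9]
    nlinarith
  have base : ∀ (ψ : DirichletCharacter ℂ N) (_ : ψ ≠ 1) (s : ℂ) (r : ℝ), 1 / 2 ≤ s.re →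
      ‖s‖ ≤ r + 1 → 0 ≤ r → ‖completedLFunction ψ s‖ ≤ 32 * (N + 1) * Real.exp (2 * E r) := by
    intro ψ hψ s r hs hr hr0
    refine (norm_completed_le_right hψ hs).trans ?_
    have h1 : ‖s‖ ≤ Real.exp (E r) := by
      have := Real.add_one_le_exp (E r)
      linarith [hE r hr0]
    have h2 : Real.exp ((‖s‖ + 5) * Real.log (‖s‖ + 5)) ≤ Real.exp (E r) := by
      exact Real.exp_le_exp.2 (mul_log_le_mul_log (by linarith [norm_nonneg s]) (by linarith))
    calc _ ≤ 2 * (N + 1) * Real.exp (E r) * (16 * Real.exp (E r)) := by gcongr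
      _ = _ := by rw [two_mul (E r), Real.exp_add]; ring
  refine ⟨32 * (N + 1) * (W + 1) + (2 + Real.log N), by positivity, fun s => ?_⟩
  have hb : 32 * (N + 1) * (W + 1) * Real.exp ((2 + Real.log N) * E ‖s‖) ≤
      (32 * (N + 1) * (W + 1) + (2 + Real.log N)) *
        Real.exp ((32 * (N + 1) * (W + 1) + (2 + Real.log N)) * E ‖s‖) := by
    have hEs : 0 ≤ E ‖s‖ := by linarith [hE _ (norm_nonneg s), norm_nonneg s]
    have : (0:ℝ) ≤ 32 * (N + 1) * (W + 1) := by positivity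
    apply mul_le_mul (by linarith) (Real.exp_le_exp.2 ?_) (Real.exp_pos _).le (by linarith)
    exact mul_le_mul_of_nonneg_right (by linarith) hEs
  refine le_trans ?_ hb
  have hEs : 0 ≤ E ‖s‖ := by linarith [hE _ (norm_nonneg s), norm_nonneg s]
  have hW : 0 ≤ W := norm_nonneg _
  by_cases hs : 1 / 2 ≤ s.re
  · refine (base χ hχ s ‖s‖ hs (by linarith) (norm_nonneg s)).trans ?_
    have e1 : Real.exp (2 * E ‖s‖) ≤ Real.exp ((2 + Real.log N) * E ‖s‖) := by
      apply Real.exp_le_exp.2; nlinarith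
    calc _ ≤ 32 * ((N:ℝ) + 1) * 1 * Real.exp ((2 + Real.log N) * E ‖s‖) := by
          rw [mul_one]; gcongr
      _ ≤ _ := by gcongr; linarith
  · push Not at hs
    have hfe := hp.completedLFunction_one_sub (1 - s)
    rw [sub_sub_cancel] at hfe
    rw [hfe, norm_mul, norm_mul]
    have h1 := base χ⁻¹ hχ' (1 - s) ‖s‖ (by simp; linarith)
      ((norm_sub_le _ _).trans (by simp; linarith)) (norm_nonneg s)
    have h2 : ‖(N : ℂ) ^ (1 - s - 1 / 2)‖ ≤ Real.exp (Real.log N * E ‖s‖) := by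
      rw [Complex.norm_natCast_cpow_of_pos (NeZero.pos N), Real.rpow_def_of_pos hN]
      apply Real.exp_le_exp.2
      have : (1 - s - 1 / 2).re ≤ E ‖s‖ := by
        have h3 := Complex.abs_re_le_norm s
        have h4 := neg_abs_le s.re
        have := hE _ (norm_nonneg s)
        simp
        linarith
      gcongr
    calc _ ≤ Real.exp (Real.log N * E ‖s‖) * W * (32 * (N + 1) * Real.exp (2 * E ‖s‖)) := by
          gcongr
      _ = 32 * (N + 1) * W * Real.exp ((2 + Real.log N) * E ‖s‖) := by
          rw [add_mul, Real.exp_add]; ring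
      _ ≤ _ := by gcongr; linarith

lemma completed_growth {N : ℕ} [NeZero N] {χ : DirichletCharacter ℂ N} (hχ : χ ≠ 1)
    (hp : χ.IsPrimitive) (c : ℂ) : ∀ ε > 0, ∀ᶠ R : ℝ in atTop, ∀ z, ‖z - c‖ ≤ R →
      ‖completedLFunction χ z‖ ≤ Real.exp (ε * R ^ 2) := by
  obtain ⟨C, hC, hb⟩ := norm_completed_le hχ hp
  intro ε hε
  have hlog : ∀ᶠ x : ℝ in atTop, Real.log x ≤ ε / (8 * C) * x := by
    have := Real.isLittleO_log_id_atTop.bound (show 0 < ε / (8 * C) by positivity)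
    filter_upwards [this, eventually_ge_atTop 1] with x hx h1
    simpa [abs_of_nonneg (Real.log_nonneg h1), abs_of_nonneg (show 0 ≤ x by linarith)] using hx
  have hsq : ∀ᶠ R : ℝ in atTop, Real.log C ≤ ε / 2 * R ^ 2 :=
    ((tendsto_pow_atTop (two_ne_zero)).const_mul_atTop (by positivity)).eventually_ge_atTop _
  have h2 : Tendsto (fun R : ℝ => R + (‖c‖ + 6)) atTop atTop :=
    tendsto_atTop_add_const_right _ _ tendsto_id
  filter_upwards [h2.eventually hlog, hsq, eventually_ge_atTop (‖c‖ + 6)] with R h3 h4 h5 z hz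
  have h6 : ‖z‖ ≤ R + ‖c‖ := by
    have := norm_add_le (z - c) c
    rw [sub_add_cancel] at this; linarith
  refine (hb z).trans ?_
  rw [← Real.exp_log hC, ← Real.exp_add]
  rw [Real.exp_log hC]
  apply Real.exp_le_exp.2
  have h7 : (‖z‖ + 6) * Real.log (‖z‖ + 6) ≤ (R + (‖c‖ + 6)) * (ε / (8 * C) * (R + (‖c‖ + 6))) := by
    have : 0 ≤ Real.log (‖z‖ + 6) := Real.log_nonneg (by linarith [norm_nonneg z])
    have h8 : Real.log (‖z‖ + 6) ≤ Real.log (R + (‖c‖ + 6)) :=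
      Real.log_le_log (by positivity) (by linarith)
    have h9 : 0 ≤ ‖c‖ := norm_nonneg c
    apply mul_le_mul (by linarith) (h8.trans h3) this (by linarith)
  have h9 : 0 ≤ ‖c‖ := norm_nonneg c
  have h10 : C * ((R + (‖c‖ + 6)) * (ε / (8 * C) * (R + (‖c‖ + 6)))) ≤ ε / 2 * R ^ 2 := by
    have : C * ((R + (‖c‖ + 6)) * (ε / (8 * C) * (R + (‖c‖ + 6)))) = ε / 8 * (R + (‖c‖ + 6)) ^ 2 := by
      field_simp
    rw [this]
    have : (R + (‖c‖ + 6)) ^ 2 ≤ (2 * R) ^ 2 :=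
      pow_le_pow_left₀ (by linarith) (by linarith) 2
    nlinarith
  have := mul_le_mul_of_nonneg_left h7 hC.le
  linarith

end

noncomputable def digammaR (x : ℝ) : ℝ := deriv (fun y => Real.log (Real.Gamma y)) x

lemma Gamma_differentiableAt_pos {x : ℝ} (hx : 0 < x) : DifferentiableAt ℝ Real.Gamma x :=
  Real.differentiableAt_Gamma (fun m => by
    have : (0 : ℝ) ≤ m := Nat.cast_nonneg m
    linarith)

lemma digamma_ofReal {x : ℝ} (hx : 0 < x) : Complex.digamma x = (digammaR x : ℂ) := by
  have h1 : HasDerivAt Real.Gamma (deriv Real.Gamma x) x :=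
    (Gamma_differentiableAt_pos hx).hasDerivAt
  have h2 : HasDerivAt (fun y : ℝ => ((Real.Gamma y : ℝ) : ℂ)) ((deriv Real.Gamma x : ℝ) : ℂ) x :=
    h1.ofReal_comp
  have h3 : HasDerivAt Complex.Gamma (deriv Complex.Gamma x) (x : ℂ) :=
    (Complex.differentiableAt_Gamma _ (fun m h => by
      have h' := congrArg Complex.re h
      have : (0 : ℝ) ≤ m := Nat.cast_nonneg m
      simp at h'
      linarith)).hasDerivAt
  have h4 := h3.comp_ofReal
  have h5 : deriv Complex.Gamma x = ((deriv Real.Gamma x : ℝ) : ℂ) := by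
    refine h4.unique ?_
    simpa [Complex.Gamma_ofReal] using h2
  rw [Complex.digamma_def, logDeriv_apply, h5, Complex.Gamma_ofReal, digammaR,
    deriv.log h1.differentiableAt (Real.Gamma_pos_of_pos hx).ne']
  push_cast
  rfl

lemma digammaR_add_one {x : ℝ} (hx : 0 < x) : digammaR (x + 1) = digammaR x + x⁻¹ := by
  have h := Complex.digamma_apply_add_one (x : ℂ) (fun m h => by
      have h' := congrArg Complex.re h
      have : (0 : ℝ) ≤ m := Nat.cast_nonneg m
      simp at h'
      linarith)
  rw [digamma_ofReal hx, show (x : ℂ) + 1 = ((x + 1 : ℝ) : ℂ) by push_cast; ring,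
    digamma_ofReal (by linarith)] at h
  exact_mod_cast h

lemma logGamma_differentiableAt {x : ℝ} (hx : 0 < x) :
    DifferentiableAt ℝ (fun y => Real.log (Real.Gamma y)) x :=
  (Gamma_differentiableAt_pos hx).log (Real.Gamma_pos_of_pos hx).ne'

lemma logGamma_add_one {x : ℝ} (hx : 0 < x) :
    Real.log (Real.Gamma (x + 1)) = Real.log x + Real.log (Real.Gamma x) := by
  rw [Real.Gamma_add_one hx.ne', Real.log_mul hx.ne' (Real.Gamma_pos_of_pos hx).ne']

lemma digammaR_le {x : ℝ} (hx : 0 < x) : digammaR x ≤ Real.log x := by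
  have h := Real.convexOn_log_Gamma.deriv_le_slope (x := x) (y := x + 1) hx
    (show (0 : ℝ) < x + 1 by linarith) (by linarith) (logGamma_differentiableAt hx)
  have h2 : slope (Real.log ∘ Real.Gamma) x (x + 1) = Real.log x := by
    simp [slope_def_field, logGamma_add_one hx]
  rw [h2] at h
  exact h

lemma le_digammaR {x : ℝ} (hx : 0 < x) : Real.log x - x⁻¹ ≤ digammaR x := by
  have h := Real.convexOn_log_Gamma.slope_le_deriv (x := x) (y := x + 1) hx
    (show (0 : ℝ) < x + 1 by linarith) (by linarith) (logGamma_differentiableAt (by linarith))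
  have h2 : slope (Real.log ∘ Real.Gamma) x (x + 1) = Real.log x := by
    simp [slope_def_field, logGamma_add_one hx]
  rw [h2] at h
  have h3 : Real.log x ≤ digammaR (x + 1) := h
  rw [digammaR_add_one hx] at h3
  linarith

lemma digammaR_add_nat {x : ℝ} (hx : 0 < x) (n : ℕ) :
    digammaR (x + n) = digammaR x + ∑ k ∈ Finset.range n, (x + k)⁻¹ := by
  induction n with
  | zero => simp
  | succ n ih =>
    rw [Finset.sum_range_succ, ← add_assoc, ← ih, ← digammaR_add_one (by positivity)]
    push_cast
    ring_nf

lemma tendsto_log_add_nat (x : ℝ) (hx : 0 < x) :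
    Tendsto (fun n : ℕ => Real.log (x + n) - Real.log n) atTop (nhds 0) := by
  have h1 : Tendsto (fun n : ℕ => Real.log (1 + x / n)) atTop (nhds (Real.log (1 + 0))) := by
    refine Tendsto.log ?_ (by norm_num)
    exact tendsto_const_nhds.add (tendsto_const_div_atTop_nhds_zero_nat x)
  simp only [add_zero, Real.log_one] at h1
  refine h1.congr' ?_
  filter_upwards [eventually_gt_atTop 0] with n hn
  have hn' : (0 : ℝ) < n := by exact_mod_cast hn
  rw [← Real.log_div (by positivity) hn'.ne']
  congr 1
  field_simp
  ring

lemma tendsto_digammaR_sub_log (x : ℝ) (hx : 0 < x) :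
    Tendsto (fun n : ℕ => digammaR (x + n) - Real.log n) atTop (nhds 0) := by
  have h1 := tendsto_log_add_nat x hx
  have h2 : Tendsto (fun n : ℕ => (x + (n : ℝ))⁻¹) atTop (nhds 0) :=
    tendsto_inv_atTop_zero.comp
      (tendsto_atTop_add_const_left _ _ tendsto_natCast_atTop_atTop)
  have h3 := h1.sub h2
  simp only [sub_zero] at h3
  refine tendsto_of_tendsto_of_tendsto_of_le_of_le h3 h1 (fun n => ?_) (fun n => ?_)
  · have := le_digammaR (x := x + n) (by positivity)
    simp only
    linarith
  · have := digammaR_le (x := x + n) (by positivity)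
    simp only
    linarith

/-- Difference series of the digamma function on the positive reals. -/
lemma tendsto_digammaR_series {x y : ℝ} (hx : 0 < x) (hy : 0 < y) :
    Tendsto (fun n : ℕ => ∑ k ∈ Finset.range n, ((y + k)⁻¹ - (x + k)⁻¹)) atTop
      (nhds (digammaR x - digammaR y)) := by
  have h := (tendsto_digammaR_sub_log y hy).sub (tendsto_digammaR_sub_log x hx)
  have h2 := h.const_add (digammaR x - digammaR y)
  simp only [sub_zero, add_zero] at h2
  refine h2.congr (fun n => ?_)
  rw [digammaR_add_nat hx, digammaR_add_nat hy, Finset.sum_sub_distrib]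
  ring

lemma norm_inv_sub_inv_le {y : ℝ} (hy : 0 < y) {s : ℂ} {r R : ℝ} (hr : 0 < r) (hs : r ≤ s.re)
    (hR : ‖s - y‖ ≤ R) (k : ℕ) :
    ‖((y : ℂ) + k)⁻¹ - (s + k)⁻¹‖ ≤ R * ((min y r + k)⁻¹ ^ 2) := by
  have hk : (0 : ℝ) ≤ k := Nat.cast_nonneg k
  have hm : 0 < min y r := lt_min hy hr
  have h1 : min y r + k ≤ ‖(y : ℂ) + k‖ := by
    calc min y r + k ≤ y + k := by gcongr; exact min_le_left _ _
      _ = ((y : ℂ) + k).re := by simp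
      _ ≤ _ := Complex.re_le_norm _
  have h2 : min y r + k ≤ ‖s + k‖ := by
    calc min y r + k ≤ s.re + k := by gcongr; exact (min_le_right _ _).trans hs
      _ = (s + k).re := by simp
      _ ≤ _ := Complex.re_le_norm _
  have p1 : 0 < min y r + k := by positivity
  have n1 : (y : ℂ) + k ≠ 0 := norm_pos_iff.1 (p1.trans_le h1)
  have n2 : s + k ≠ 0 := norm_pos_iff.1 (p1.trans_le h2)
  have : ((y : ℂ) + k)⁻¹ - (s + k)⁻¹ = (s - y) * (((y : ℂ) + k)⁻¹ * (s + k)⁻¹) := by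
    field_simp; ring
  rw [this, norm_mul, norm_mul, norm_inv, norm_inv, pow_two]
  have hR0 : 0 ≤ R := (norm_nonneg _).trans hR
  gcongr

lemma summable_inv_add_sq {r : ℝ} (hr : 0 < r) : Summable (fun k : ℕ => ((r + k)⁻¹) ^ 2) := by
  have h := (Real.summable_one_div_nat_add_rpow r 2).2 (by norm_num)
  refine h.congr (fun k => ?_)
  rw [abs_of_pos (by positivity), add_comm]
  simp

/-- Difference series of the digamma function in the right half plane. -/
theorem hasSum_digamma {y : ℝ} (hy : 0 < y) {s : ℂ} (hs : 0 < s.re) :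
    HasSum (fun k : ℕ => ((y : ℂ) + k)⁻¹ - (s + k)⁻¹)
      (Complex.digamma s - Complex.digamma y) := by
  have hsum : ∀ z : ℂ, 0 < z.re → Summable (fun k : ℕ => ((y : ℂ) + k)⁻¹ - (z + k)⁻¹) := by
    intro z hz
    exact Summable.of_norm_bounded ((summable_inv_add_sq (lt_min hy hz)).mul_left ‖z - y‖)
      (fun k => norm_inv_sub_inv_le hy hz le_rfl le_rfl k)
  have hU : IsOpen {z : ℂ | 0 < z.re} := isOpen_lt continuous_const Complex.continuous_re
  have hF : DifferentiableOn ℂ (fun z : ℂ => ∑' k : ℕ, (((y : ℂ) + k)⁻¹ - (z + k)⁻¹))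
      {z : ℂ | 0 < z.re} := by
    intro z hz
    have hz' : 0 < z.re := hz
    set V : Set ℂ := Metric.ball z (z.re / 2) with hV
    have hVre : ∀ w ∈ V, z.re / 2 ≤ w.re := by
      intro w hw
      have h1 : ‖w - z‖ < z.re / 2 := by simpa [hV, dist_eq_norm] using hw
      have h2 := (Complex.abs_re_le_norm (w - z)).trans h1.le
      rw [abs_le] at h2
      simp at h2
      linarith [h2.1]
    have hd : DifferentiableOn ℂ (fun z : ℂ => ∑' k : ℕ, (((y : ℂ) + k)⁻¹ - (z + k)⁻¹)) V := by
      refine Complex.differentiableOn_tsum_of_summable_norm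
        (u := fun k : ℕ => (‖z - y‖ + z.re / 2) * ((min y (z.re / 2) + k)⁻¹ ^ 2))
        ((summable_inv_add_sq (lt_min hy (by linarith))).mul_left _) ?_ Metric.isOpen_ball ?_
      · intro k w hw
        have : w + k ≠ 0 := by
          intro h
          have := congrArg Complex.re h
          have h3 := hVre w hw
          have hk : (0 : ℝ) ≤ k := Nat.cast_nonneg k
          simp at this
          linarith
        have h4 : DifferentiableAt ℂ (fun z : ℂ => z + k) w := by fun_prop
        exact ((differentiableAt_const _).sub (h4.fun_inv this)).differentiableWithinAt
      · intro k w hw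
        refine norm_inv_sub_inv_le hy (by linarith) (hVre w hw) ?_ k
        have h1 : ‖w - z‖ < z.re / 2 := by simpa [hV, dist_eq_norm] using hw
        calc ‖w - y‖ = ‖(w - z) + (z - y)‖ := by ring_nf
          _ ≤ ‖w - z‖ + ‖z - y‖ := norm_add_le _ _
          _ ≤ _ := by linarith
    exact (hd.differentiableAt (Metric.isOpen_ball.mem_nhds
      (Metric.mem_ball_self (by linarith)))).differentiableWithinAt
  have hG : DifferentiableOn ℂ (fun z : ℂ => Complex.digamma z - Complex.digamma y)
      {z : ℂ | 0 < z.re} := by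
    intro z hz
    have hz' : 0 < z.re := hz
    have hpole : ∀ w : ℂ, 0 < w.re → ∀ m : ℕ, w ≠ -m := by
      intro w hw m h
      have h' := congrArg Complex.re h
      have : (0 : ℝ) ≤ m := Nat.cast_nonneg m
      simp at h'
      linarith
    have hΓ : DifferentiableOn ℂ Complex.Gamma {z : ℂ | 0 < z.re} := fun w hw =>
      (Complex.differentiableAt_Gamma w (hpole w hw)).differentiableWithinAt
    have h1 : DifferentiableAt ℂ (deriv Complex.Gamma) z :=
      (hΓ.deriv hU).differentiableAt (hU.mem_nhds hz)
    have h2 : DifferentiableAt ℂ Complex.Gamma z := Complex.differentiableAt_Gamma z (hpole z hz')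
    have h3 : Complex.Gamma z ≠ 0 := Complex.Gamma_ne_zero (hpole z hz')
    exact ((h1.div h2 h3).sub_const _).differentiableWithinAt
  have hpre : IsPreconnected {z : ℂ | 0 < z.re} :=
    (convex_halfSpace_re_gt 0).isPreconnected
  have heq := (hF.analyticOnNhd hU).eqOn_of_preconnected_of_frequently_eq (hG.analyticOnNhd hU)
    hpre (z₀ := (1 : ℂ)) (by simp) ?_
  · have := heq (show s ∈ {z : ℂ | 0 < z.re} from hs)
    simp only at this
    rw [← this]
    exact (hsum s hs).hasSum
  · have key : ∀ x : ℝ, 0 < x → (∑' k : ℕ, (((y : ℂ) + k)⁻¹ - ((x : ℂ) + k)⁻¹)) =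
        Complex.digamma x - Complex.digamma y := by
      intro x hx
      refine tendsto_nhds_unique (hsum x (by simpa)).hasSum.tendsto_sum_nat ?_
      rw [digamma_ofReal hx, digamma_ofReal hy]
      have := (Complex.continuous_ofReal.tendsto _).comp (tendsto_digammaR_series hx hy)
      push_cast at this
      refine this.congr (fun n => ?_)
      simp
    have ht : Tendsto (fun n : ℕ => (((1 : ℝ) + 1 / ((n : ℝ) + 1) : ℝ) : ℂ)) atTop
        (nhdsWithin 1 {1}ᶜ) := by
      refine tendsto_nhdsWithin_iff.2 ⟨?_, ?_⟩
      · have h1 : Tendsto (fun n : ℕ => (1 : ℝ) + 1 / ((n : ℝ) + 1)) atTop (nhds (1 + 0)) :=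
          tendsto_const_nhds.add tendsto_one_div_add_atTop_nhds_zero_nat
        have := (Complex.continuous_ofReal.tendsto _).comp h1
        simpa [Function.comp_def] using this
      · refine Eventually.of_forall (fun n => ?_)
        simp only [Set.mem_compl_iff, Set.mem_singleton_iff]
        intro h
        have h' : (1 : ℝ) + 1 / ((n : ℝ) + 1) = 1 := by exact_mod_cast h
        have : (0 : ℝ) < 1 / ((n : ℝ) + 1) := by positivity
        linarith
    refine ht.frequently (Frequently.of_forall (fun n => ?_))
    exact key _ (by positivity)

section
open DirichletCharacter

/-- The Dirichlet series `∑ Λ(n) χ(n) n^{-s}`. -/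
noncomputable def mangoldtSeries {N : ℕ} (χ : DirichletCharacter ℂ N) (s : ℂ) : ℂ :=
  LSeries (fun n : ℕ => χ (n : ZMod N) * (ArithmeticFunction.vonMangoldt n : ℂ)) s

/-- The real Dirichlet series `∑ Λ(n) n^{-σ}`. -/
noncomputable def mangoldtMajorant (σ : ℝ) : ℝ :=
  ∑' n : ℕ, ArithmeticFunction.vonMangoldt n * (n : ℝ) ^ (-σ)

lemma norm_term_vonMangoldt {N : ℕ} (χ : DirichletCharacter ℂ N) (s : ℂ) (n : ℕ) :
    ‖LSeries.term (fun n : ℕ => χ (n : ZMod N) * (ArithmeticFunction.vonMangoldt n : ℂ)) s n‖ ≤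
      ArithmeticFunction.vonMangoldt n * (n : ℝ) ^ (-s.re) := by
  rcases Nat.eq_zero_or_pos n with rfl | hn
  · simp
  · rw [LSeries.term_of_ne_zero hn.ne', norm_div, Complex.norm_natCast_cpow_of_pos hn,
      Real.rpow_neg (by positivity), norm_mul, div_eq_mul_inv]
    have h1 := DirichletCharacter.norm_le_one χ (n : ZMod N)
    have h2 : ‖((ArithmeticFunction.vonMangoldt n : ℝ) : ℂ)‖ =
        ArithmeticFunction.vonMangoldt n := by
      rw [Complex.norm_real, Real.norm_of_nonneg ArithmeticFunction.vonMangoldt_nonneg]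
    rw [h2]
    gcongr
    have := ArithmeticFunction.vonMangoldt_nonneg (n := n)
    nlinarith

lemma summable_mangoldtMajorant {σ : ℝ} (hσ : 1 < σ) :
    Summable (fun n : ℕ => ArithmeticFunction.vonMangoldt n * (n : ℝ) ^ (-σ)) := by
  have h := (ArithmeticFunction.LSeriesSummable_vonMangoldt (s := (σ : ℂ)) (by simpa)).norm
  refine h.congr (fun n => ?_)
  rcases Nat.eq_zero_or_pos n with rfl | hn
  · simp
  · rw [LSeries.term_of_ne_zero hn.ne', norm_div, Complex.norm_natCast_cpow_of_pos hn,
      Real.rpow_neg (by positivity), Complex.norm_real,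
      Real.norm_of_nonneg ArithmeticFunction.vonMangoldt_nonneg, div_eq_mul_inv]
    simp

lemma mangoldtMajorant_nonneg (σ : ℝ) : 0 ≤ mangoldtMajorant σ :=
  tsum_nonneg (fun n => mul_nonneg ArithmeticFunction.vonMangoldt_nonneg (by positivity))

lemma mangoldtMajorant_anti {σ τ : ℝ} (hσ : 1 < σ) (h : σ ≤ τ) :
    mangoldtMajorant τ ≤ mangoldtMajorant σ := by
  refine (summable_mangoldtMajorant (hσ.trans_le h)).tsum_le_tsum (fun n => ?_)
    (summable_mangoldtMajorant hσ)
  rcases Nat.eq_zero_or_pos n with rfl | hn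
  · simp
  · have : (1 : ℝ) ≤ n := by exact_mod_cast hn
    have h0 := ArithmeticFunction.vonMangoldt_nonneg (n := n)
    gcongr

lemma norm_mangoldtSeries_le {N : ℕ} (χ : DirichletCharacter ℂ N) {s : ℂ} (hs : 1 < s.re) :
    ‖mangoldtSeries χ s‖ ≤ mangoldtMajorant s.re :=
  tsum_of_norm_bounded (summable_mangoldtMajorant hs).hasSum (norm_term_vonMangoldt χ s)

lemma logDeriv_LFunction_eq {N : ℕ} [NeZero N] (χ : DirichletCharacter ℂ N) {s : ℂ}
    (hs : 1 < s.re) : logDeriv (LFunction χ) s = -mangoldtSeries χ s := by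
  have h : mangoldtSeries χ s = _ := LSeries_twist_vonMangoldt_eq χ hs
  rw [h, logDeriv_apply,
    deriv_LFunction_eq_deriv_LSeries χ hs, LFunction_eq_LSeries χ hs, neg_div, neg_neg]

/-- The shift in the gamma factor. -/
noncomputable def gammaShift {N : ℕ} (χ : DirichletCharacter ℂ N) : ℝ :=
  (gammaFactor_cases χ).choose

lemma gammaShift_nonneg {N : ℕ} (χ : DirichletCharacter ℂ N) : 0 ≤ gammaShift χ := by
  rcases (gammaFactor_cases χ).choose_spec.1 with h | h <;> rw [gammaShift, h]
  norm_num

lemma gammaShift_le_one {N : ℕ} (χ : DirichletCharacter ℂ N) : gammaShift χ ≤ 1 := by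
  rcases (gammaFactor_cases χ).choose_spec.1 with h | h <;> rw [gammaShift, h]
  norm_num

lemma gammaFactor_eq {N : ℕ} (χ : DirichletCharacter ℂ N) (s : ℂ) :
    χ.gammaFactor s = Complex.Gammaℝ (s + gammaShift χ) :=
  (gammaFactor_cases χ).choose_spec.2 s

lemma gammaFactor_ne_zero {N : ℕ} (χ : DirichletCharacter ℂ N) {s : ℂ} (hs : 0 < s.re) :
    χ.gammaFactor s ≠ 0 := by
  rw [gammaFactor_eq]
  apply Complex.Gammaℝ_ne_zero_of_re_pos
  have := gammaShift_nonneg χ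
  simp; linarith

lemma not_pole_of_re_pos {w : ℂ} (hw : 0 < w.re) (m : ℕ) : w ≠ -m := by
  intro h
  have h' := congrArg Complex.re h
  have : (0 : ℝ) ≤ m := Nat.cast_nonneg m
  simp at h'
  linarith

lemma hasDerivAt_Gammaℝ {w : ℂ} (hw : 0 < w.re) :
    HasDerivAt Complex.Gammaℝ (Complex.Gammaℝ w *
      (-(Real.log Real.pi) / 2 + Complex.digamma (w / 2) / 2)) w := by
  have hw2 : 0 < (w / 2).re := by simpa using hw
  have h1 : HasDerivAt Complex.Gamma (deriv Complex.Gamma (w / 2)) (w / 2) :=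
    (Complex.differentiableAt_Gamma _ (not_pole_of_re_pos hw2)).hasDerivAt
  have h2 : HasDerivAt (fun z : ℂ => z / 2) (1 / 2) w := (hasDerivAt_id w).div_const 2
  have h3 := HasDerivAt.comp w h1 h2
  have h4 : HasDerivAt (fun z : ℂ => -z / 2) (-1 / 2) w := (hasDerivAt_id w).neg.div_const 2
  have hπ : (Real.pi : ℂ) ≠ 0 := by exact_mod_cast Real.pi_ne_zero
  have h5 := h4.const_cpow (c := (Real.pi : ℂ)) (Or.inl hπ)
  have h6 := h5.mul h3
  have hG : Complex.Gamma (w / 2) ≠ 0 := Complex.Gamma_ne_zero (not_pole_of_re_pos hw2)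
  have h7 : Complex.Gammaℝ = fun z : ℂ => (Real.pi : ℂ) ^ (-z / 2) * Complex.Gamma (z / 2) := by
    ext z; exact Complex.Gammaℝ_def z
  rw [h7]
  refine h6.congr_deriv ?_
  rw [Complex.digamma_def, logDeriv_apply, Complex.ofReal_log Real.pi_pos.le]
  simp only [Function.comp]
  field_simp

lemma logDeriv_gammaFactor {N : ℕ} (χ : DirichletCharacter ℂ N) {s : ℂ} (hs : 0 < s.re) :
    logDeriv (χ.gammaFactor) s =
      -(Real.log Real.pi) / 2 + Complex.digamma ((s + gammaShift χ) / 2) / 2 := by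
  have hw : 0 < (s + gammaShift χ).re := by
    have := gammaShift_nonneg χ
    simp; linarith
  have h7 : χ.gammaFactor = fun z : ℂ => Complex.Gammaℝ (z + gammaShift χ) := by
    ext z; exact gammaFactor_eq χ z
  have h1 := (hasDerivAt_Gammaℝ hw).comp_add_const s (gammaShift χ : ℂ)
  rw [logDeriv_apply, h7, h1.deriv]
  have := Complex.Gammaℝ_ne_zero_of_re_pos hw
  field_simp

lemma completed_ne_zero {N : ℕ} [NeZero N] {χ : DirichletCharacter ℂ N} (hχ : χ ≠ 1) {s : ℂ}
    (hs : 1 ≤ s.re) : completedLFunction χ s ≠ 0 := by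
  rw [completed_eq_mul χ (by linarith)]
  exact mul_ne_zero (LFunction_ne_zero_of_one_le_re χ (Or.inl hχ) hs)
    (gammaFactor_ne_zero χ (by linarith))

lemma differentiableAt_gammaFactor {N : ℕ} (χ : DirichletCharacter ℂ N) {s : ℂ} (hs : 0 < s.re) :
    DifferentiableAt ℂ χ.gammaFactor s := by
  have hw : 0 < (s + gammaShift χ).re := by
    have := gammaShift_nonneg χ
    simp; linarith
  have h7 : χ.gammaFactor = fun z : ℂ => Complex.Gammaℝ (z + gammaShift χ) := by
    ext z; exact gammaFactor_eq χ z
  rw [h7]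
  exact ((hasDerivAt_Gammaℝ hw).comp_add_const s (gammaShift χ : ℂ)).differentiableAt

lemma logDeriv_completed {N : ℕ} [NeZero N] {χ : DirichletCharacter ℂ N} (hχ : χ ≠ 1) {s : ℂ}
    (hs : 1 < s.re) : logDeriv (completedLFunction χ) s =
      -mangoldtSeries χ s - Real.log Real.pi / 2 +
        Complex.digamma ((s + gammaShift χ) / 2) / 2 := by
  have hs0 : 0 < s.re := by linarith
  have h1 : completedLFunction χ =ᶠ[nhds s] fun z => LFunction χ z * χ.gammaFactor z := by
    filter_upwards [(isOpen_lt continuous_const Complex.continuous_re).mem_nhds hs0] with z hz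
    exact completed_eq_mul χ hz
  rw [(logDeriv_congr_nhds h1).eq_of_nhds, logDeriv_mul s (LFunction_ne_zero_of_one_le_re χ (Or.inl hχ) hs.le)
    (gammaFactor_ne_zero χ hs0) (differentiable_LFunction hχ s)
    (differentiableAt_gammaFactor χ hs0), logDeriv_LFunction_eq χ hs, logDeriv_gammaFactor χ hs0]
  ring

lemma rootNumber_ne_zero {N : ℕ} [NeZero N] {χ : DirichletCharacter ℂ N} (hχ : χ ≠ 1)
    (hp : χ.IsPrimitive) : χ.rootNumber ≠ 0 := by
  intro h
  have h1 := hp.completedLFunction_one_sub (-1)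
  rw [h] at h1
  exact completed_ne_zero hχ (s := 1 - (-1)) (by norm_num) (by simpa using h1)

lemma inv_char_ne_one {N : ℕ} {χ : DirichletCharacter ℂ N} (hχ : χ ≠ 1) : χ⁻¹ ≠ 1 := by
  simpa using hχ

lemma completed_zero_re {N : ℕ} [NeZero N] {χ : DirichletCharacter ℂ N} (hχ : χ ≠ 1)
    (hp : χ.IsPrimitive) (hG : GRHchi χ) {ρ : ℂ} (hρ : completedLFunction χ ρ = 0) :
    ρ.re = 1 / 2 := by
  have hN : (N : ℂ) ≠ 0 := by exact_mod_cast NeZero.ne N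
  have h1 : ρ.re < 1 := by
    by_contra! h
    exact completed_ne_zero hχ h hρ
  have h0 : 0 < ρ.re := by
    by_contra! h
    have h2 := hp.completedLFunction_one_sub (1 - ρ)
    rw [sub_sub_cancel, hρ] at h2
    have h3 : completedLFunction χ⁻¹ (1 - ρ) ≠ 0 :=
      completed_ne_zero (inv_char_ne_one hχ) (by simp; linarith)
    exact mul_ne_zero (mul_ne_zero ((Complex.cpow_ne_zero_iff_of_exponent_ne_zero
      (fun h4 => by
        have := congrArg Complex.re h4
        simp at this; linarith)).2 hN)
      (rootNumber_ne_zero hχ hp)) h3 h2.symm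
  refine hG ρ h0 h1 ?_
  rw [Lfunc, dif_neg (NeZero.ne N)]
  rw [completed_eq_mul χ h0] at hρ
  exact (mul_eq_zero.1 hρ).resolve_right (gammaFactor_ne_zero χ h0)

lemma logDeriv_completed_one_sub {N : ℕ} [NeZero N] {χ : DirichletCharacter ℂ N} (hχ : χ ≠ 1)
    (hp : χ.IsPrimitive) {s : ℂ} (hs : 1 ≤ s.re) :
    logDeriv (completedLFunction χ) (1 - s) =
      -(Real.log N + logDeriv (completedLFunction χ⁻¹) s) := by
  have hN : (N : ℂ) ≠ 0 := by exact_mod_cast NeZero.ne N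
  have h1 : (completedLFunction χ ∘ fun z => 1 - z) = fun z =>
      ((N : ℂ) ^ (z - 1 / 2) * χ.rootNumber) * completedLFunction χ⁻¹ z := by
    ext z; exact hp.completedLFunction_one_sub z
  have h2 := logDeriv_comp (f := completedLFunction χ) (g := fun z : ℂ => 1 - z) (x := s)
    (differentiable_completedLFunction hχ _) (by fun_prop)
  have h3 : deriv (fun z : ℂ => 1 - z) s = -1 := by
    simp
  have hd : HasDerivAt (fun z : ℂ => (N : ℂ) ^ (z - 1 / 2))
      ((N : ℂ) ^ (s - 1 / 2) * Complex.log N * 1) s :=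
    ((hasDerivAt_id s).sub_const (1 / 2 : ℂ)).const_cpow (Or.inl hN)
  have hne : (N : ℂ) ^ (s - 1 / 2) ≠ 0 := by
    refine (Complex.cpow_ne_zero_iff_of_exponent_ne_zero (fun h4 => ?_)).2 hN
    have := congrArg Complex.re h4
    simp at this; linarith
  rw [h1, h3, logDeriv_mul (f := fun z : ℂ => (N : ℂ) ^ (z - 1 / 2) * χ.rootNumber) s
    (mul_ne_zero hne (rootNumber_ne_zero hχ hp))
    (completed_ne_zero (inv_char_ne_one hχ) hs)
    (hd.differentiableAt.mul_const _) (differentiable_completedLFunction (inv_char_ne_one hχ) s),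
    logDeriv_mul_const s _ (rootNumber_ne_zero hχ hp), logDeriv_apply _ s, hd.deriv] at h2
  have h4 : (N : ℂ) ^ (s - 1 / 2) * Complex.log N * 1 / (N : ℂ) ^ (s - 1 / 2) = Real.log N := by
    rw [mul_one, mul_div_cancel_left₀ _ hne]
    simp
  rw [h4] at h2
  rw [h2]
  ring

end

section
open DirichletCharacter

lemma tendsto_sum_exhaust {E : Type*} [AddCommMonoid E] [TopologicalSpace E] {F : ℝ → E}
    {T : ℝ → Finset ℝ} (hmono : Monotone T) (hex : ∀ γ, F γ ≠ 0 → ∃ R, γ ∈ T R) {S : E}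
    (hF : HasSum F S) : Tendsto (fun R => ∑ γ ∈ T R, F γ) atTop (nhds S) := by
  rw [tendsto_def]
  intro U hU
  have hF' : Tendsto (fun s : Finset ℝ => ∑ b ∈ s, F b) atTop (nhds S) := hF
  obtain ⟨s₀, hs₀⟩ := mem_atTop_sets.1 (hF' hU)
  have h1 : ∀ᶠ R in atTop, ∀ γ ∈ s₀, F γ ≠ 0 → γ ∈ T R := by
    refine (Finset.eventually_all s₀).2 (fun γ _ => ?_)
    by_cases h : F γ = 0
    · exact Eventually.of_forall (fun R h' => absurd h h')
    · obtain ⟨R, hR⟩ := hex γ h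
      filter_upwards [eventually_ge_atTop R] with R' hR' _
      exact hmono hR' hR
  filter_upwards [h1] with R hR
  have h2 : ∑ γ ∈ T R, F γ = ∑ γ ∈ T R ∪ s₀, F γ := by
    refine Finset.sum_subset Finset.subset_union_left (fun γ hγ hn => ?_)
    by_contra h
    rcases Finset.mem_union.1 hγ with h' | h'
    · exact hn h'
    · exact hn (hR γ h' h)
  simp only [Set.mem_preimage, h2]
  exact hs₀ _ Finset.subset_union_right

lemma summable_of_exhaust {F : ℝ → ℝ} (h0 : ∀ γ, 0 ≤ F γ)
    {T : ℝ → Finset ℝ} (hmono : Monotone T) (hex : ∀ γ, F γ ≠ 0 → ∃ R, γ ∈ T R) {S : ℝ}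
    (hL : Tendsto (fun R => ∑ γ ∈ T R, F γ) atTop (nhds S)) : Summable F := by
  have hm : Monotone (fun R => ∑ γ ∈ T R, F γ) := fun a b hab =>
    Finset.sum_le_sum_of_subset_of_nonneg (hmono hab) (fun i _ _ => h0 i)
  refine summable_of_sum_le (c := S) h0 (fun u => ?_)
  have h1 : ∀ᶠ R in atTop, ∀ γ ∈ u, F γ ≠ 0 → γ ∈ T R := by
    refine (Finset.eventually_all u).2 (fun γ _ => ?_)
    by_cases h : F γ = 0
    · exact Eventually.of_forall (fun R h' => absurd h h')
    · obtain ⟨R, hR⟩ := hex γ h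
      filter_upwards [eventually_ge_atTop R] with R' hR' _
      exact hmono hR' hR
  obtain ⟨R, hR⟩ := h1.exists
  calc ∑ γ ∈ u, F γ = ∑ γ ∈ u.filter (fun γ => F γ ≠ 0), F γ :=
        (Finset.sum_filter_ne_zero u).symm
    _ ≤ ∑ γ ∈ T R, F γ := by
        refine Finset.sum_le_sum_of_subset_of_nonneg (fun γ hγ => ?_) (fun i _ _ => h0 i)
        rw [Finset.mem_filter] at hγ
        exact hR γ hγ.1 hγ.2
    _ ≤ S := hm.ge_of_tendsto hL R

/-- The point of ordinate `γ` on the critical line. -/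
noncomputable def critPt (γ : ℝ) : ℂ := 1 / 2 + γ * Complex.I

@[simp] lemma critPt_re (γ : ℝ) : (critPt γ).re = 1 / 2 := by simp [critPt]
@[simp] lemma critPt_im (γ : ℝ) : (critPt γ).im = γ := by simp [critPt]

/-- The multiplicity of the critical zero of ordinate `γ`. -/
noncomputable def zmult {N : ℕ} [NeZero N] (χ : DirichletCharacter ℂ N) (γ : ℝ) : ℕ :=
  analyticOrderNatAt (completedLFunction χ) (critPt γ)

/-- Ordinates of zeros at distance at most `R` from `c`. -/
noncomputable def ordinates {N : ℕ} [NeZero N] (χ : DirichletCharacter ℂ N) (c : ℂ) (R : ℝ) :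
    Finset ℝ := (zeroSet (completedLFunction χ) c R).image Complex.im

section
variable {N : ℕ} [NeZero N] {χ : DirichletCharacter ℂ N}

lemma mem_completed_zeroSet (hχ : χ ≠ 1) {c ρ : ℂ} {R : ℝ} :
    ρ ∈ zeroSet (completedLFunction χ) c R ↔ ‖ρ - c‖ ≤ R ∧ completedLFunction χ ρ = 0 :=
  mem_zeroSet (differentiable_completedLFunction hχ) ⟨2, completed_ne_zero hχ (by norm_num)⟩

lemma ordinates_mono (hχ : χ ≠ 1) (c : ℂ) : Monotone (ordinates χ c) := by
  intro a b hab
  refine Finset.image_subset_image (fun ρ hρ => ?_)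
  rw [mem_completed_zeroSet hχ] at hρ ⊢
  exact ⟨hρ.1.trans hab, hρ.2⟩

lemma exists_mem_ordinates (hχ : χ ≠ 1) (c : ℂ) {γ : ℝ} (h : zmult χ γ ≠ 0) :
    ∃ R, γ ∈ ordinates χ c R := by
  refine ⟨‖critPt γ - c‖, Finset.mem_image.2 ⟨critPt γ, ?_, critPt_im γ⟩⟩
  rw [mem_completed_zeroSet hχ]
  refine ⟨le_rfl, ?_⟩
  by_contra h'
  apply h
  rw [zmult, analyticOrderNatAt, AnalyticAt.analyticOrderAt_eq_zero
    ((differentiable_completedLFunction hχ).analyticAt _) |>.2 h']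
  rfl

lemma eq_critPt {ρ : ℂ} (h : ρ.re = 1 / 2) : ρ = critPt ρ.im := by
  apply Complex.ext <;> simp [h]

lemma sum_zeroSet_eq {E : Type*} [AddCommMonoid E] (hχ : χ ≠ 1) (hp : χ.IsPrimitive)
    (hG : GRHchi χ) (c : ℂ) (R : ℝ) (g : ℂ → E) :
    ∑ ρ ∈ zeroSet (completedLFunction χ) c R, g ρ = ∑ γ ∈ ordinates χ c R, g (critPt γ) := by
  have hre : ∀ ρ ∈ zeroSet (completedLFunction χ) c R, ρ.re = 1 / 2 := fun ρ hρ =>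
    completed_zero_re hχ hp hG ((mem_completed_zeroSet hχ).1 hρ).2
  rw [ordinates, Finset.sum_image]
  · exact Finset.sum_congr rfl (fun ρ hρ => by rw [← eq_critPt (hre ρ hρ)])
  · intro ρ hρ ρ' hρ' h
    rw [eq_critPt (hre ρ hρ), eq_critPt (hre ρ' hρ')]
    rw [h]

lemma tendsto_sum_ordinates (hχ : χ ≠ 1) (hp : χ.IsPrimitive) (hG : GRHchi χ) {c s : ℂ}
    (hc : completedLFunction χ c ≠ 0) (hs : completedLFunction χ s ≠ 0) :
    Tendsto (fun R => ∑ γ ∈ ordinates χ c R,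
      (zmult χ γ : ℂ) * (1 / (s - critPt γ) - 1 / (c - critPt γ))) atTop
      (nhds (logDeriv (completedLFunction χ) s - logDeriv (completedLFunction χ) c)) := by
  refine (tendsto_sum_zeros_logDeriv (differentiable_completedLFunction hχ) hc hs
    (completed_growth hχ hp c)).congr (fun R => ?_)
  exact sum_zeroSet_eq hχ hp hG c R _

/-- The symmetric zero sum at the real point `σ`. -/
noncomputable def zeroSumValue (χ : DirichletCharacter ℂ N) (σ : ℝ) : ℝ :=
  Real.log N + (logDeriv (completedLFunction χ) σ + logDeriv (completedLFunction χ⁻¹) σ).re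

theorem hasSum_zeros_real (hχ : χ ≠ 1) (hp : χ.IsPrimitive) (hG : GRHchi χ) {σ : ℝ}
    (hσ : 1 < σ) : HasSum (fun γ => (zmult χ γ : ℝ) * (2 * (σ - 1 / 2) /
      ((σ - 1 / 2) ^ 2 + γ ^ 2))) (zeroSumValue χ σ) := by
  have hs : completedLFunction χ (σ : ℂ) ≠ 0 := completed_ne_zero hχ (by simpa using hσ.le)
  have hc : completedLFunction χ (1 - (σ : ℂ)) ≠ 0 := by
    intro h
    have := completed_zero_re hχ hp hG h
    simp at this
    linarith
  have h1 := tendsto_sum_ordinates hχ hp hG hc hs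
  have h2 : (zeroSumValue χ σ) = (logDeriv (completedLFunction χ) σ -
      logDeriv (completedLFunction χ) (1 - (σ : ℂ))).re := by
    rw [logDeriv_completed_one_sub hχ hp (by simpa using hσ.le), zeroSumValue]
    simp only [Complex.sub_re, Complex.add_re, Complex.neg_re, Complex.ofReal_re]
    ring
  have h3 := (Complex.continuous_re.tendsto _).comp h1
  rw [← h2] at h3
  have h4 : Tendsto (fun R => ∑ γ ∈ ordinates χ (1 - (σ : ℂ)) R, (zmult χ γ : ℝ) *
      (2 * (σ - 1 / 2) / ((σ - 1 / 2) ^ 2 + γ ^ 2))) atTop (nhds (zeroSumValue χ σ)) := by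
    refine h3.congr (fun R => ?_)
    rw [Function.comp, Complex.re_sum]
    refine Finset.sum_congr rfl (fun γ _ => ?_)
    have hpos : 0 < (σ - 1 / 2) ^ 2 + γ ^ 2 := by nlinarith [sq_nonneg γ]
    have e1 : 1 / ((σ : ℂ) - critPt γ) - 1 / (1 - (σ : ℂ) - critPt γ) =
        ((2 * (σ - 1 / 2) / ((σ - 1 / 2) ^ 2 + γ ^ 2) : ℝ) : ℂ) := by
      have n1 : (σ : ℂ) - critPt γ ≠ 0 := by
        intro h; have := congrArg Complex.re h; simp at this; linarith
      have n2 : 1 - (σ : ℂ) - critPt γ ≠ 0 := by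
        intro h; have := congrArg Complex.re h; simp at this; linarith
      have n3 : (((σ - 1 / 2) ^ 2 + γ ^ 2 : ℝ) : ℂ) ≠ 0 := by exact_mod_cast hpos.ne'
      rw [Complex.ofReal_div]
      rw [div_sub_div _ _ n1 n2, div_eq_div_iff (mul_ne_zero n1 n2) n3]
      push_cast [critPt]
      ring_nf
      simp only [Complex.I_sq]
      ring
    rw [e1, ← Complex.ofReal_natCast, ← Complex.ofReal_mul, Complex.ofReal_re]
  have hnn : ∀ γ : ℝ, 0 ≤ (zmult χ γ : ℝ) * (2 * (σ - 1 / 2) / ((σ - 1 / 2) ^ 2 + γ ^ 2)) := by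
    intro γ
    have : 0 ≤ σ - 1 / 2 := by linarith
    positivity
  have hex : ∀ γ : ℝ, (zmult χ γ : ℝ) * (2 * (σ - 1 / 2) / ((σ - 1 / 2) ^ 2 + γ ^ 2)) ≠ 0 →
      ∃ R, γ ∈ ordinates χ (1 - (σ : ℂ)) R := by
    intro γ h
    refine exists_mem_ordinates hχ _ (fun h0 => h ?_)
    simp [h0]
  have hS := summable_of_exhaust hnn (ordinates_mono hχ _) hex h4
  have := tendsto_nhds_unique (tendsto_sum_exhaust (ordinates_mono hχ _) hex hS.hasSum) h4
  rw [← this]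
  exact hS.hasSum

lemma zeroSumValue_nonneg (hχ : χ ≠ 1) (hp : χ.IsPrimitive) (hG : GRHchi χ) {σ : ℝ}
    (hσ : 1 < σ) : 0 ≤ zeroSumValue χ σ := by
  refine (hasSum_zeros_real hχ hp hG hσ).nonneg (fun γ => ?_)
  have : 0 ≤ σ - 1 / 2 := by linarith
  positivity

lemma zmult_summable (hχ : χ ≠ 1) (hp : χ.IsPrimitive) (hG : GRHchi χ) :
    Summable (fun γ => (zmult χ γ : ℝ) / (1 + |γ|) ^ 2) := by
  have h := (hasSum_zeros_real hχ hp hG (σ := 2) (by norm_num)).summable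
  refine Summable.of_nonneg_of_le (fun γ => by positivity) (fun γ => ?_) (h.mul_left 2)
  have hm : (0 : ℝ) ≤ zmult χ γ := Nat.cast_nonneg _
  rw [div_eq_mul_inv, mul_left_comm]
  refine mul_le_mul_of_nonneg_left ?_ hm
  rw [inv_eq_one_div, ← mul_div_assoc, div_le_div_iff₀ (by positivity) (by positivity)]
  have := abs_nonneg γ
  have h2 := sq_abs γ
  nlinarith

lemma one_add_abs_le_norm_sub_critPt {s : ℂ} (hs : 1 < s.re) (γ : ℝ) :
    1 + |γ| ≤ (3 + 2 * |s.im|) * ‖s - critPt γ‖ := by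
  have h1 : 1 / 2 ≤ ‖s - critPt γ‖ := by
    refine le_trans ?_ (Complex.re_le_norm _)
    simp; linarith
  have h2 : |s.im - γ| ≤ ‖s - critPt γ‖ := by
    have := Complex.abs_im_le_norm (s - critPt γ)
    simpa using this
  have h3 : |γ| ≤ |s.im| + |s.im - γ| := by
    have := abs_sub_abs_le_abs_sub γ s.im
    rw [abs_sub_comm] at this
    linarith
  nlinarith [abs_nonneg s.im]

lemma sub_critPt_ne_zero {s : ℂ} (hs : 1 < s.re) (γ : ℝ) : s - critPt γ ≠ 0 := by
  intro h; have := congrArg Complex.re h; simp at this; linarith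

theorem hasSum_zeros_complex (hχ : χ ≠ 1) (hp : χ.IsPrimitive) (hG : GRHchi χ) {s c : ℂ}
    (hs : 1 < s.re) (hc : 1 < c.re) : HasSum (fun γ => (zmult χ γ : ℂ) *
      (1 / (s - critPt γ) - 1 / (c - critPt γ)))
      (logDeriv (completedLFunction χ) s - logDeriv (completedLFunction χ) c) := by
  have h4 := tendsto_sum_ordinates hχ hp hG (completed_ne_zero hχ hc.le)
    (completed_ne_zero hχ hs.le)
  have hS : Summable (fun γ => (zmult χ γ : ℂ) *
      (1 / (s - critPt γ) - 1 / (c - critPt γ))) := by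
    refine Summable.of_norm_bounded ((zmult_summable hχ hp hG).mul_left
      (‖c - s‖ * ((3 + 2 * |s.im|) * (3 + 2 * |c.im|)))) (fun γ => ?_)
    have n1 := sub_critPt_ne_zero hs γ
    have n2 := sub_critPt_ne_zero hc γ
    have b1 := one_add_abs_le_norm_sub_critPt hs γ
    have b2 := one_add_abs_le_norm_sub_critPt hc γ
    have p1 := norm_pos_iff.2 n1
    have p2 := norm_pos_iff.2 n2
    have e : 1 / (s - critPt γ) - 1 / (c - critPt γ) =
        (c - s) / ((s - critPt γ) * (c - critPt γ)) := by
      field_simp; ring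
    rw [e, norm_mul, norm_div, norm_mul, Complex.norm_natCast, mul_div_assoc', mul_div_assoc',
      div_le_div_iff₀ (by positivity) (by positivity)]
    have : (1 + |γ|) ^ 2 ≤ ((3 + 2 * |s.im|) * ‖s - critPt γ‖) *
        ((3 + 2 * |c.im|) * ‖c - critPt γ‖) := by
      rw [pow_two]
      have := abs_nonneg γ
      gcongr
    calc (zmult χ γ : ℝ) * ‖c - s‖ * (1 + |γ|) ^ 2 ≤ (zmult χ γ : ℝ) * ‖c - s‖ *
          (((3 + 2 * |s.im|) * ‖s - critPt γ‖) * ((3 + 2 * |c.im|) * ‖c - critPt γ‖)) := by gcongr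
      _ = _ := by ring
  have hex : ∀ γ : ℝ, (zmult χ γ : ℂ) * (1 / (s - critPt γ) - 1 / (c - critPt γ)) ≠ 0 →
      ∃ R, γ ∈ ordinates χ c R := by
    intro γ h
    refine exists_mem_ordinates hχ _ (fun h0 => h ?_)
    simp [h0]
  have := tendsto_nhds_unique (tendsto_sum_exhaust (ordinates_mono hχ _) hex hS.hasSum) h4
  rw [← this]
  exact hS.hasSum

/-- The approximation `log (Nσ)` for the symmetric zero sum. -/
lemma abs_zeroSumValue_sub_le (hχ : χ ≠ 1) {σ : ℝ} (hσ : 1 < σ) :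
    |zeroSumValue χ σ - (Real.log N + Real.log σ)| ≤ 5 + 2 * mangoldtMajorant σ := by
  have key : ∀ ψ : DirichletCharacter ℂ N, ψ ≠ 1 →
      |(logDeriv (completedLFunction ψ) σ).re - Real.log σ / 2| ≤
        5 / 2 + mangoldtMajorant σ := by
    intro ψ hψ
    have ha0 := gammaShift_nonneg ψ
    have ha1 := gammaShift_le_one ψ
    set a := gammaShift ψ with ha
    have hx : 0 < (σ + a) / 2 := by linarith
    have e1 : ((σ : ℂ) + a) / 2 = (((σ + a) / 2 : ℝ) : ℂ) := by push_cast; ring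
    rw [logDeriv_completed hψ (by simpa using hσ), ← ha, e1, digamma_ofReal hx]
    have h1 := (Complex.abs_re_le_norm _).trans (norm_mangoldtSeries_le ψ (s := σ) (by simpa))
    rw [Complex.ofReal_re, abs_le] at h1
    have h2 := digammaR_le hx
    have h3 := le_digammaR hx
    have h4 : ((σ + a) / 2)⁻¹ ≤ 2 := by
      rw [inv_le_comm₀ hx (by norm_num)]; linarith
    have h5 : Real.log ((σ + a) / 2) ≤ Real.log σ := Real.log_le_log hx (by linarith)
    have h6 : Real.log σ - Real.log 2 ≤ Real.log ((σ + a) / 2) := by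
      rw [← Real.log_div (by linarith) (by norm_num)]
      exact Real.log_le_log (by linarith) (by linarith)
    have h7 := Real.log_two_lt_d9
    have h8 : Real.log Real.pi ≤ 2.15 := by
      have := Real.log_le_sub_one_of_pos Real.pi_pos
      have := Real.pi_lt_d2
      linarith
    have h9 : 0 ≤ Real.log Real.pi := Real.log_nonneg (by linarith [Real.pi_gt_three])
    have e2 : (-mangoldtSeries ψ σ - (Real.log Real.pi : ℂ) / 2 +
        ((digammaR ((σ + a) / 2) : ℝ) : ℂ) / 2).re =
        -(mangoldtSeries ψ σ).re - Real.log Real.pi / 2 + digammaR ((σ + a) / 2) / 2 := by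
      simp
    rw [e2, abs_le]
    constructor <;> linarith [h1.1, h1.2]
  have k1 := abs_le.1 (key χ hχ)
  have k2 := abs_le.1 (key χ⁻¹ (inv_char_ne_one hχ))
  rw [zeroSumValue, Complex.add_re, abs_le]
  constructor <;> linarith [k1.1, k1.2, k2.1, k2.2]

end

end

section
open MeasureTheory FourierTransform

lemma norm_cexp_neg_mul (s : ℂ) (t : ℝ) : ‖Complex.exp (-s * t)‖ = Real.exp (-s.re * t) := by
  rw [Complex.norm_exp]; simp

lemma laplace_integrable {u : ℝ → ℂ} {C : ℝ} (hu : ∀ t, 0 ≤ t → ‖u t‖ ≤ C * Real.exp (3 / 2 * t))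
    (hc : ContinuousOn u (Set.Ici 0)) {s : ℂ} (hs : s.re = 2) :
    IntegrableOn (fun t : ℝ => u t * Complex.exp (-s * t)) (Set.Ioi 0) := by
  have h1 : IntegrableOn (fun t : ℝ => C * Real.exp (-(1 / 2) * t)) (Set.Ioi 0) :=
    (integrableOn_exp_mul_Ioi (by norm_num) 0).const_mul C
  refine Integrable.mono' h1 ?_ ?_
  · refine ContinuousOn.aestronglyMeasurable ?_ measurableSet_Ioi
    exact (hc.mono Set.Ioi_subset_Ici_self).mul (by fun_prop)
  · refine (ae_restrict_iff' measurableSet_Ioi).2 (Eventually.of_forall (fun t ht => ?_))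
    have ht' : (0 : ℝ) < t := ht
    rw [norm_mul, norm_cexp_neg_mul, hs]
    calc ‖u t‖ * Real.exp (-2 * t) ≤ C * Real.exp (3 / 2 * t) * Real.exp (-2 * t) := by
          gcongr; exact hu t ht'.le
      _ = C * Real.exp (-(1 / 2) * t) := by
          rw [mul_assoc, ← Real.exp_add]; ring_nf

lemma laplace_unique {h : ℝ → ℂ} {C : ℝ} (hc : ContinuousOn h (Set.Ici 0)) (h0 : h 0 = 0)
    (hb : ∀ t, 0 ≤ t → ‖h t‖ ≤ C * Real.exp (3 / 2 * t))
    (hz : ∀ s : ℂ, s.re = 2 → ∫ t in Set.Ioi (0 : ℝ), h t * Complex.exp (-s * t) = 0) :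
    ∀ t, 0 ≤ t → h t = 0 := by
  set k : ℝ → ℂ := fun t => h (max t 0) * Complex.exp (-2 * (t : ℂ)) with hk
  have hkc : Continuous k := by
    have h1 : Continuous (fun t : ℝ => h (max t 0)) :=
      hc.comp_continuous (by fun_prop) (fun t => Set.mem_Ici.2 (le_max_right _ _))
    exact h1.mul (by fun_prop)
  have hkneg : ∀ t, t ≤ 0 → k t = 0 := by
    intro t ht
    simp [hk, max_eq_right ht, h0]
  have hind : ∀ c : ℝ → ℂ, (fun t => c t * k t) =
      Set.indicator (Set.Ioi 0) (fun t => c t * (h t * Complex.exp (-2 * (t : ℂ)))) := by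
    intro c
    ext t
    by_cases ht : 0 < t
    · rw [Set.indicator_of_mem (show t ∈ Set.Ioi 0 from ht), hk]
      simp only [max_eq_left ht.le]
    · rw [Set.indicator_of_notMem (by simpa using ht), hkneg t (not_lt.1 ht), mul_zero]
  have hki : Integrable k := by
    have h2 := hind (fun _ => 1)
    simp only [one_mul] at h2
    rw [show k = fun t => k t from rfl, h2, integrable_indicator_iff measurableSet_Ioi]
    exact laplace_integrable hb hc (s := 2) (by simp)
  have hF : 𝓕 k = fun _ => 0 := by
    ext w
    rw [Real.fourier_real_eq_integral_exp_smul]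
    simp only [smul_eq_mul]
    rw [hind, integral_indicator measurableSet_Ioi]
    have := hz (2 + 2 * Real.pi * w * Complex.I) (by simp)
    rw [← this]
    congr 1
    ext t
    rw [mul_left_comm, ← Complex.exp_add]
    congr 2
    push_cast
    ring
  have hFi : Integrable (𝓕 k) := by rw [hF]; exact integrable_zero _ _ _
  intro t ht
  have h3 := hki.fourierInv_fourier_eq hFi (hkc.continuousAt (x := t))
  rw [hF] at h3
  have h4 : k t = 0 := by
    rw [← h3, Real.fourierInv_eq']
    simp
  rw [hk] at h4
  simp only [max_eq_left ht] at h4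
  exact (mul_eq_zero.1 h4).resolve_right (Complex.exp_ne_zero _)

section series
variable {ι : Type*} {u : ι → ℝ → ℂ} {C : ι → ℝ}

lemma laplace_tsum_bound (hC : Summable C)
    (hu : ∀ i t, 0 ≤ t → ‖u i t‖ ≤ C i * Real.exp (3 / 2 * t)) {t : ℝ} (ht : 0 ≤ t) :
    ‖∑' i, u i t‖ ≤ (∑' i, C i) * Real.exp (3 / 2 * t) :=
  tsum_of_norm_bounded (hC.hasSum.mul_right _) (fun i => hu i t ht)

lemma laplace_tsum_continuousOn (hC : Summable C)
    (hu : ∀ i t, 0 ≤ t → ‖u i t‖ ≤ C i * Real.exp (3 / 2 * t))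
    (hc : ∀ i, ContinuousOn (u i) (Set.Ici 0)) :
    ContinuousOn (fun t => ∑' i, u i t) (Set.Ici 0) := by
  have h1 : ∀ i, ContinuousOn (fun t : ℝ => u i t * Complex.exp (-(3 / 2) * t)) (Set.Ici 0) :=
    fun i => (hc i).mul (by fun_prop)
  have h2 : ContinuousOn (fun t : ℝ => ∑' i, u i t * Complex.exp (-(3 / 2) * t)) (Set.Ici 0) := by
    refine continuousOn_tsum h1 hC (fun i t ht => ?_)
    rw [norm_mul, norm_cexp_neg_mul]
    calc ‖u i t‖ * Real.exp (-(3 / 2 : ℂ).re * t)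
        ≤ C i * Real.exp (3 / 2 * t) * Real.exp (-(3 / 2 : ℂ).re * t) := by
          gcongr; exact hu i t ht
      _ = C i := by
          have : ((3 : ℂ) / 2).re = 3 / 2 := by simp
          rw [mul_assoc, ← Real.exp_add, this]; ring_nf; simp
  have h3 : ContinuousOn (fun t : ℝ => (∑' i, u i t * Complex.exp (-(3 / 2) * t)) *
      Complex.exp ((3 / 2) * t)) (Set.Ici 0) := h2.mul (by fun_prop)
  refine h3.congr (fun t _ => ?_)
  simp only
  rw [tsum_mul_right, mul_assoc, ← Complex.exp_add]
  simp

lemma laplace_tsum [Countable ι] (hC : Summable C)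
    (hu : ∀ i t, 0 ≤ t → ‖u i t‖ ≤ C i * Real.exp (3 / 2 * t))
    (hc : ∀ i, ContinuousOn (u i) (Set.Ici 0)) {s : ℂ} (hs : s.re = 2) :
    HasSum (fun i => ∫ t in Set.Ioi (0 : ℝ), u i t * Complex.exp (-s * t))
      (∫ t in Set.Ioi (0 : ℝ), (∑' i, u i t) * Complex.exp (-s * t)) := by
  have h1 : IntegrableOn (fun t : ℝ => Real.exp (-(1 / 2) * t)) (Set.Ioi 0) :=
    integrableOn_exp_mul_Ioi (by norm_num) 0
  have := hasSum_integral_of_summable_integral_norm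
    (F := fun i (t : ℝ) => u i t * Complex.exp (-s * t)) (μ := volume.restrict (Set.Ioi 0))
    (fun i => laplace_integrable (hu i) (hc i) hs) ?_
  · simpa only [tsum_mul_right] using this
  · refine Summable.of_nonneg_of_le (fun i => integral_nonneg (fun t => norm_nonneg _))
      (fun i => ?_) (hC.mul_right (∫ t in Set.Ioi (0 : ℝ), Real.exp (-(1 / 2) * t)))
    rw [← integral_const_mul]
    refine setIntegral_mono_on (laplace_integrable (hu i) (hc i) hs).norm (h1.const_mul _)
      measurableSet_Ioi (fun t ht => ?_)
    have ht' : (0 : ℝ) < t := ht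
    rw [norm_mul, norm_cexp_neg_mul, hs]
    calc ‖u i t‖ * Real.exp (-2 * t) ≤ C i * Real.exp (3 / 2 * t) * Real.exp (-2 * t) := by
          gcongr; exact hu i t ht'.le
      _ = C i * Real.exp (-(1 / 2) * t) := by
          rw [mul_assoc, ← Real.exp_add]; ring_nf
end series

end

section
open MeasureTheory

/-- `∫_0^t e^{ρ v} dv`. -/
noncomputable def expInt (ρ : ℂ) (t : ℝ) : ℂ := ∫ v in (0 : ℝ)..t, Complex.exp (ρ * v)

lemma hasDerivAt_expInt (ρ : ℂ) (t : ℝ) : HasDerivAt (expInt ρ) (Complex.exp (ρ * t)) t := by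
  have hc : Continuous (fun v : ℝ => Complex.exp (ρ * v)) := by fun_prop
  exact intervalIntegral.integral_hasDerivAt_right (hc.intervalIntegrable _ _)
    (hc.stronglyMeasurableAtFilter _ _) hc.continuousAt

lemma mul_expInt (ρ : ℂ) (t : ℝ) : ρ * expInt ρ t = Complex.exp (ρ * t) - 1 := by
  by_cases h : ρ = 0
  · simp [h]
  · rw [expInt, integral_exp_mul_complex h, mul_div_cancel₀ _ h]
    simp

lemma norm_expInt_le {ρ : ℂ} (hρ : ρ.re ≤ 1 / 2) {t : ℝ} (ht : 0 ≤ t) :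
    ‖expInt ρ t‖ ≤ 3 / (1 + ‖ρ‖) * Real.exp (3 / 2 * t) := by
  have e1 : 1 ≤ Real.exp (1 / 2 * t) := Real.one_le_exp (by positivity)
  have h1 : ‖ρ‖ * ‖expInt ρ t‖ ≤ 2 * Real.exp (1 / 2 * t) := by
    rw [← norm_mul, mul_expInt]
    refine (norm_sub_le _ _).trans ?_
    have : ‖Complex.exp (ρ * t)‖ ≤ Real.exp (1 / 2 * t) := by
      rw [Complex.norm_exp]
      refine Real.exp_le_exp.2 ?_
      simp only [Complex.mul_re, Complex.ofReal_re, Complex.ofReal_im, mul_zero, sub_zero]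
      gcongr
    simp only [norm_one]
    linarith
  have h2 : ‖expInt ρ t‖ ≤ Real.exp (1 / 2 * t) * |t - 0| := by
    refine intervalIntegral.norm_integral_le_of_norm_le_const (fun v hv => ?_)
    rw [Set.uIoc_of_le ht] at hv
    rw [Complex.norm_exp]
    refine Real.exp_le_exp.2 ?_
    simp only [Complex.mul_re, Complex.ofReal_re, Complex.ofReal_im, mul_zero, sub_zero]
    nlinarith [hv.1, hv.2]
  rw [sub_zero, abs_of_nonneg ht] at h2
  have h3 : t + 1 ≤ Real.exp t := Real.add_one_le_exp t
  have h4 : Real.exp (3 / 2 * t) = Real.exp (1 / 2 * t) * Real.exp t := by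
    rw [← Real.exp_add]; ring_nf
  rw [div_mul_eq_mul_div, le_div_iff₀ (by positivity), h4]
  nlinarith

lemma laplace_expInt {ρ s : ℂ} (hρ : ρ.re ≤ 1 / 2) (hs : s.re = 2) :
    ∫ t in Set.Ioi (0 : ℝ), expInt ρ t * Complex.exp (-s * t) = 1 / (s * (s - ρ)) := by
  have hs0 : s ≠ 0 := by rintro rfl; simp at hs
  have hsρ : ρ - s ≠ 0 := by
    intro h; have := congrArg Complex.re h; simp [hs] at this; linarith
  have hcont : Continuous (expInt ρ) :=
    continuous_iff_continuousAt.2 (fun t => (hasDerivAt_expInt ρ t).continuousAt)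
  set G : ℝ → ℂ := fun t => -(expInt ρ t * Complex.exp (-s * t)) / s +
    Complex.exp ((ρ - s) * t) / (s * (ρ - s)) with hG
  have hexp : ∀ (a : ℂ) (t : ℝ), HasDerivAt (fun t : ℝ => Complex.exp (a * t))
      (Complex.exp (a * t) * a) t := by
    intro a t
    have h1 : HasDerivAt (fun t : ℝ => a * (t : ℂ)) (a * 1) t :=
      (Complex.ofRealCLM.hasDerivAt (x := t)).const_mul a
    simpa using h1.cexp
  have hd : ∀ t ∈ Set.Ioi (0 : ℝ), HasDerivAt G (expInt ρ t * Complex.exp (-s * t)) t := by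
    intro t _
    have h1 := ((hasDerivAt_expInt ρ t).mul (hexp (-s) t)).neg.div_const s
    have h2 := (hexp (ρ - s) t).div_const (s * (ρ - s))
    refine (h1.add h2).congr_deriv ?_
    have h3 : Complex.exp ((ρ - s) * t) = Complex.exp (ρ * t) * Complex.exp (-s * t) := by
      rw [← Complex.exp_add]; ring_nf
    rw [h3]
    field_simp
    ring
  have hlim : Tendsto G atTop (nhds 0) := by
    have hexp0 : Tendsto (fun t : ℝ => Real.exp (-(1 / 2) * t)) atTop (nhds 0) := by
      refine Real.tendsto_exp_atBot.comp ?_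
      exact tendsto_id.const_mul_atTop_of_neg (by norm_num)
    have h1 : Tendsto (fun t : ℝ => expInt ρ t * Complex.exp (-s * t)) atTop (nhds 0) := by
      refine squeeze_zero_norm' (a := fun t => 3 / (1 + ‖ρ‖) * Real.exp (-(1 / 2) * t)) ?_ ?_
      · filter_upwards [eventually_ge_atTop 0] with t ht
        rw [norm_mul, norm_cexp_neg_mul, hs]
        calc _ ≤ 3 / (1 + ‖ρ‖) * Real.exp (3 / 2 * t) * Real.exp (-2 * t) := by
              gcongr; exact norm_expInt_le hρ ht
          _ = _ := by rw [mul_assoc, ← Real.exp_add]; ring_nf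
      · simpa using hexp0.const_mul (3 / (1 + ‖ρ‖))
    have h2 : Tendsto (fun t : ℝ => Complex.exp ((ρ - s) * t)) atTop (nhds 0) := by
      refine squeeze_zero_norm' (a := fun t => Real.exp (-(1 / 2) * t)) ?_ hexp0
      filter_upwards [eventually_ge_atTop 0] with t ht
      rw [Complex.norm_exp]
      refine Real.exp_le_exp.2 ?_
      simp only [Complex.mul_re, Complex.ofReal_re, Complex.ofReal_im, mul_zero, sub_zero,
        Complex.sub_re, hs]
      nlinarith
    have := (h1.neg.div_const s).add (h2.div_const (s * (ρ - s)))
    simpa [hG] using this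
  have hGc : ContinuousWithinAt G (Set.Ici 0) 0 := by
    apply Continuous.continuousWithinAt
    simp only [hG]
    fun_prop
  have h5 := integral_Ioi_of_hasDerivAt_of_tendsto hGc hd
    (laplace_integrable (fun t ht => norm_expInt_le hρ ht) hcont.continuousOn hs) hlim
  rw [h5, hG]
  have : s - ρ ≠ 0 := by rw [← neg_sub]; exact neg_ne_zero.2 hsρ
  simp [expInt]
  field_simp
  ring

/-- The smoothing weight `min(1, (e^t/n)^λ)`. -/
noncomputable def smoothWeight (l : ℝ) (n : ℕ) (t : ℝ) : ℝ := min 1 ((Real.exp t / n) ^ l)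

lemma smoothWeight_nonneg (l : ℝ) (n : ℕ) (t : ℝ) : 0 ≤ smoothWeight l n t :=
  le_min zero_le_one (by positivity)

lemma smoothWeight_of_le {l : ℝ} (hl : 0 ≤ l) {n : ℕ} (hn : 0 < n) {t : ℝ} (h : Real.log n ≤ t) :
    smoothWeight l n t = 1 := by
  have hn' : (0 : ℝ) < n := by exact_mod_cast hn
  refine min_eq_left (Real.one_le_rpow ?_ hl)
  rw [one_le_div hn']
  exact (Real.log_le_iff_le_exp hn').1 h

lemma smoothWeight_of_ge {l : ℝ} (hl : 0 ≤ l) {n : ℕ} (hn : 0 < n) {t : ℝ} (h : t ≤ Real.log n) :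
    smoothWeight l n t = Real.exp (l * t) * (n : ℝ) ^ (-l) := by
  have hn' : (0 : ℝ) < n := by exact_mod_cast hn
  have h1 : (Real.exp t / n) ≤ 1 := by
    rw [div_le_one hn']
    exact (Real.le_log_iff_exp_le hn').1 h
  rw [smoothWeight, min_eq_right (Real.rpow_le_one (by positivity) h1 hl),
    Real.div_rpow (Real.exp_pos t).le hn'.le, ← Real.exp_mul, Real.rpow_neg hn'.le,
    div_eq_mul_inv, mul_comm t]

lemma smoothWeight_le {l : ℝ} (hl : 3 / 2 ≤ l) (n : ℕ) (hn : 0 < n) (t : ℝ) :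
    smoothWeight l n t ≤ (n : ℝ) ^ (-(3 / 2 : ℝ)) * Real.exp (3 / 2 * t) := by
  have hn' : (0 : ℝ) < n := by exact_mod_cast hn
  have h0 : 0 < Real.exp t / n := by positivity
  have h1 : (n : ℝ) ^ (-(3 / 2 : ℝ)) * Real.exp (3 / 2 * t) = (Real.exp t / n) ^ (3 / 2 : ℝ) := by
    rw [Real.div_rpow (Real.exp_pos t).le hn'.le, ← Real.exp_mul, Real.rpow_neg hn'.le,
      mul_comm t, mul_comm]
    exact (div_eq_mul_inv _ _).symm
  rw [h1]
  rcases le_total 1 (Real.exp t / n) with h | h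
  · exact (min_le_left _ _).trans (Real.one_le_rpow h (by norm_num))
  · exact (min_le_right _ _).trans (Real.rpow_le_rpow_of_exponent_ge h0 h hl)

lemma continuous_smoothWeight {l : ℝ} (hl : 0 < l) (n : ℕ) : Continuous (smoothWeight l n) := by
  unfold smoothWeight
  refine continuous_const.min ?_
  exact (Real.continuous_exp.div_const _).rpow_const (fun _ => Or.inr hl.le)

lemma laplace_smoothWeight {l : ℝ} (hl : 3 ≤ l) {n : ℕ} (hn : 0 < n) {s : ℂ} (hs : s.re = 2) :
    ∫ t in Set.Ioi (0 : ℝ), (smoothWeight l n t : ℂ) * Complex.exp (-s * t) =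
      l / (s * (l - s)) * (n : ℂ) ^ (-s) - 1 / (l - s) * (n : ℂ) ^ (-(l : ℂ)) := by
  have hn' : (0 : ℝ) < n := by exact_mod_cast hn
  have hnC : (n : ℂ) ≠ 0 := by exact_mod_cast hn.ne'
  have hs0 : s ≠ 0 := by rintro rfl; simp at hs
  have hls : (l : ℂ) - s ≠ 0 := by
    intro h; have := congrArg Complex.re h; simp [hs] at this; linarith
  have hL : 0 ≤ Real.log n := Real.log_nonneg (by exact_mod_cast hn)
  have hint : IntegrableOn (fun t : ℝ => (smoothWeight l n t : ℂ) * Complex.exp (-s * t))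
      (Set.Ioi 0) := by
    refine laplace_integrable (C := (n : ℝ) ^ (-(3 / 2 : ℝ))) (fun t _ => ?_) ?_ hs
    · rw [Complex.norm_real, Real.norm_of_nonneg (smoothWeight_nonneg _ _ _)]
      exact smoothWeight_le (by linarith) n hn t
    · exact (Complex.continuous_ofReal.comp
        (continuous_smoothWeight (by linarith) n)).continuousOn
  rw [← Set.Ioc_union_Ioi_eq_Ioi hL] at hint ⊢
  rw [setIntegral_union (Set.Ioc_disjoint_Ioi le_rfl) measurableSet_Ioi hint.left_of_union
    hint.right_of_union, ← intervalIntegral.integral_of_le hL]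
  have i1 : ∫ t in (0 : ℝ)..Real.log n, (smoothWeight l n t : ℂ) * Complex.exp (-s * t) =
      ∫ t in (0 : ℝ)..Real.log n, (n : ℂ) ^ (-(l : ℂ)) * Complex.exp ((l - s) * t) := by
    refine intervalIntegral.integral_congr (fun t ht => ?_)
    rw [Set.uIcc_of_le hL] at ht
    rw [smoothWeight_of_ge (by linarith) hn ht.2]
    push_cast
    rw [Complex.ofReal_cpow hn'.le]
    push_cast
    rw [mul_comm (Complex.exp _), mul_assoc, ← Complex.exp_add]
    ring_nf
  have i2 : ∫ t in Set.Ioi (Real.log n), (smoothWeight l n t : ℂ) * Complex.exp (-s * t) =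
      ∫ t in Set.Ioi (Real.log n), Complex.exp (-s * t) := by
    refine setIntegral_congr_fun measurableSet_Ioi (fun t ht => ?_)
    rw [smoothWeight_of_le (by linarith) hn (le_of_lt ht)]
    simp
  have e1 : ∀ a : ℂ, Complex.exp (a * (Real.log n : ℂ)) = (n : ℂ) ^ a := by
    intro a
    rw [Complex.cpow_def_of_ne_zero hnC, Complex.ofReal_log hn'.le, mul_comm]
    simp
  rw [i1, i2, intervalIntegral.integral_const_mul, integral_exp_mul_complex hls,
    integral_exp_mul_complex_Ioi (by simp [hs]), e1, e1]
  have e2 : (n : ℂ) ^ ((l : ℂ) - s) = (n : ℂ) ^ (l : ℂ) * (n : ℂ) ^ (-s) := by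
    rw [sub_eq_add_neg, Complex.cpow_add _ _ hnC]
  have e3 : (n : ℂ) ^ (-(l : ℂ)) * (n : ℂ) ^ (l : ℂ) = 1 := by
    rw [← Complex.cpow_add _ _ hnC]; simp
  rw [e2]
  simp only [Complex.ofReal_zero, mul_zero, Complex.exp_zero]
  have e4 : (n : ℂ) ^ (-(l : ℂ)) * (((n : ℂ) ^ (l : ℂ) * (n : ℂ) ^ (-s) - 1) / (l - s)) =
      ((n : ℂ) ^ (-s) - (n : ℂ) ^ (-(l : ℂ))) / (l - s) := by
    rw [mul_div_assoc', mul_sub, ← mul_assoc, e3]; ring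
  rw [e4]
  field_simp
  ring

end

section
open MeasureTheory

lemma norm_div_sub_le {l : ℝ} (hl : 3 ≤ l) {ρ : ℂ} (hρ : ρ.re ≤ 1 / 2) :
    ‖(l : ℂ) / (l - ρ)‖ ≤ l * (2 + l) / (1 + ‖ρ‖) := by
  have h1 : 1 ≤ ‖(l : ℂ) - ρ‖ := by
    refine le_trans ?_ (Complex.re_le_norm _)
    simp; linarith
  have h2 : ‖ρ‖ ≤ l + ‖(l : ℂ) - ρ‖ := by
    calc ‖ρ‖ = ‖(l : ℂ) - ((l : ℂ) - ρ)‖ := by ring_nf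
      _ ≤ ‖(l : ℂ)‖ + ‖(l : ℂ) - ρ‖ := norm_sub_le _ _
      _ = _ := by rw [Complex.norm_real, Real.norm_of_nonneg (by linarith)]
  rw [norm_div, Complex.norm_real, Real.norm_of_nonneg (by linarith), mul_div_assoc,
    div_eq_mul_one_div]
  refine mul_le_mul_of_nonneg_left ?_ (by linarith)
  rw [div_le_div_iff₀ (by linarith) (by positivity)]
  nlinarith

/-- The smoothed twisted prime sum `∑ Λ(n) χ(n) min(1, (e^t/n)^l)`. -/
noncomputable def smoothSum {N : ℕ} (χ : DirichletCharacter ℂ N) (l t : ℝ) : ℂ :=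
  ∑' n : ℕ, χ (n : ZMod N) * (ArithmeticFunction.vonMangoldt n : ℂ) * (smoothWeight l n t : ℂ)

lemma mangoldtSeries_eq_tsum {N : ℕ} (χ : DirichletCharacter ℂ N) {s : ℂ} (hs : 1 < s.re) :
    HasSum (fun n : ℕ => χ (n : ZMod N) * (ArithmeticFunction.vonMangoldt n : ℂ) *
      (n : ℂ) ^ (-s)) (mangoldtSeries χ s) := by
  have hS : Summable (LSeries.term
      (fun n : ℕ => χ (n : ZMod N) * (ArithmeticFunction.vonMangoldt n : ℂ)) s) :=
    Summable.of_norm_bounded (summable_mangoldtMajorant hs) (norm_term_vonMangoldt χ s)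
  have : HasSum _ (mangoldtSeries χ s) := hS.hasSum
  refine this.congr_fun (fun n => ?_)
  rcases Nat.eq_zero_or_pos n with rfl | hn
  · simp
  · rw [LSeries.term_of_ne_zero hn.ne', Complex.cpow_neg, div_eq_mul_inv]

section
variable {N : ℕ} (χ : DirichletCharacter ℂ N) {l : ℝ}

lemma norm_smoothTerm_le (hl : 3 ≤ l) (n : ℕ) (t : ℝ) :
    ‖χ (n : ZMod N) * (ArithmeticFunction.vonMangoldt n : ℂ) * (smoothWeight l n t : ℂ)‖ ≤
      ArithmeticFunction.vonMangoldt n * (n : ℝ) ^ (-(3 / 2 : ℝ)) * Real.exp (3 / 2 * t) := by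
  have h0 := ArithmeticFunction.vonMangoldt_nonneg (n := n)
  rcases Nat.eq_zero_or_pos n with rfl | hn
  · simp
  · rw [norm_mul, norm_mul, Complex.norm_real, Complex.norm_real, Real.norm_of_nonneg h0,
      Real.norm_of_nonneg (smoothWeight_nonneg _ _ _), mul_assoc _ _ (Real.exp _)]
    have h1 := DirichletCharacter.norm_le_one χ (n : ZMod N)
    have h2 := smoothWeight_le (l := l) (by linarith) n hn t
    have h3 := smoothWeight_nonneg l n t
    calc _ ≤ 1 * ArithmeticFunction.vonMangoldt n * smoothWeight l n t := by gcongr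
      _ ≤ _ := by rw [one_mul]; gcongr

theorem explicit_formula {ι : Type*} [Countable ι] {ρ : ι → ℂ} {m : ι → ℕ}
    (hre : ∀ i, (ρ i).re ≤ 1 / 2) (hm : Summable (fun i => (m i : ℝ) / (1 + ‖ρ i‖) ^ 2))
    (hl : 3 ≤ l)
    (hD : ∀ s : ℂ, s.re = 2 → HasSum (fun i => (m i : ℂ) * (1 / (s - ρ i) - 1 / (l - ρ i)))
      (mangoldtSeries χ l - mangoldtSeries χ s)) {t : ℝ} (ht : 0 ≤ t) :
    HasSum (fun i => (m i : ℂ) * (l / (l - ρ i)) * expInt (ρ i) t)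
      (mangoldtSeries χ l - smoothSum χ l t) := by
  -- the zero side
  have hC1 : Summable (fun i => (m i : ℝ) / (1 + ‖ρ i‖) ^ 2 * (3 * (l * (2 + l)))) :=
    hm.mul_right _
  have hu1 : ∀ i t, 0 ≤ t → ‖(m i : ℂ) * (l / (l - ρ i)) * expInt (ρ i) t‖ ≤
      (m i : ℝ) / (1 + ‖ρ i‖) ^ 2 * (3 * (l * (2 + l))) * Real.exp (3 / 2 * t) := by
    intro i t ht
    rw [norm_mul, norm_mul, Complex.norm_natCast]
    calc _ ≤ (m i : ℝ) * (l * (2 + l) / (1 + ‖ρ i‖)) *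
          (3 / (1 + ‖ρ i‖) * Real.exp (3 / 2 * t)) := by
          gcongr
          · exact norm_div_sub_le hl (hre i)
          · exact norm_expInt_le (hre i) ht
      _ = _ := by field_simp
  have hc1 : ∀ i, ContinuousOn (fun t => (m i : ℂ) * (l / (l - ρ i)) * expInt (ρ i) t)
      (Set.Ici 0) := by
    intro i
    refine ContinuousOn.mul continuousOn_const ?_
    exact (continuous_iff_continuousAt.2
      (fun t => (hasDerivAt_expInt (ρ i) t).continuousAt)).continuousOn
  -- the prime side
  have hC2 : Summable (fun n : ℕ => ArithmeticFunction.vonMangoldt n *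
      (n : ℝ) ^ (-(3 / 2 : ℝ))) := summable_mangoldtMajorant (by norm_num)
  have hu2 : ∀ (n : ℕ) (t : ℝ), 0 ≤ t → ‖χ (n : ZMod N) *
      (ArithmeticFunction.vonMangoldt n : ℂ) * (smoothWeight l n t : ℂ)‖ ≤
      ArithmeticFunction.vonMangoldt n * (n : ℝ) ^ (-(3 / 2 : ℝ)) * Real.exp (3 / 2 * t) :=
    fun n t _ => norm_smoothTerm_le χ hl n t
  have hc2 : ∀ n : ℕ, ContinuousOn (fun t => χ (n : ZMod N) *
      (ArithmeticFunction.vonMangoldt n : ℂ) * (smoothWeight l n t : ℂ)) (Set.Ici 0) := by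
    intro n
    refine ContinuousOn.mul continuousOn_const ?_
    exact (Complex.continuous_ofReal.comp (continuous_smoothWeight (by linarith) n)).continuousOn
  have hlre : 1 < (l : ℂ).re := by simp; linarith
  set D := mangoldtSeries χ l with hDdef
  set h : ℝ → ℂ := fun t => smoothSum χ l t - D +
    ∑' i, (m i : ℂ) * (l / (l - ρ i)) * expInt (ρ i) t with hh
  have hkey : ∀ t, 0 ≤ t → h t = 0 := by
    have k2c := laplace_tsum_continuousOn hC2 hu2 hc2
    have k1c := laplace_tsum_continuousOn hC1 hu1 hc1
    refine laplace_unique (C := (∑' n : ℕ, ArithmeticFunction.vonMangoldt n *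
      (n : ℝ) ^ (-(3 / 2 : ℝ))) + ‖D‖ +
      ∑' i, (m i : ℝ) / (1 + ‖ρ i‖) ^ 2 * (3 * (l * (2 + l)))) ?_ ?_ ?_ ?_
    · exact (k2c.sub continuousOn_const).add k1c
    · have h1 : smoothSum χ l 0 = D := by
        rw [smoothSum]
        refine HasSum.tsum_eq ((mangoldtSeries_eq_tsum χ hlre).congr_fun (fun n => ?_))
        rcases Nat.eq_zero_or_pos n with rfl | hn
        · simp
        · rw [smoothWeight_of_ge (by linarith) hn (Real.log_nonneg (by exact_mod_cast hn))]
          push_cast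
          rw [Complex.ofReal_cpow (by positivity)]
          simp
      simp [hh, h1, expInt]
    · intro t ht
      have e1 : 1 ≤ Real.exp (3 / 2 * t) := Real.one_le_exp (by positivity)
      have b1 := laplace_tsum_bound hC1 hu1 ht
      have b2 := laplace_tsum_bound hC2 hu2 ht
      calc ‖h t‖ ≤ ‖smoothSum χ l t‖ + ‖D‖ +
            ‖∑' i, (m i : ℂ) * (l / (l - ρ i)) * expInt (ρ i) t‖ :=
            (norm_add_le _ _).trans (by gcongr; exact norm_sub_le _ _)
        _ ≤ _ := by
            have := norm_nonneg D
            rw [add_mul, add_mul]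
            refine add_le_add (add_le_add b2 (le_mul_of_one_le_right this e1)) b1
    · intro s hs
      have hs0 : s ≠ 0 := by rintro rfl; simp at hs
      have hls : (l : ℂ) - s ≠ 0 := by
        intro h; have := congrArg Complex.re h; simp [hs] at this; linarith
      have hsre : 1 < s.re := by rw [hs]; norm_num
      have t1 := laplace_tsum hC1 hu1 hc1 hs
      have t2 := laplace_tsum hC2 hu2 hc2 hs
      have v1 : ∫ t in Set.Ioi (0 : ℝ), (∑' i, (m i : ℂ) * (l / (l - ρ i)) * expInt (ρ i) t) *
          Complex.exp (-s * t) = l / (s * (l - s)) * (D - mangoldtSeries χ s) := by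
        refine t1.unique (((hD s hs).mul_left (l / (s * (l - s)))).congr_fun (fun i => ?_))
        have n1 : s - ρ i ≠ 0 := by
          intro h; have := congrArg Complex.re h; simp [hs] at this; linarith [hre i]
        have n2 : (l : ℂ) - ρ i ≠ 0 := by
          intro h; have := congrArg Complex.re h; simp at this; linarith [hre i]
        have := laplace_expInt (hre i) hs
        calc _ = ∫ t in Set.Ioi (0 : ℝ), ((m i : ℂ) * (l / (l - ρ i))) *
              (expInt (ρ i) t * Complex.exp (-s * t)) := by simp only [mul_assoc]
          _ = _ := by
              rw [integral_const_mul, this]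
              field_simp
              ring
      have v2 : ∫ t in Set.Ioi (0 : ℝ), smoothSum χ l t * Complex.exp (-s * t) =
          l / (s * (l - s)) * mangoldtSeries χ s - 1 / (l - s) * D := by
        refine t2.unique ((((mangoldtSeries_eq_tsum χ hsre).mul_left (l / (s * (l - s)))).sub
          ((mangoldtSeries_eq_tsum χ hlre).mul_left (1 / (l - s)))).congr_fun (fun n => ?_))
        rcases Nat.eq_zero_or_pos n with rfl | hn
        · simp
        · calc _ = ∫ t in Set.Ioi (0 : ℝ), (χ (n : ZMod N) *
                (ArithmeticFunction.vonMangoldt n : ℂ)) *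
                ((smoothWeight l n t : ℂ) * Complex.exp (-s * t)) := by simp only [mul_assoc]
            _ = _ := by
                rw [integral_const_mul, laplace_smoothWeight hl hn hs]
                ring
      have v3 : ∫ t in Set.Ioi (0 : ℝ), Complex.exp (-s * t) = 1 / s := by
        rw [integral_exp_mul_complex_Ioi (by simp [hs])]
        simp
      have i2 := laplace_integrable (fun t ht => laplace_tsum_bound hC2 hu2 ht) k2c hs
      have i1 := laplace_integrable (fun t ht => laplace_tsum_bound hC1 hu1 ht) k1c hs
      have i3 : IntegrableOn (fun t : ℝ => Complex.exp (-s * t)) (Set.Ioi 0) :=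
        integrableOn_exp_mul_complex_Ioi (by simp [hs]) 0
      have i2' : IntegrableOn (fun t : ℝ => smoothSum χ l t * Complex.exp (-s * t))
        (Set.Ioi 0) := i2
      have i4 : IntegrableOn (fun t : ℝ => smoothSum χ l t * Complex.exp (-s * t) -
        D * Complex.exp (-s * t)) (Set.Ioi 0) := i2'.sub (i3.const_mul D)
      calc ∫ t in Set.Ioi (0 : ℝ), h t * Complex.exp (-s * t)
          = ∫ t in Set.Ioi (0 : ℝ), (smoothSum χ l t * Complex.exp (-s * t) -
            D * Complex.exp (-s * t) + (∑' i, (m i : ℂ) * (l / (l - ρ i)) * expInt (ρ i) t) *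
          Complex.exp (-s * t)) := by
            congr 1; ext t; simp only [hh]; ring
        _ = 0 := by
            rw [integral_add i4 i1, integral_sub i2' (i3.const_mul D),
              integral_const_mul, v1, v2, v3]
            field_simp
            ring
  have := hkey t ht
  have h2 : D - smoothSum χ l t = ∑' i, (m i : ℂ) * (l / (l - ρ i)) * expInt (ρ i) t := by
    simp only [hh] at this
    linear_combination -this
  rw [h2]
  refine Summable.hasSum ?_
  exact Summable.of_norm_bounded (hC1.mul_right (Real.exp (3 / 2 * t))) (fun i => hu1 i t ht)
end

end

section
open DirichletCharacter

/-- The weight attached to a zero `1/2 + iγ` by the smoothed explicit formula. -/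
noncomputable def zeroWeight (l γ : ℝ) : ℂ := l / (critPt γ * (l - critPt γ))

lemma norm_critPt_sq (γ : ℝ) : ‖critPt γ‖ ^ 2 = 1 / 4 + γ ^ 2 := by
  rw [Complex.sq_norm, Complex.normSq_apply]
  simp; ring

lemma norm_sub_critPt_sq (l γ : ℝ) : ‖(l : ℂ) - critPt γ‖ ^ 2 = (l - 1 / 2) ^ 2 + γ ^ 2 := by
  rw [Complex.sq_norm, Complex.normSq_apply]
  simp; ring

lemma one_add_abs_le_norm_critPt (γ : ℝ) : 1 + |γ| ≤ 3 * ‖critPt γ‖ := by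
  refine (pow_le_pow_iff_left₀ (by positivity) (by positivity) two_ne_zero).1 ?_
  rw [mul_pow, norm_critPt_sq]
  nlinarith [sq_abs γ, sq_nonneg (|γ| - 1 / 8)]

lemma norm_critPt_le_norm_sub {l : ℝ} (hl : 1 ≤ l) (γ : ℝ) :
    ‖critPt γ‖ ≤ ‖(l : ℂ) - critPt γ‖ := by
  refine (pow_le_pow_iff_left₀ (by positivity) (by positivity) two_ne_zero).1 ?_
  rw [norm_critPt_sq, norm_sub_critPt_sq]
  nlinarith

lemma le_norm_sub_critPt (l γ : ℝ) : l - 1 / 2 ≤ ‖(l : ℂ) - critPt γ‖ := by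
  refine le_trans ?_ (Complex.re_le_norm _)
  simp

lemma norm_critPt_pos (γ : ℝ) : 0 < ‖critPt γ‖ := by
  have := one_add_abs_le_norm_critPt γ
  have := abs_nonneg γ
  linarith

lemma norm_zeroWeight {l : ℝ} (hl : 0 ≤ l) (γ : ℝ) :
    ‖zeroWeight l γ‖ = l / (‖critPt γ‖ * ‖(l : ℂ) - critPt γ‖) := by
  rw [zeroWeight, norm_div, norm_mul, Complex.norm_real, Real.norm_of_nonneg hl]

lemma norm_zeroWeight_le_sq {l : ℝ} (hl : 1 ≤ l) (γ : ℝ) :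
    ‖zeroWeight l γ‖ ≤ l / (1 / 4 + γ ^ 2) := by
  rw [norm_zeroWeight (by linarith), ← norm_critPt_sq, sq]
  have := norm_critPt_pos γ
  have := norm_critPt_le_norm_sub hl γ
  gcongr

lemma norm_zeroWeight_le {l : ℝ} (hl : 1 ≤ l) (γ : ℝ) :
    ‖zeroWeight l γ‖ ≤ 6 / (1 + |γ|) := by
  rw [norm_zeroWeight (by linarith)]
  have h1 := one_add_abs_le_norm_critPt γ
  have h2 := le_norm_sub_critPt l γ
  have h3 := norm_critPt_pos γ
  have h4 := abs_nonneg γ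
  rw [div_le_div_iff₀ (mul_pos h3 (by linarith)) (by linarith)]
  have h5 : l ≤ 2 * ‖(l : ℂ) - critPt γ‖ := by linarith
  calc l * (1 + |γ|) ≤ (2 * ‖(l : ℂ) - critPt γ‖) * (3 * ‖critPt γ‖) := by gcongr
    _ = _ := by ring

lemma norm_zeroWeight_le_one_add {l : ℝ} (hl : 1 ≤ l) (γ : ℝ) :
    ‖zeroWeight l γ‖ ≤ 9 * l / (1 + |γ|) ^ 2 := by
  refine (norm_zeroWeight_le_sq hl γ).trans ?_
  rw [div_le_div_iff₀ (by positivity) (by positivity)]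
  have : (1 + |γ|) ^ 2 ≤ 9 * (1 / 4 + γ ^ 2) := by
    nlinarith [sq_abs γ, sq_nonneg (|γ| - 1 / 8)]
  nlinarith

lemma zeroWeight_re {l : ℝ} (hl : 1 ≤ l) (γ : ℝ) : (zeroWeight l γ).re =
    (1 / 2) / (1 / 4 + γ ^ 2) + (l - 1 / 2) / ((l - 1 / 2) ^ 2 + γ ^ 2) := by
  have h1 : critPt γ ≠ 0 := norm_pos_iff.1 (norm_critPt_pos γ)
  have h2 : (l : ℂ) - critPt γ ≠ 0 := by
    rw [← norm_pos_iff]; have := le_norm_sub_critPt l γ; linarith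
  have : zeroWeight l γ = (critPt γ)⁻¹ + (l - critPt γ)⁻¹ := by
    rw [zeroWeight]; field_simp; ring
  rw [this, Complex.add_re, Complex.inv_re, Complex.inv_re, ← Complex.sq_norm, ← Complex.sq_norm,
    norm_critPt_sq, norm_sub_critPt_sq]
  simp

section
variable {N : ℕ} [NeZero N] {χ : DirichletCharacter ℂ N}

/-- The sum over zeros in the smoothed explicit formula. -/
noncomputable def zeroSum (χ : DirichletCharacter ℂ N) (l t : ℝ) : ℂ :=
  ∑' γ : ℝ, (zmult χ γ : ℂ) * zeroWeight l γ * Complex.exp (critPt γ * t)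

lemma summable_zmult_norm_zeroWeight (hχ : χ ≠ 1) (hp : χ.IsPrimitive) (hG : GRHchi χ) {l : ℝ}
    (hl : 1 ≤ l) : Summable (fun γ => (zmult χ γ : ℝ) * ‖zeroWeight l γ‖) := by
  refine Summable.of_nonneg_of_le (fun γ => by positivity) (fun γ => ?_)
    ((zmult_summable hχ hp hG).mul_left (9 * l))
  calc _ ≤ (zmult χ γ : ℝ) * (9 * l / (1 + |γ|) ^ 2) := by
        gcongr; exact norm_zeroWeight_le_one_add hl γ
    _ = _ := by ring

lemma norm_exp_critPt (γ t : ℝ) : ‖Complex.exp (critPt γ * t)‖ = Real.exp (t / 2) := by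
  rw [Complex.norm_exp]; congr 1; simp; ring

lemma summable_zeroSum (hχ : χ ≠ 1) (hp : χ.IsPrimitive) (hG : GRHchi χ) {l : ℝ}
    (hl : 1 ≤ l) (t : ℝ) : Summable (fun γ : ℝ =>
      (zmult χ γ : ℂ) * zeroWeight l γ * Complex.exp (critPt γ * t)) := by
  refine Summable.of_norm ?_
  refine ((summable_zmult_norm_zeroWeight hχ hp hG hl).mul_right (Real.exp (t / 2))).congr
    (fun γ => ?_)
  rw [norm_mul, norm_mul, norm_exp_critPt]
  simp

/-- The real part of the trivial zeros' contribution is controlled termwise. -/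
lemma norm_trivial_term_le {l a : ℝ} (hl : 3 ≤ l) (ha : 0 ≤ a) {t : ℝ} (ht : 0 ≤ t) (k : ℕ) :
    ‖(l : ℂ) / (l - (-(a + 2 * k) : ℝ)) * expInt ((-(a + 2 * k) : ℝ)) t‖ ≤
      (if k = 0 then t else 0) + l * (1 / 4 * (1 / (k : ℝ) ^ 2)) := by
  set b : ℝ := a + 2 * k with hb
  have hb0 : 0 ≤ b := by positivity
  have e1 : (l : ℂ) - (-b : ℝ) = ((l + b : ℝ) : ℂ) := by push_cast; ring
  rw [e1, norm_mul, norm_div, Complex.norm_real, Complex.norm_real,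
    Real.norm_of_nonneg (by linarith), Real.norm_of_nonneg (by linarith)]
  by_cases hk : k = 0
  · have h2 : ‖expInt ((-b : ℝ)) t‖ ≤ 1 * |t - 0| := by
      refine intervalIntegral.norm_integral_le_of_norm_le_const (fun v hv => ?_)
      rw [Set.uIoc_of_le ht] at hv
      rw [Complex.norm_exp]
      have : ((-b : ℝ) * (v : ℂ)).re = -b * v := by simp
      rw [this]
      exact Real.exp_le_one_iff.2 (by nlinarith [hv.1])
    have h3 : l / (l + b) ≤ 1 := by rw [div_le_one (by linarith)]; linarith
    simp only [hk, if_true]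
    rw [one_mul, sub_zero, abs_of_nonneg ht] at h2
    have := mul_le_mul h3 h2 (norm_nonneg _) zero_le_one
    simpa using this
  · have hk1 : (1 : ℝ) ≤ k := by exact_mod_cast Nat.one_le_iff_ne_zero.2 hk
    have hbk : 2 * (k : ℝ) ≤ b := by linarith
    have hbp : 0 < b := by linarith
    have h2 : b * ‖expInt ((-b : ℝ)) t‖ ≤ 1 := by
      have h3 := mul_expInt ((-b : ℝ)) t
      have h4 : ‖((-b : ℝ) : ℂ)‖ = b := by
        rw [Complex.norm_real, norm_neg, Real.norm_of_nonneg hb0]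
      have h6 : b * ‖expInt ((-b : ℝ)) t‖ = ‖Complex.exp ((-b : ℝ) * (t : ℂ)) - 1‖ := by
        rw [← h3, norm_mul, h4]
      rw [h6]
      have : Complex.exp ((-b : ℝ) * (t : ℂ)) - 1 = ((Real.exp (-b * t) - 1 : ℝ) : ℂ) := by
        push_cast; rfl
      rw [this, Complex.norm_real, Real.norm_eq_abs, abs_le]
      have h5 : Real.exp (-b * t) ≤ 1 := Real.exp_le_one_iff.2 (by nlinarith)
      constructor <;> linarith [Real.exp_pos (-b * t)]
    have h3 : ‖expInt ((-b : ℝ)) t‖ ≤ 1 / b := by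
      rw [le_div_iff₀ hbp]; linarith
    simp only [hk, if_false, zero_add]
    calc l / (l + b) * ‖expInt ((-b : ℝ)) t‖ ≤ l / (2 * k) * (1 / (2 * k)) := by
          have hl0 : 0 ≤ l := by linarith
          refine mul_le_mul ?_ (h3.trans ?_) (norm_nonneg _) (by positivity)
          · gcongr; linarith
          · gcongr
      _ = _ := by field_simp; ring

theorem norm_smoothSum_add_zeroSum_le (hχ : χ ≠ 1) (hp : χ.IsPrimitive) (hG : GRHchi χ) {l : ℝ}
    (hl : 3 ≤ l) {t : ℝ} (ht : 0 ≤ t) :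
    ‖smoothSum χ l t + zeroSum χ l t‖ ≤
      mangoldtMajorant 3 + ‖zeroSum χ l 0‖ + t + l := by
  set S : Set ℝ := Function.support (fun γ => (zmult χ γ : ℝ) / (1 + |γ|) ^ 2) with hS
  have hScount : S.Countable := (zmult_summable hχ hp hG).countable_support
  have hSz : ∀ γ, γ ∉ S → zmult χ γ = 0 := by
    intro γ hγ
    rw [hS, Function.mem_support, not_not, div_eq_zero_iff] at hγ
    rcases hγ with h | h
    · exact_mod_cast h
    · exfalso; have : 0 < (1 + |γ|) ^ 2 := by positivity
      exact this.ne' h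
  have hsub : ∀ {F : ℝ → ℂ} {G : ℂ}, (∀ γ, zmult χ γ = 0 → F γ = 0) → HasSum F G →
      HasSum (fun γ : S => F γ) G := by
    intro F G hF h
    refine (hasSum_subtype_iff_of_support_subset ?_).2 h
    intro γ hγ
    by_contra hc
    exact hγ (hF γ (hSz γ hc))
  have : Countable S := hScount.to_subtype
  set a := gammaShift χ with ha
  have ha0 : 0 ≤ a := gammaShift_nonneg χ
  have ha1 : a ≤ 1 := gammaShift_le_one χ
  let ρ : S ⊕ ℕ → ℂ := Sum.elim (fun γ => critPt γ) (fun k => ((-(a + 2 * k) : ℝ) : ℂ))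
  let m : S ⊕ ℕ → ℕ := Sum.elim (fun γ => zmult χ γ) (fun _ => 1)
  have hre : ∀ i, (ρ i).re ≤ 1 / 2 := by
    rintro (γ | k)
    · simp [ρ]
    · simp only [ρ, Sum.elim_inr, Complex.ofReal_re]
      have : (0 : ℝ) ≤ k := Nat.cast_nonneg k
      linarith
  have hlre : 1 < (l : ℂ).re := by simp; linarith
  have hz2 : Summable (fun k : ℕ => 1 / (k : ℝ) ^ 2) := hasSum_zeta_two.summable
  have hm : Summable (fun i => (m i : ℝ) / (1 + ‖ρ i‖) ^ 2) := by
    have s1 : Summable (fun γ : S => (m (Sum.inl γ) : ℝ) / (1 + ‖ρ (Sum.inl γ)‖) ^ 2) := by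
      refine Summable.of_nonneg_of_le (fun γ => by positivity) (fun γ => ?_)
        ((zmult_summable hχ hp hG).subtype S)
      simp only [m, ρ, Sum.elim_inl, Function.comp_apply]
      have : |(γ : ℝ)| ≤ ‖critPt γ‖ := by
        have := Complex.abs_im_le_norm (critPt γ); simpa using this
      gcongr
    have s2 : Summable (fun k : ℕ => (m (Sum.inr k) : ℝ) / (1 + ‖ρ (Sum.inr k)‖) ^ 2) := by
      refine Summable.of_nonneg_of_le (fun γ => by positivity) (fun k => ?_)
        ((summable_nat_add_iff 1).2 hz2)
      simp only [m, ρ, Sum.elim_inr]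
      rw [Complex.norm_real, norm_neg, Real.norm_of_nonneg (by positivity)]
      push_cast
      have hk0 : (0 : ℝ) ≤ k := Nat.cast_nonneg k
      have hk : (k : ℝ) + 1 ≤ 1 + (a + 2 * k) := by linarith
      gcongr
    exact (HasSum.sum (f := fun i => (m i : ℝ) / (1 + ‖ρ i‖) ^ 2) s1.hasSum s2.hasSum).summable
  have hD : ∀ s : ℂ, s.re = 2 → HasSum (fun i => (m i : ℂ) * (1 / (s - ρ i) - 1 / (l - ρ i)))
      (mangoldtSeries χ l - mangoldtSeries χ s) := by
    intro s hs
    have hs1 : 1 < s.re := by rw [hs]; norm_num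
    have p1 := hsub (fun γ h => by simp [h]) (hasSum_zeros_complex hχ hp hG hs1 hlre)
    have hy : 0 < (l + a) / 2 := by linarith
    have hs' : 0 < ((s + a) / 2).re := by simp [hs]; linarith
    have p2 := (hasSum_digamma hy hs').mul_left (-(1 / 2 : ℂ))
    have p3 : HasSum (fun k : ℕ => (m (Sum.inr k) : ℂ) * (1 / (s - ρ (Sum.inr k)) -
        1 / (l - ρ (Sum.inr k)))) (-(1 / 2 : ℂ) * (Complex.digamma ((s + a) / 2) -
          Complex.digamma (((l + a) / 2 : ℝ) : ℂ))) := by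
      refine p2.congr_fun (fun k => ?_)
      simp only [m, ρ, Sum.elim_inr]
      have n1 : s + a + 2 * k ≠ 0 := by
        intro h; have := congrArg Complex.re h; simp [hs] at this
        have : (0 : ℝ) ≤ k := Nat.cast_nonneg k
        linarith
      have n2 : (l : ℂ) + a + 2 * k ≠ 0 := by
        intro h; have := congrArg Complex.re h; simp at this
        have : (0 : ℝ) ≤ k := Nat.cast_nonneg k
        linarith
      have e1 : s - ((-(a + 2 * k) : ℝ) : ℂ) = s + a + 2 * k := by push_cast; ring
      have e2 : (l : ℂ) - ((-(a + 2 * k) : ℝ) : ℂ) = l + a + 2 * k := by push_cast; ring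
      have e3 : (s + a) / 2 + k = (s + a + 2 * k) / 2 := by ring
      have e4 : (((l + a) / 2 : ℝ) : ℂ) + k = ((l : ℂ) + a + 2 * k) / 2 := by push_cast; ring
      rw [e1, e2, e3, e4]
      push_cast
      field_simp
      ring
    have p4 := HasSum.sum (f := fun i => (m i : ℂ) * (1 / (s - ρ i) - 1 / (l - ρ i))) p1 p3
    convert p4 using 1
    rw [logDeriv_completed hχ hs1, logDeriv_completed hχ hlre]
    push_cast
    ring
  have main := explicit_formula χ hre hm hl hD ht
  have z1 := (summable_zeroSum hχ hp hG (l := l) (by linarith) t).hasSum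
  have z0 := (summable_zeroSum hχ hp hG (l := l) (by linarith) 0).hasSum
  have q1 : HasSum (fun γ : S => (m (Sum.inl γ) : ℂ) * (l / (l - ρ (Sum.inl γ))) *
      expInt (ρ (Sum.inl γ)) t) (zeroSum χ l t - zeroSum χ l 0) := by
    have := hsub (fun γ h => by simp [h]) (z1.sub z0)
    refine this.congr_fun (fun γ => ?_)
    simp only [m, ρ, Sum.elim_inl]
    have h1 := mul_expInt (critPt γ) t
    have h2 : critPt γ ≠ 0 := norm_pos_iff.1 (norm_critPt_pos γ)
    have h3 := sub_critPt_ne_zero hlre γ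
    rw [zeroWeight]
    have h4 : expInt (critPt γ) t = (Complex.exp (critPt γ * t) - 1) / critPt γ := by
      rw [← h1]; field_simp
    rw [h4]
    simp only [Complex.ofReal_zero, mul_zero, Complex.exp_zero]
    field_simp
  have b1 : HasSum (fun k : ℕ => (if k = 0 then t else 0) + l * (1 / 4 * (1 / (k : ℝ) ^ 2)))
      (t + l * (1 / 4 * (Real.pi ^ 2 / 6))) :=
    (hasSum_ite_eq 0 t).add ((hasSum_zeta_two.mul_left _).mul_left _)
  have b2 : ∀ k : ℕ, ‖(m (Sum.inr k) : ℂ) * (l / (l - ρ (Sum.inr k))) * expInt (ρ (Sum.inr k)) t‖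
      ≤ (if k = 0 then t else 0) + l * (1 / 4 * (1 / (k : ℝ) ^ 2)) := by
    intro k
    simpa [m, ρ] using norm_trivial_term_le hl ha0 ht k
  have q2 := (Summable.of_norm_bounded b1.summable b2).hasSum
  have q3 := tsum_of_norm_bounded b1 b2
  have q4 := (HasSum.sum (f := fun i => (m i : ℂ) * (l / (l - ρ i)) * expInt (ρ i) t) q1 q2).unique
    main
  have q5 : smoothSum χ l t + zeroSum χ l t = mangoldtSeries χ l + zeroSum χ l 0 -
      ∑' k : ℕ, (m (Sum.inr k) : ℂ) * (l / (l - ρ (Sum.inr k))) * expInt (ρ (Sum.inr k)) t := by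
    linear_combination q4
  rw [q5]
  have q6 : ‖mangoldtSeries χ l‖ ≤ mangoldtMajorant 3 :=
    (norm_mangoldtSeries_le χ hlre).trans
      (mangoldtMajorant_anti (by norm_num) (by simpa using hl))
  have q7 : l * (1 / 4 * (Real.pi ^ 2 / 6)) ≤ l := by
    have : Real.pi ^ 2 ≤ 16 := by nlinarith [Real.pi_le_four, Real.pi_pos]
    nlinarith
  calc _ ≤ ‖mangoldtSeries χ l‖ + ‖zeroSum χ l 0‖ + _ :=
        (norm_sub_le _ _).trans (add_le_add_left (norm_add_le _ _) _)
    _ ≤ _ := by linarith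
end

end

lemma sum_div_sqrt_le {m : ℝ → ℝ} (hm : ∀ γ, 0 ≤ m γ) {s : Finset ℝ} {A T : ℝ} (hA : 0 ≤ A)
    (h : ∀ Y, 1 ≤ Y → Y ≤ T → ∑ γ ∈ s.filter (fun γ => |γ| ≤ Y), m γ ≤ A * Y) (hT : 1 ≤ T) :
    ∑ γ ∈ s.filter (fun γ => |γ| ≤ T), m γ / √(1 + |γ|) ≤ 6 * A * √T := by
  have key : ∀ n : ℕ, ∀ Y, 1 ≤ Y → Y ≤ T → Y ≤ 2 ^ n →
      ∑ γ ∈ s.filter (fun γ => |γ| ≤ Y), m γ / √(1 + |γ|) ≤ 6 * A * √Y := by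
    have triv : ∀ Y, 1 ≤ Y → Y ≤ T → Y ≤ 2 →
        ∑ γ ∈ s.filter (fun γ => |γ| ≤ Y), m γ / √(1 + |γ|) ≤ 6 * A * √Y := by
      intro Y h1 h2 h3
      have h4 : Y ≤ 2 * √Y := by
        nlinarith [Real.sq_sqrt (show 0 ≤ Y by linarith), Real.sqrt_nonneg Y,
          Real.one_le_sqrt.2 h1]
      calc _ ≤ ∑ γ ∈ s.filter (fun γ => |γ| ≤ Y), m γ := by
            refine Finset.sum_le_sum (fun γ _ => div_le_self (hm γ) ?_)
            rw [Real.one_le_sqrt]; linarith [abs_nonneg γ]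
        _ ≤ A * Y := h Y h1 h2
        _ ≤ A * (2 * √Y) := by gcongr
        _ ≤ _ := by nlinarith [mul_nonneg hA (Real.sqrt_nonneg Y)]
    intro n
    induction n with
    | zero => intro Y h1 h2 h3; exact triv Y h1 h2 (by norm_num at h3; linarith)
    | succ n ih =>
      intro Y h1 h2 h3
      by_cases h4 : Y ≤ 2
      · exact triv Y h1 h2 h4
      push Not at h4
      have i1 := ih (Y / 2) (by linarith) (by linarith) (by rw [pow_succ] at h3; linarith)
      have hsplit : ∑ γ ∈ s.filter (fun γ => |γ| ≤ Y), m γ / √(1 + |γ|) ≤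
          ∑ γ ∈ s.filter (fun γ => |γ| ≤ Y / 2), m γ / √(1 + |γ|) +
          ∑ γ ∈ s.filter (fun γ => |γ| ≤ Y), m γ / √(Y / 2) := by
        rw [Finset.sum_filter, Finset.sum_filter, Finset.sum_filter, ← Finset.sum_add_distrib]
        refine Finset.sum_le_sum (fun γ _ => ?_)
        have p1 : 0 ≤ m γ / √(Y / 2) := div_nonneg (hm γ) (Real.sqrt_nonneg _)
        by_cases c1 : |γ| ≤ Y / 2
        · have c2 : |γ| ≤ Y := by linarith
          simp only [c1, c2, if_true]; linarith
        · by_cases c2 : |γ| ≤ Y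
          · simp only [c1, c2, if_true, if_false, zero_add]
            push Not at c1
            refine div_le_div_of_nonneg_left (hm γ) (Real.sqrt_pos.2 (by linarith)) ?_
            exact Real.sqrt_le_sqrt (by linarith)
          · simp [c1, c2]
      have i2 := h Y h1 h2
      rw [← Finset.sum_div] at hsplit
      have hsY : √Y = √2 * √(Y / 2) := by
        rw [← Real.sqrt_mul (by norm_num)]; congr 1; ring
      have hs : 0 < √(Y / 2) := Real.sqrt_pos.2 (by linarith)
      have hs2 : √(Y / 2) ^ 2 = Y / 2 := Real.sq_sqrt (by linarith)
      have i3 : (∑ γ ∈ s.filter (fun γ => |γ| ≤ Y), m γ) / √(Y / 2) ≤ 2 * A * √(Y / 2) := by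
        rw [div_le_iff₀ hs]; nlinarith
      have h2' : (4 / 3 : ℝ) ≤ √2 := Real.le_sqrt_of_sq_le (by norm_num)
      rw [hsY]
      nlinarith [mul_nonneg hA hs.le]
  obtain ⟨n, hn⟩ := pow_unbounded_of_one_lt T (one_lt_two)
  exact key n T hT le_rfl hn.le

section
variable {N : ℕ} [NeZero N] {χ : DirichletCharacter ℂ N}

lemma finite_ordinates_le (hχ : χ ≠ 1) (hp : χ.IsPrimitive) (hG : GRHchi χ) (T : ℝ) :
    {γ : ℝ | zmult χ γ ≠ 0 ∧ |γ| ≤ T}.Finite := by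
  have h := (zmult_summable hχ hp hG).tendsto_cofinite_zero
  have h2 : ∀ᶠ γ in cofinite, (zmult χ γ : ℝ) / (1 + |γ|) ^ 2 < 1 / (2 * (1 + |T|) ^ 2) :=
    h.eventually (gt_mem_nhds (by positivity))
  refine Set.Finite.subset h2 ?_
  rintro γ ⟨h3, h4⟩
  simp only [Set.mem_compl_iff, Set.mem_ofPred_eq, not_lt]
  have h5 : (1 : ℝ) ≤ zmult χ γ := by exact_mod_cast Nat.one_le_iff_ne_zero.2 h3
  have h6 : |γ| ≤ |T| := h4.trans (le_abs_self T)
  calc 1 / (2 * (1 + |T|) ^ 2) ≤ 1 / (1 + |γ|) ^ 2 := by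
        refine one_div_le_one_div_of_le (by positivity) ?_
        have : (1 + |γ|) ^ 2 ≤ (1 + |T|) ^ 2 := by gcongr
        nlinarith [sq_nonneg (1 + |T|)]
    _ ≤ _ := by gcongr

/-- The finite set of ordinates of zeros up to height `T`. -/
noncomputable def lowZeros (χ : DirichletCharacter ℂ N) (T : ℝ) : Finset ℝ :=
  if h : {γ : ℝ | zmult χ γ ≠ 0 ∧ |γ| ≤ T}.Finite then h.toFinset else ∅

lemma mem_lowZeros (hχ : χ ≠ 1) (hp : χ.IsPrimitive) (hG : GRHchi χ) {T γ : ℝ} :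
    γ ∈ lowZeros χ T ↔ zmult χ γ ≠ 0 ∧ |γ| ≤ T := by
  rw [lowZeros, dif_pos (finite_ordinates_le hχ hp hG T)]
  simp

/-- The size of the density of zeros up to height `T`. -/
noncomputable def zeroDensity (N : ℕ) (T : ℝ) : ℝ :=
  Real.log N + Real.log (T + 1) + (5 + 2 * mangoldtMajorant (3 / 2))

lemma zeroSumValue_le_zeroDensity (hχ : χ ≠ 1) {Y T : ℝ} (hY : 1 ≤ Y) (hT : Y ≤ T) :
    zeroSumValue χ (Y + 1 / 2) ≤ zeroDensity N T := by
  have h := (abs_le.1 (abs_zeroSumValue_sub_le hχ (show 1 < Y + 1 / 2 by linarith))).2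
  have h1 := mangoldtMajorant_anti (show 1 < (3 / 2 : ℝ) by norm_num)
    (show 3 / 2 ≤ Y + 1 / 2 by linarith)
  have h2 : Real.log (Y + 1 / 2) ≤ Real.log (T + 1) :=
    Real.log_le_log (by linarith) (by linarith)
  rw [zeroDensity]
  linarith

lemma zeroDensity_nonneg (hχ : χ ≠ 1) (hp : χ.IsPrimitive) (hG : GRHchi χ) {T : ℝ} (hT : 1 ≤ T) :
    0 ≤ zeroDensity N T :=
  (zeroSumValue_nonneg hχ hp hG (σ := 1 + 1 / 2) (by norm_num)).trans
    (zeroSumValue_le_zeroDensity hχ le_rfl hT)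

lemma sum_zmult_le (hχ : χ ≠ 1) (hp : χ.IsPrimitive) (hG : GRHchi χ) {Y T : ℝ} (hY : 1 ≤ Y)
    (hT : Y ≤ T) (s : Finset ℝ) :
    ∑ γ ∈ s.filter (fun γ => |γ| ≤ Y), (zmult χ γ : ℝ) ≤ zeroDensity N T * Y := by
  have h := hasSum_zeros_real hχ hp hG (σ := Y + 1 / 2) (by linarith)
  have h1 := sum_le_hasSum (s.filter (fun γ => |γ| ≤ Y)) (fun γ _ => by
    have : 0 ≤ Y + 1 / 2 - 1 / 2 := by linarith
    positivity) h
  have h2 := h1.trans (zeroSumValue_le_zeroDensity hχ hY hT)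
  have h3 : (∑ γ ∈ s.filter (fun γ => |γ| ≤ Y), (zmult χ γ : ℝ)) * (1 / Y) ≤
      ∑ γ ∈ s.filter (fun γ => |γ| ≤ Y), (zmult χ γ : ℝ) * (2 * (Y + 1 / 2 - 1 / 2) /
      ((Y + 1 / 2 - 1 / 2) ^ 2 + γ ^ 2)) := by
    rw [Finset.sum_mul]
    refine Finset.sum_le_sum (fun γ hγ => ?_)
    have hγ2 := (Finset.mem_filter.1 hγ).2
    refine mul_le_mul_of_nonneg_left ?_ (Nat.cast_nonneg _)
    rw [show Y + 1 / 2 - 1 / 2 = Y by ring, div_le_div_iff₀ (by linarith) (by positivity)]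
    have : γ ^ 2 ≤ Y ^ 2 := by
      rw [← sq_abs γ]; gcongr
    nlinarith
  have h4 := h3.trans h2
  rw [mul_one_div, div_le_iff₀ (by linarith)] at h4
  exact h4

lemma sum_lowZeros_le (hχ : χ ≠ 1) (hp : χ.IsPrimitive) (hG : GRHchi χ) {T : ℝ} (hT : 1 ≤ T) :
    ∑ γ ∈ lowZeros χ T, (zmult χ γ : ℝ) / √(1 + |γ|) ≤ 6 * zeroDensity N T * √T := by
  have h := sum_div_sqrt_le (m := fun γ => (zmult χ γ : ℝ)) (fun γ => Nat.cast_nonneg _)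
    (zeroDensity_nonneg hχ hp hG hT)
    (fun Y h1 h2 => sum_zmult_le hχ hp hG h1 h2 (lowZeros χ T)) hT
  rwa [Finset.filter_true_of_mem (fun γ hγ => ((mem_lowZeros hχ hp hG).1 hγ).2)] at h

lemma norm_zeroSum_zero_le (hχ : χ ≠ 1) (hp : χ.IsPrimitive) (hG : GRHchi χ) {l : ℝ}
    (hl : 1 ≤ l) : ‖zeroSum χ l 0‖ ≤ 3 * l * zeroDensity N 2 := by
  have h := (hasSum_zeros_real hχ hp hG (σ := 3 / 2 + 1 / 2) (by norm_num)).mul_left (3 * l)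
  refine (tsum_of_norm_bounded h (fun γ => ?_)).trans ?_
  · rw [norm_mul, norm_mul, norm_exp_critPt]
    simp only [zero_div, Real.exp_zero, mul_one, Complex.norm_natCast]
    calc (zmult χ γ : ℝ) * ‖zeroWeight l γ‖ ≤ (zmult χ γ : ℝ) * (l / (1 / 4 + γ ^ 2)) := by
          gcongr; exact norm_zeroWeight_le_sq hl γ
      _ ≤ (zmult χ γ : ℝ) * (3 * l * (2 * (3 / 2 + 1 / 2 - 1 / 2) /
            ((3 / 2 + 1 / 2 - 1 / 2) ^ 2 + γ ^ 2))) := by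
          refine mul_le_mul_of_nonneg_left ?_ (Nat.cast_nonneg _)
          rw [← mul_div_assoc, div_le_div_iff₀ (by positivity) (by positivity)]
          nlinarith [sq_nonneg γ, mul_nonneg (show 0 ≤ l by linarith) (sq_nonneg γ)]
      _ = _ := by ring
  · have := zeroSumValue_le_zeroDensity (χ := χ) hχ (Y := 3 / 2) (T := 2) (by norm_num)
      (by norm_num)
    have h0 : 0 ≤ 3 * l := by linarith
    exact mul_le_mul_of_nonneg_left this h0

lemma hasSum_re_zeroSum_zero (hχ : χ ≠ 1) (hp : χ.IsPrimitive) (hG : GRHchi χ) {l : ℝ}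
    (hl : 1 ≤ l) : HasSum (fun γ => (zmult χ γ : ℝ) * (zeroWeight l γ).re) (zeroSum χ l 0).re := by
  refine (Complex.hasSum_re (summable_zeroSum hχ hp hG hl 0).hasSum).congr_fun (fun γ => ?_)
  simp

lemma re_zeroSum_zero_ge (hχ : χ ≠ 1) (hp : χ.IsPrimitive) (hG : GRHchi χ) {l η : ℝ}
    (hl : 3 ≤ l) (hη : 0 < η) (hη2 : η ≤ 1 / 2) :
    (1 / 2 - η) * Real.log N + 1 / 2 * (Real.log N + Real.log l) -
      (5 + mangoldtMajorant (1 + η) + mangoldtMajorant 3) ≤ (zeroSum χ l 0).re := by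
  have h1 := (hasSum_zeros_real hχ hp hG (σ := 1 + η) (by linarith)).mul_left (1 / (2 * (1 + 2 * η)))
  have h2 := (hasSum_zeros_real hχ hp hG (σ := l) (by linarith)).mul_left (1 / 2)
  have h3 := hasSum_le (fun γ => ?_) (h1.add h2) (hasSum_re_zeroSum_zero hχ hp hG (l := l) (by linarith))
  · have b1 := (abs_le.1 (abs_zeroSumValue_sub_le hχ (show 1 < 1 + η by linarith))).1
    have b2 := (abs_le.1 (abs_zeroSumValue_sub_le hχ (show 1 < l by linarith))).1
    have b3 := zeroSumValue_nonneg hχ hp hG (show 1 < 1 + η by linarith)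
    have b4 : 0 ≤ Real.log (1 + η) := Real.log_nonneg (by linarith)
    have b5 := mangoldtMajorant_anti (show 1 < (3 : ℝ) by norm_num) hl
    have b6 : 1 / 2 - η ≤ 1 / (2 * (1 + 2 * η)) := by
      rw [le_div_iff₀ (by positivity)]
      nlinarith
    have b7 := mul_le_mul_of_nonneg_right b6 b3
    have b8 : (1 / 2 - η) * (Real.log N - (5 + 2 * mangoldtMajorant (1 + η))) ≤
        (1 / 2 - η) * zeroSumValue χ (1 + η) :=
      mul_le_mul_of_nonneg_left (by linarith) (by linarith)
    have b9 := mangoldtMajorant_nonneg (1 + η)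
    nlinarith
  · rw [zeroWeight_re (by linarith)]
    have e1 : 1 / (2 * (1 + 2 * η)) * (2 * (1 + η - 1 / 2) / ((1 + η - 1 / 2) ^ 2 + γ ^ 2)) ≤
        (1 / 2) / (1 / 4 + γ ^ 2) := by
      have : 1 / (2 * (1 + 2 * η)) * (2 * (1 + η - 1 / 2) / ((1 + η - 1 / 2) ^ 2 + γ ^ 2)) =
          (1 / 2) / ((1 / 2 + η) ^ 2 + γ ^ 2) := by
        rw [show 1 + η - 1 / 2 = 1 / 2 + η by ring]
        field_simp
      rw [this]
      gcongr
      nlinarith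
    have e2 : (1 / 2) * (2 * (l - 1 / 2) / ((l - 1 / 2) ^ 2 + γ ^ 2)) =
        (l - 1 / 2) / ((l - 1 / 2) ^ 2 + γ ^ 2) := by ring
    have hm : (0 : ℝ) ≤ zmult χ γ := Nat.cast_nonneg _
    calc _ = (zmult χ γ : ℝ) * (1 / (2 * (1 + 2 * η)) *
          (2 * (1 + η - 1 / 2) / ((1 + η - 1 / 2) ^ 2 + γ ^ 2)) +
          (1 / 2) * (2 * (l - 1 / 2) / ((l - 1 / 2) ^ 2 + γ ^ 2))) := by ring
      _ ≤ _ := mul_le_mul_of_nonneg_left (by rw [e2]; linarith) hm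

theorem re_zeroSum_ge_of_near (hχ : χ ≠ 1) (hp : χ.IsPrimitive) (hG : GRHchi χ) {l δ T t : ℝ}
    (hl : 1 ≤ l) (hδ : 0 < δ) (hT : 1 ≤ T) (hlT : l = δ * T)
    (hnear : ∀ γ ∈ lowZeros χ T, ‖Complex.exp ((γ * t : ℝ) * Complex.I) - 1‖ ≤
      2 * Real.pi * (δ * (√(1 + |γ|) / √T))) :
    (zeroSum χ l 0).re - (72 * Real.pi + 2) * δ * zeroDensity N T ≤
      Real.exp (-t / 2) * (zeroSum χ l t).re := by
  have hTp : 0 < √T := Real.sqrt_pos.2 (by linarith)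
  have h0 := hasSum_re_zeroSum_zero hχ hp hG hl
  have h1 : HasSum (fun γ => (zmult χ γ : ℝ) *
      (zeroWeight l γ * Complex.exp ((γ * t : ℝ) * Complex.I)).re)
      (Real.exp (-t / 2) * (zeroSum χ l t).re) := by
    refine ((Complex.hasSum_re (summable_zeroSum hχ hp hG hl t).hasSum).mul_left
      (Real.exp (-t / 2))).congr_fun (fun γ => ?_)
    have e1 : Complex.exp (critPt γ * t) =
        ((Real.exp (t / 2) : ℝ) : ℂ) * Complex.exp ((γ * t : ℝ) * Complex.I) := by
      rw [Complex.ofReal_exp, ← Complex.exp_add, critPt]; congr 1; push_cast; ring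
    have e2 : Real.exp (-t / 2) * Real.exp (t / 2) = 1 := by
      rw [← Real.exp_add, neg_div, neg_add_cancel, Real.exp_zero]
    have e3 : (zmult χ γ : ℂ) * zeroWeight l γ * Complex.exp (critPt γ * t) =
        ((zmult χ γ * Real.exp (t / 2) : ℝ) : ℂ) *
          (zeroWeight l γ * Complex.exp ((γ * t : ℝ) * Complex.I)) := by
      rw [e1]; push_cast; ring
    rw [e3, Complex.re_ofReal_mul]
    linear_combination (-(zmult χ γ : ℝ) *
      (zeroWeight l γ * Complex.exp ((γ * t : ℝ) * Complex.I)).re) * e2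
  have h2 : HasSum (fun γ => if γ ∈ lowZeros χ T then
      12 * Real.pi * δ / √T * ((zmult χ γ : ℝ) / √(1 + |γ|)) else 0)
      (∑ γ ∈ lowZeros χ T, 12 * Real.pi * δ / √T * ((zmult χ γ : ℝ) / √(1 + |γ|))) := by
    have := hasSum_sum_of_ne_finset_zero (L := SummationFilter.unconditional ℝ)
      (f := fun γ => if γ ∈ lowZeros χ T then
      12 * Real.pi * δ / √T * ((zmult χ γ : ℝ) / √(1 + |γ|)) else 0) (s := lowZeros χ T)
      (fun γ hγ => if_neg hγ)
    rwa [Finset.sum_congr rfl (fun γ hγ => if_pos hγ)] at this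
  have h3 := (hasSum_zeros_real hχ hp hG (σ := T + 1 / 2) (by linarith)).mul_left (2 * δ)
  have h4 := hasSum_le (fun γ => ?_) (h0.sub h1) (h2.add h3)
  · rw [← Finset.mul_sum] at h4
    have c1 := sum_lowZeros_le hχ hp hG hT
    have c2 := zeroSumValue_le_zeroDensity (χ := χ) hχ hT le_rfl
    have c3 : 12 * Real.pi * δ / √T * ∑ γ ∈ lowZeros χ T, (zmult χ γ : ℝ) / √(1 + |γ|) ≤
        12 * Real.pi * δ / √T * (6 * zeroDensity N T * √T) := by gcongr
    have c4 : 12 * Real.pi * δ / √T * (6 * zeroDensity N T * √T) =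
        72 * Real.pi * δ * zeroDensity N T := by field_simp; ring
    nlinarith
  · have hm : (0 : ℝ) ≤ zmult χ γ := Nat.cast_nonneg _
    have d1 : (zeroWeight l γ).re -
        (zeroWeight l γ * Complex.exp ((γ * t : ℝ) * Complex.I)).re ≤
        ‖zeroWeight l γ‖ * ‖Complex.exp ((γ * t : ℝ) * Complex.I) - 1‖ := by
      rw [← norm_mul, ← norm_neg, ← Complex.sub_re]
      refine le_trans (le_of_eq ?_) (Complex.re_le_norm _)
      congr 1; ring
    have d0 : 0 ≤ 2 * δ * ((zmult χ γ : ℝ) * (2 * (T + 1 / 2 - 1 / 2) /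
        ((T + 1 / 2 - 1 / 2) ^ 2 + γ ^ 2))) := by
      have : 0 ≤ T + 1 / 2 - 1 / 2 := by linarith
      positivity
    rw [← mul_sub]
    by_cases hγ : γ ∈ lowZeros χ T
    · rw [if_pos hγ]
      have hs : 0 < √(1 + |γ|) := Real.sqrt_pos.2 (by positivity)
      have hs2 : √(1 + |γ|) ^ 2 = 1 + |γ| := Real.sq_sqrt (by positivity)
      calc _ ≤ (zmult χ γ : ℝ) * (6 / (1 + |γ|) * (2 * Real.pi * (δ * (√(1 + |γ|) / √T)))) := by
            refine mul_le_mul_of_nonneg_left (d1.trans ?_) hm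
            exact mul_le_mul (norm_zeroWeight_le hl γ) (hnear γ hγ) (norm_nonneg _)
              (by positivity)
        _ = 12 * Real.pi * δ / √T * ((zmult χ γ : ℝ) / √(1 + |γ|)) := by
            rw [show 6 / (1 + |γ|) = 6 / √(1 + |γ|) ^ 2 by rw [hs2]]; field_simp; ring
        _ ≤ _ := by linarith
    · rw [if_neg hγ, zero_add]
      by_cases hz : zmult χ γ = 0
      · simp [hz]
      have hγT : T < |γ| := by
        by_contra hc
        exact hγ ((mem_lowZeros hχ hp hG).2 ⟨hz, not_lt.1 hc⟩)
      have hγ2 : T ^ 2 ≤ γ ^ 2 := by rw [← sq_abs γ]; gcongr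
      have d2 : ‖Complex.exp ((γ * t : ℝ) * Complex.I) - 1‖ ≤ 2 := by
        refine (norm_sub_le _ _).trans ?_
        rw [Complex.norm_exp_ofReal_mul_I]; norm_num
      have d3 : ‖zeroWeight l γ‖ ≤ δ * (2 * T / (T ^ 2 + γ ^ 2)) := by
        refine (norm_zeroWeight_le_sq hl γ).trans ?_
        have hpos : 0 < T := by linarith
        rw [hlT, ← mul_div_assoc, div_le_div_iff₀ (by positivity) (by positivity)]
        have : 0 < δ * T := by positivity
        nlinarith
      calc _ ≤ (zmult χ γ : ℝ) * (δ * (2 * T / (T ^ 2 + γ ^ 2)) * 2) := by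
            refine mul_le_mul_of_nonneg_left (d1.trans ?_) hm
            exact mul_le_mul d3 d2 (norm_nonneg _) ((norm_nonneg _).trans d3)
        _ = _ := by rw [show T + 1 / 2 - 1 / 2 = T by ring]; ring
end

/-- Dirichlet's simultaneous approximation, with a separate precision for each frequency. -/
theorem exists_simultaneous_return (Γ : Finset ℝ) (M : ℝ → ℕ) (hM : ∀ γ ∈ Γ, 0 < M γ) (A : ℝ) :
    ∃ k : ℕ, 1 ≤ k ∧ k ≤ ∏ γ ∈ Γ, M γ ∧ ∀ γ ∈ Γ,
      ‖Complex.exp ((γ * (k * A) : ℝ) * Complex.I) - 1‖ ≤ 2 * Real.pi * (1 / M γ) := by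
  let F : ℕ → (γ : Γ) → ℕ := fun k γ => ⌊(M γ : ℝ) * Int.fract ((γ : ℝ) * ((k : ℝ) * A) / (2 * Real.pi))⌋₊
  have hmaps : ∀ k ∈ Finset.range (∏ γ ∈ Γ, M γ + 1),
      F k ∈ Fintype.piFinset (fun γ : Γ => Finset.range (M γ)) := by
    intro k _
    rw [Fintype.mem_piFinset]
    intro γ
    rw [Finset.mem_range]
    have h0 : (0 : ℝ) < M γ := by exact_mod_cast hM γ γ.2
    refine (Nat.floor_lt (mul_nonneg h0.le (Int.fract_nonneg _))).2 ?_
    nlinarith [Int.fract_lt_one ((γ : ℝ) * (k * A) / (2 * Real.pi))]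
  have hcard : (Fintype.piFinset (fun γ : Γ => Finset.range (M γ))).card <
      (Finset.range (∏ γ ∈ Γ, M γ + 1)).card := by
    rw [Fintype.card_piFinset, Finset.card_range]
    simp only [Finset.card_range]
    rw [Finset.prod_coe_sort Γ (fun γ => M γ)]
    exact Nat.lt_succ_self _
  obtain ⟨a, ha, b, hb, hab, hF⟩ := Finset.exists_ne_map_eq_of_card_lt_of_maps_to hcard hmaps
  wlog hlt : a < b generalizing a b
  · exact this b hb a ha hab.symm hF.symm (lt_of_le_of_ne (not_lt.1 hlt) hab.symm)
  refine ⟨b - a, by omega, ?_, fun γ hγ => ?_⟩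
  · have := Finset.mem_range.1 hb; omega
  have h0 : (0 : ℝ) < M γ := by exact_mod_cast hM γ hγ
  set u := γ * (a * A) / (2 * Real.pi) with hu
  set v := γ * (b * A) / (2 * Real.pi) with hv
  have hfl : ⌊(M γ : ℝ) * Int.fract u⌋₊ = ⌊(M γ : ℝ) * Int.fract v⌋₊ := congrFun hF ⟨γ, hγ⟩
  have hpi := Real.pi_pos
  have e1 : γ * (((b - a : ℕ) : ℝ) * A) = 2 * Real.pi * (v - u) := by
    rw [Nat.cast_sub hlt.le, hu, hv]; field_simp
  have e2 : Complex.exp ((γ * (((b - a : ℕ) : ℝ) * A) : ℝ) * Complex.I) =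
      Complex.exp (Complex.I * ((2 * Real.pi * (Int.fract v - Int.fract u) : ℝ))) := by
    rw [e1]
    have : ((2 * Real.pi * (v - u) : ℝ) : ℂ) * Complex.I =
        Complex.I * ((2 * Real.pi * (Int.fract v - Int.fract u) : ℝ)) +
          ((⌊v⌋ - ⌊u⌋ : ℤ) : ℂ) * (2 * Real.pi * Complex.I) := by
      have r1 := Int.self_sub_floor v
      have r2 := Int.self_sub_floor u
      rw [← r1, ← r2]
      push_cast
      ring
    rw [this, Complex.exp_add, Complex.exp_int_mul_two_pi_mul_I, mul_one]
  rw [e2]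
  refine (Real.norm_exp_I_mul_ofReal_sub_one_le).trans ?_
  rw [Real.norm_eq_abs, abs_mul, abs_of_pos (by positivity)]
  refine mul_le_mul_of_nonneg_left ?_ (by positivity)
  rw [le_div_iff₀ h0]
  have f1 := Nat.floor_le (mul_nonneg h0.le (Int.fract_nonneg u))
  have f2 := Nat.lt_floor_add_one ((M γ : ℝ) * Int.fract u)
  have f3 := Nat.floor_le (mul_nonneg h0.le (Int.fract_nonneg v))
  have f4 := Nat.lt_floor_add_one ((M γ : ℝ) * Int.fract v)
  rw [hfl] at f1 f2
  rw [show |Int.fract v - Int.fract u| * (M γ : ℝ) = |(Int.fract v - Int.fract u) * M γ| by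
    rw [abs_mul, abs_of_pos h0], abs_le]
  constructor <;> nlinarith

section
open MeasureTheory

lemma integrableOn_tail {l : ℝ} (hl : 0 < l) (t c : ℝ) :
    IntegrableOn (fun u : ℝ => l * Real.exp (l * (t - u))) (Set.Ioi c) := by
  have := ((integrableOn_exp_mul_Ioi (a := -l) (by linarith) c).const_mul (l * Real.exp (l * t)))
  refine this.congr (Eventually.of_forall (fun u => ?_))
  simp only
  rw [mul_assoc, ← Real.exp_add]; ring_nf

lemma integral_tail {l : ℝ} (hl : 0 < l) (t c : ℝ) :
    ∫ u in Set.Ioi c, l * Real.exp (l * (t - u)) = Real.exp (l * (t - c)) := by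
  have h : ∀ u : ℝ, l * Real.exp (l * (t - u)) = l * Real.exp (l * t) * Real.exp (-l * u) := by
    intro u; rw [mul_assoc, ← Real.exp_add]; ring_nf
  simp only [h]
  rw [integral_const_mul, integral_exp_mul_Ioi (by linarith)]
  have e : Real.exp (l * (t - c)) = Real.exp (l * t) * Real.exp (-l * c) := by
    rw [← Real.exp_add]; ring_nf
  rw [e]; field_simp

lemma smoothWeight_eq_integral {l : ℝ} (hl : 0 < l) {n : ℕ} (hn : 0 < n) (t : ℝ) :
    ∫ u in Set.Ioi t, (if Real.log n ≤ u then l * Real.exp (l * (t - u)) else 0) =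
      smoothWeight l n t := by
  have h1 : (fun u : ℝ => if Real.log n ≤ u then l * Real.exp (l * (t - u)) else 0) =
      (Set.Ici (Real.log n)).indicator (fun u => l * Real.exp (l * (t - u))) := by
    ext u; simp [Set.indicator_apply]
  rw [h1, setIntegral_indicator measurableSet_Ici]
  rcases le_total (Real.log n) t with h | h
  · have : Set.Ioi t ∩ Set.Ici (Real.log n) = Set.Ioi t := by
      ext u; simp only [Set.mem_inter_iff, Set.mem_Ioi, Set.mem_Ici]
      exact ⟨fun a => a.1, fun a => ⟨a, h.trans a.le⟩⟩
    rw [this, integral_tail hl, smoothWeight_of_le hl.le hn h]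
    simp
  · rcases h.eq_or_lt with h' | h'
    · have : Set.Ioi t ∩ Set.Ici (Real.log n) = Set.Ioi t := by
        ext u; simp only [Set.mem_inter_iff, Set.mem_Ioi, Set.mem_Ici]
        exact ⟨fun a => a.1, fun a => ⟨a, by linarith⟩⟩
      rw [this, integral_tail hl, smoothWeight_of_le hl.le hn h'.symm.le]
      simp
    have : Set.Ioi t ∩ Set.Ici (Real.log n) = Set.Ici (Real.log n) := by
      ext u; simp only [Set.mem_inter_iff, Set.mem_Ioi, Set.mem_Ici]
      exact ⟨fun a => a.2, fun a => ⟨h'.trans_le a, a⟩⟩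
    rw [this, integral_Ici_eq_integral_Ioi, integral_tail hl, smoothWeight_of_ge hl.le hn h,
      Real.rpow_def_of_pos (by exact_mod_cast hn), ← Real.exp_add]
    ring_nf

lemma smoothWeight_sum_le_of_partial_ge {a : ℕ → ℝ} {K C B l t : ℝ} (hK : 0 ≤ K) (hB : 0 ≤ B)
    (hC : ∀ x, 0 ≤ x → Chebyshev.psi x ≤ C * x)
    (ha : ∀ n, |a n| ≤ K * ArithmeticFunction.vonMangoldt n) (hl : 3 ≤ l) (ht : 0 ≤ t)
    (h : ∀ u, t ≤ u → u ≤ 2 * t →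
      -(B * Real.exp (u / 2)) ≤ ∑ n ∈ Finset.Ioc 0 ⌊Real.exp u⌋₊, a n) :
    -(B * (l / (l - 1 / 2)) * Real.exp (t / 2)) - 3 * K * C ≤
      ∑' n, a n * smoothWeight l n t := by
  have hl0 : 0 < l := by linarith
  have ha0 : a 0 = 0 := by simpa using ha 0
  have hC0 : 0 ≤ C := by have := hC 1 zero_le_one; rw [Chebyshev.psi_one] at this; linarith
  let F : ℕ → ℝ → ℝ := fun n u =>
    a n * (if Real.log n ≤ u then l * Real.exp (l * (t - u)) else 0)
  have hFint : ∀ n, IntegrableOn (F n) (Set.Ioi t) := by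
    intro n
    refine Integrable.const_mul ?_ _
    have h1 : (fun u : ℝ => if Real.log n ≤ u then l * Real.exp (l * (t - u)) else 0) =
        (Set.Ici (Real.log n)).indicator (fun u => l * Real.exp (l * (t - u))) := by
      ext u; simp [Set.indicator_apply]
    rw [h1]
    exact (integrableOn_tail hl0 t t).indicator measurableSet_Ici
  have hFv : ∀ n, ∫ u in Set.Ioi t, F n u = a n * smoothWeight l n t := by
    intro n
    simp only [F]
    rcases Nat.eq_zero_or_pos n with rfl | hn
    · simp [ha0]
    · rw [integral_const_mul, smoothWeight_eq_integral hl0 hn]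
  have hFn : ∀ n, ∫ u in Set.Ioi t, ‖F n u‖ = |a n| * smoothWeight l n t := by
    intro n
    rcases Nat.eq_zero_or_pos n with rfl | hn
    · simp [F, ha0]
    · rw [← smoothWeight_eq_integral hl0 hn, ← integral_const_mul]
      congr 1; ext u
      simp only [F, norm_mul, Real.norm_eq_abs]
      congr 1
      split_ifs
      · exact abs_of_nonneg (by positivity)
      · simp
  have hsum : Summable (fun n => ∫ u in Set.Ioi t, ‖F n u‖) := by
    simp only [hFn]
    refine Summable.of_nonneg_of_le
      (fun n => mul_nonneg (abs_nonneg _) (smoothWeight_nonneg _ _ _)) (fun n => ?_)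
      (((summable_mangoldtMajorant (σ := 3 / 2) (by norm_num)).mul_left K).mul_right
        (Real.exp (3 / 2 * t)))
    rcases Nat.eq_zero_or_pos n with rfl | hn
    · simp [ha0]
    · calc |a n| * smoothWeight l n t ≤ (K * ArithmeticFunction.vonMangoldt n) *
            ((n : ℝ) ^ (-(3 / 2 : ℝ)) * Real.exp (3 / 2 * t)) :=
          mul_le_mul (ha n) (smoothWeight_le (by linarith) n hn t) (smoothWeight_nonneg _ _ _)
            ((abs_nonneg _).trans (ha n))
        _ = _ := by ring
  have hmain := hasSum_integral_of_summable_integral_norm hFint hsum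
  simp only [hFv] at hmain
  rw [hmain.tsum_eq]
  have hpart : ∀ u, ∑' n, F n u =
      (∑ n ∈ Finset.Ioc 0 ⌊Real.exp u⌋₊, a n) * (l * Real.exp (l * (t - u))) := by
    intro u
    rw [tsum_eq_sum (s := Finset.Ioc 0 ⌊Real.exp u⌋₊), Finset.sum_mul]
    · refine Finset.sum_congr rfl (fun n hn => ?_)
      rw [Finset.mem_Ioc] at hn
      have hn0 : (0 : ℝ) < n := by exact_mod_cast hn.1
      have h2 : (n : ℝ) ≤ Real.exp u := (Nat.le_floor_iff (Real.exp_pos u).le).1 hn.2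
      have h3 : Real.log n ≤ u := by rwa [Real.log_le_iff_le_exp hn0]
      simp [F, h3]
    · intro n hn
      rcases Nat.eq_zero_or_pos n with rfl | hn0
      · simp [F, ha0]
      · have h2 : ¬ n ≤ ⌊Real.exp u⌋₊ := fun hc => hn (Finset.mem_Ioc.2 ⟨hn0, hc⟩)
        have h3 : ¬ Real.log n ≤ u := by
          rw [Real.log_le_iff_le_exp (by exact_mod_cast hn0),
            ← Nat.le_floor_iff (Real.exp_pos u).le]
          exact h2
        simp [F, h3]
  have habs : ∀ u, |∑ n ∈ Finset.Ioc 0 ⌊Real.exp u⌋₊, a n| ≤ K * (C * Real.exp u) := by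
    intro u
    calc _ ≤ ∑ n ∈ Finset.Ioc 0 ⌊Real.exp u⌋₊, K * ArithmeticFunction.vonMangoldt n :=
          (Finset.abs_sum_le_sum_abs _ _).trans (Finset.sum_le_sum (fun n _ => ha n))
      _ = K * Chebyshev.psi (Real.exp u) := by rw [← Finset.mul_sum]; rfl
      _ ≤ _ := by gcongr; exact hC _ (Real.exp_pos u).le
  have hb : ∀ u ∈ Set.Ioi t, -(B * Real.exp (t / 2) * l / (l - 1 / 2)) *
      ((l - 1 / 2) * Real.exp ((l - 1 / 2) * (t - u))) -
      2 * K * C * l / (l - 1) * ((l - 1) / 2 * Real.exp ((l - 1) / 2 * (t - u))) ≤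
      ∑' n, F n u := by
    intro u hu
    rw [hpart]
    have g1 : (l - 1 / 2) ≠ 0 := by linarith
    have g2 : (l - 1) ≠ 0 := by linarith
    have r1 : -(B * Real.exp (t / 2) * l / (l - 1 / 2)) *
        ((l - 1 / 2) * Real.exp ((l - 1 / 2) * (t - u))) =
        -(B * Real.exp (u / 2)) * (l * Real.exp (l * (t - u))) := by
      have : Real.exp (t / 2) * Real.exp ((l - 1 / 2) * (t - u)) =
          Real.exp (u / 2) * Real.exp (l * (t - u)) := by
        rw [← Real.exp_add, ← Real.exp_add]; congr 1; ring
      have g3 : B * Real.exp (t / 2) * l / (l - 1 / 2) * (l - 1 / 2) = B * Real.exp (t / 2) * l :=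
        div_mul_cancel₀ _ g1
      linear_combination (-l) * B * this - Real.exp ((l - 1 / 2) * (t - u)) * g3
    have r2 : 2 * K * C * l / (l - 1) * ((l - 1) / 2 * Real.exp ((l - 1) / 2 * (t - u))) =
        K * C * l * Real.exp ((l - 1) / 2 * (t - u)) := by
      field_simp
    rw [r1, r2]
    have p1 : 0 ≤ K * C * l * Real.exp ((l - 1) / 2 * (t - u)) := by positivity
    have p2 : 0 < l * Real.exp (l * (t - u)) := by positivity
    by_cases hu2 : u ≤ 2 * t
    · have := mul_le_mul_of_nonneg_right (h u (le_of_lt hu) hu2) p2.le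
      linarith
    · push Not at hu2
      have q1 := mul_le_mul_of_nonneg_right (abs_le.1 (habs u)).1 p2.le
      have q2 : Real.exp u * Real.exp (l * (t - u)) ≤ Real.exp ((l - 1) / 2 * (t - u)) := by
        rw [← Real.exp_add]
        refine Real.exp_le_exp.2 ?_
        nlinarith
      have q3 : K * C * l * (Real.exp u * Real.exp (l * (t - u))) ≤
          K * C * l * Real.exp ((l - 1) / 2 * (t - u)) := by gcongr
      have q4 : 0 ≤ B * Real.exp (u / 2) * (l * Real.exp (l * (t - u))) := by positivity
      nlinarith
  have hint1 := (integrableOn_tail (l := l - 1 / 2) (by linarith) t t).const_mul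
    (-(B * Real.exp (t / 2) * l / (l - 1 / 2)))
  have hint2 := (integrableOn_tail (l := (l - 1) / 2) (by linarith) t t).const_mul
    (2 * K * C * l / (l - 1))
  have hint3 : IntegrableOn (fun u => ∑' n, F n u) (Set.Ioi t) := by
    have hm : Measurable (fun u => ∑' n, F n u) := by
      simp only [hpart]
      refine Measurable.mul ?_ (by fun_prop)
      have : Measurable (fun k : ℕ => ∑ n ∈ Finset.Ioc 0 k, a n) := measurable_of_countable _
      exact this.comp (Nat.measurable_floor.comp Real.measurable_exp)
    refine Integrable.mono' (((integrableOn_tail (l := l - 1) (by linarith) t t).const_mul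
      (K * C * l / (l - 1) * Real.exp t))) hm.aestronglyMeasurable
      (Eventually.of_forall (fun u => ?_))
    rw [hpart, norm_mul, Real.norm_eq_abs, Real.norm_of_nonneg (by positivity)]
    have g2 : (l - 1) ≠ 0 := by linarith
    calc _ ≤ K * (C * Real.exp u) * (l * Real.exp (l * (t - u))) := by gcongr; exact habs u
      _ = _ := by
        have : Real.exp t * Real.exp ((l - 1) * (t - u)) =
            Real.exp u * Real.exp (l * (t - u)) := by
          rw [← Real.exp_add, ← Real.exp_add]; congr 1; ring
        have g3 : K * C * l / (l - 1) * (l - 1) = K * C * l := div_mul_cancel₀ _ g2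
        linear_combination (-l) * K * C * this -
          Real.exp t * Real.exp ((l - 1) * (t - u)) * g3
  have hfin := setIntegral_mono_on (hint1.sub hint2) hint3 measurableSet_Ioi hb
  have hlhs : ∫ u in Set.Ioi t, (-(B * Real.exp (t / 2) * l / (l - 1 / 2)) *
      ((l - 1 / 2) * Real.exp ((l - 1 / 2) * (t - u))) -
      2 * K * C * l / (l - 1) * ((l - 1) / 2 * Real.exp ((l - 1) / 2 * (t - u)))) =
      -(B * Real.exp (t / 2) * l / (l - 1 / 2)) - 2 * K * C * l / (l - 1) := by
    have k1 := integral_tail (l := l - 1 / 2) (by linarith) t t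
    have k2 := integral_tail (l := (l - 1) / 2) (by linarith) t t
    rw [integral_sub hint1 hint2, integral_const_mul _ (fun u => (l - 1 / 2) * _),
      integral_const_mul _ (fun u => (l - 1) / 2 * _), k1, k2]
    simp
  have hfin2 : -(B * Real.exp (t / 2) * l / (l - 1 / 2)) - 2 * K * C * l / (l - 1) ≤
      ∫ u in Set.Ioi t, ∑' n, F n u := by rw [← hlhs]; exact hfin
  refine le_trans ?_ hfin2
  have z1 : B * (l / (l - 1 / 2)) * Real.exp (t / 2) = B * Real.exp (t / 2) * l / (l - 1 / 2) := by
    ring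
  have z2 : 2 * K * C * l / (l - 1) ≤ 3 * K * C := by
    rw [div_le_iff₀ (by linarith)]
    nlinarith [mul_nonneg hK hC0]
  rw [z1]; linarith

end

lemma sum_biUnion_le_sum {α β : Type*} (s : Finset α) (F : α → Finset β) {y : β → ℝ}
    (hy : ∀ b, 0 ≤ y b) : ∑ b ∈ s.biUnion F, y b ≤ ∑ a ∈ s, ∑ b ∈ F a, y b := by
  induction s using Finset.induction_on with
  | empty => simp
  | insert a s ha ih =>
    rw [Finset.biUnion_insert, Finset.sum_insert ha]
    have := Finset.sum_union_inter (s₁ := F a) (s₂ := s.biUnion F) (f := y)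
    have h0 : 0 ≤ ∑ b ∈ F a ∩ s.biUnion F, y b := Finset.sum_nonneg (fun b _ => hy b)
    linarith

section
variable {ι : Type*} {d : ι → ℕ} (χ : ∀ i, DirichletCharacter ℂ (d i))

/-- The coefficients of the real part of a sum of twisted prime-counting functions. -/
noncomputable def twistCoeff (S : Finset ι) (n : ℕ) : ℝ :=
  ∑ i ∈ S, (χ i (n : ZMod (d i))).re * ArithmeticFunction.vonMangoldt n

lemma abs_twistCoeff_le (S : Finset ι) (n : ℕ) :
    |twistCoeff χ S n| ≤ S.card * ArithmeticFunction.vonMangoldt n := by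
  refine (Finset.abs_sum_le_sum_abs _ _).trans ?_
  rw [← nsmul_eq_mul]
  refine Finset.sum_le_card_nsmul _ _ _ (fun i _ => ?_)
  rw [abs_mul, abs_of_nonneg ArithmeticFunction.vonMangoldt_nonneg]
  have := (Complex.abs_re_le_norm _).trans (DirichletCharacter.norm_le_one (χ i) (n : ZMod (d i)))
  nlinarith [ArithmeticFunction.vonMangoldt_nonneg (n := n)]

lemma tsum_twistCoeff {l : ℝ} (hl : 3 ≤ l) (S : Finset ι) (t : ℝ) :
    ∑' n, twistCoeff χ S n * smoothWeight l n t = ∑ i ∈ S, (smoothSum (χ i) l t).re := by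
  have hs : ∀ i, Summable (fun n : ℕ => χ i (n : ZMod (d i)) *
      (ArithmeticFunction.vonMangoldt n : ℂ) * (smoothWeight l n t : ℂ)) := fun i =>
    Summable.of_norm_bounded ((summable_mangoldtMajorant (by norm_num)).mul_right _)
      (fun n => norm_smoothTerm_le (χ i) hl n t)
  have h1 : ∀ i ∈ S, HasSum (fun n : ℕ => (χ i (n : ZMod (d i))).re *
      ArithmeticFunction.vonMangoldt n * smoothWeight l n t) (smoothSum (χ i) l t).re := by
    intro i _
    refine (Complex.hasSum_re (hs i).hasSum).congr_fun (fun n => ?_)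
    simp only [Complex.mul_re, Complex.mul_im, Complex.ofReal_re, Complex.ofReal_im]
    ring
  have h2 := hasSum_sum h1
  rw [← h2.tsum_eq]
  congr 1; ext n
  rw [twistCoeff, Finset.sum_mul]

variable [∀ i, NeZero (d i)]

lemma exists_return_time {S : Finset ι} (h1 : ∀ i ∈ S, χ i ≠ 1) (h2 : ∀ i ∈ S, (χ i).IsPrimitive)
    (h3 : ∀ i ∈ S, GRHchi (χ i)) {δ T D A : ℝ} (hδ : 0 < δ) (hT : 1 ≤ T) (hA : 0 ≤ A)
    (hD : ∀ i ∈ S, zeroDensity (d i) T ≤ D) :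
    ∃ t, A ≤ t ∧ t ≤ A * Real.exp (6 / δ * T * S.card * D) ∧ ∀ i ∈ S, ∀ γ ∈ lowZeros (χ i) T,
      ‖Complex.exp ((γ * t : ℝ) * Complex.I) - 1‖ ≤
        2 * Real.pi * (δ * (√(1 + |γ|) / √T)) := by
  have hTp : 0 < √T := Real.sqrt_pos.2 (by linarith)
  have hsq : √T ^ 2 = T := Real.sq_sqrt (by linarith)
  set Γ : Finset ℝ := S.biUnion (fun i => lowZeros (χ i) T) with hΓ
  let y : ℝ → ℝ := fun γ => √T / (δ * √(1 + |γ|))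
  have hs : ∀ γ : ℝ, 0 < √(1 + |γ|) := fun γ => Real.sqrt_pos.2 (by positivity)
  have hy : ∀ γ, 0 < y γ := fun γ => by have := hs γ; positivity
  have hM : ∀ γ, 0 < ⌈y γ⌉₊ := fun γ => Nat.ceil_pos.2 (hy γ)
  obtain ⟨k, hk1, hk2, hk3⟩ := exists_simultaneous_return Γ (fun γ => ⌈y γ⌉₊) (fun γ _ => hM γ) A
  have hk1' : (1 : ℝ) ≤ k := by exact_mod_cast hk1
  refine ⟨k * A, by nlinarith, ?_, fun i hi γ hγ => ?_⟩
  · have hprod : (k : ℝ) ≤ ∏ γ ∈ Γ, (⌈y γ⌉₊ : ℝ) := by exact_mod_cast hk2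
    have hprod2 : ∏ γ ∈ Γ, (⌈y γ⌉₊ : ℝ) ≤ ∏ γ ∈ Γ, Real.exp (y γ) := by
      refine Finset.prod_le_prod (fun γ _ => Nat.cast_nonneg _) (fun γ _ => ?_)
      have := Nat.ceil_lt_add_one (hy γ).le
      linarith [Real.add_one_le_exp (y γ)]
    rw [← Real.exp_sum] at hprod2
    have hsum : ∑ γ ∈ Γ, y γ ≤ 6 / δ * T * S.card * D := by
      calc ∑ γ ∈ Γ, y γ ≤ ∑ i ∈ S, ∑ γ ∈ lowZeros (χ i) T, y γ :=
            sum_biUnion_le_sum S _ (fun γ => (hy γ).le)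
        _ ≤ ∑ i ∈ S, √T / δ * (6 * D * √T) := by
            refine Finset.sum_le_sum (fun i hi => ?_)
            have e1 : ∑ γ ∈ lowZeros (χ i) T, y γ ≤
                √T / δ * ∑ γ ∈ lowZeros (χ i) T, (zmult (χ i) γ : ℝ) / √(1 + |γ|) := by
              rw [Finset.mul_sum]
              refine Finset.sum_le_sum (fun γ hγ => ?_)
              have hz := ((mem_lowZeros (h1 i hi) (h2 i hi) (h3 i hi)).1 hγ).1
              have hz' : (1 : ℝ) ≤ zmult (χ i) γ := by
                exact_mod_cast Nat.one_le_iff_ne_zero.2 hz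
              calc y γ = √T / δ * (1 / √(1 + |γ|)) := by simp only [y]; field_simp
                _ ≤ _ := by have := hs γ; gcongr
            refine e1.trans (mul_le_mul_of_nonneg_left ?_ (by positivity))
            refine (sum_lowZeros_le (h1 i hi) (h2 i hi) (h3 i hi) hT).trans ?_
            have := hD i hi
            gcongr
        _ = _ := by
            rw [Finset.sum_const, nsmul_eq_mul]
            rw [show 6 / δ * T = 6 / δ * √T ^ 2 by rw [hsq]]; ring
    have := hprod.trans (hprod2.trans (Real.exp_le_exp.2 hsum))
    rw [mul_comm]
    exact mul_le_mul_of_nonneg_left this hA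
  · have hγΓ : γ ∈ Γ := Finset.mem_biUnion.2 ⟨i, hi, hγ⟩
    refine (hk3 γ hγΓ).trans (mul_le_mul_of_nonneg_left ?_ (by positivity))
    have h0 : (0 : ℝ) < ⌈y γ⌉₊ := by exact_mod_cast hM γ
    calc (1 : ℝ) / ⌈y γ⌉₊ ≤ 1 / y γ := one_div_le_one_div_of_le (hy γ) (Nat.le_ceil _)
      _ = _ := by have := hs γ; simp only [y]; field_simp

end

lemma two_mul_return_time_le {δ f Q F A t K C₂ : ℝ} (hδ : 0 < δ) (hδ2 : δ ≤ 1 / 484) (hQ : 1 ≤ Q)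
    (hf : 1 ≤ f) (hF : 0 ≤ F) (hA : 0 ≤ A) (hK : 1 ≤ K) (hC : C₂ ≤ Q)
    (ht : t ≤ A * Real.exp (6 / δ * (f / δ ^ 2) * K * (Q + F + C₂))) :
    2 * t ≤ A * Real.exp (13 / δ ^ 3 * (K * f * (Q + F))) := by
  have hKf : 1 ≤ K * f := one_le_mul_of_one_le_of_one_le hK hf
  have hW1 : 1 ≤ K * f * (Q + F) := one_le_mul_of_one_le_of_one_le hKf (by linarith)
  generalize hW : K * f * (Q + F) = W at *
  have e1 : 6 / δ * (f / δ ^ 2) * K * (Q + F + C₂) ≤ 12 / δ ^ 3 * W := by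
    have h1 : 6 / δ * (f / δ ^ 2) * K * (Q + F + C₂) = 6 / δ ^ 3 * (K * f * (Q + F + C₂)) := by
      field_simp
    have h2 : K * f * (Q + F + C₂) ≤ K * f * (2 * (Q + F)) :=
      mul_le_mul_of_nonneg_left (by linarith) (by linarith)
    rw [h1]
    calc _ ≤ 6 / δ ^ 3 * (K * f * (2 * (Q + F))) :=
          mul_le_mul_of_nonneg_left h2 (by positivity)
      _ = _ := by rw [← hW]; ring
  have e2 : 1 ≤ 1 / δ ^ 3 * W := by
    have : 1 ≤ 1 / δ ^ 3 := by
      rw [le_div_iff₀ (by positivity), one_mul]; exact pow_le_one₀ hδ.le (by linarith)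
    exact one_le_mul_of_one_le_of_one_le this hW1
  have e3 : 2 * Real.exp (12 / δ ^ 3 * W) ≤ Real.exp (13 / δ ^ 3 * W) := by
    have : (13 : ℝ) / δ ^ 3 * W = 1 / δ ^ 3 * W + 12 / δ ^ 3 * W := by ring
    rw [this, Real.exp_add]
    refine mul_le_mul_of_nonneg_right ?_ (Real.exp_pos _).le
    linarith [Real.add_one_le_exp (1 / δ ^ 3 * W)]
  have e4 := mul_le_mul_of_nonneg_left (Real.exp_le_exp.2 e1) hA
  have e5 := mul_le_mul_of_nonneg_left e3 hA
  linarith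

lemma le_sq_mul_sq_of_large {δ f Q L : ℝ} (hδ : 0 < δ) (hQ : 1 ≤ Q) (hf : 1 ≤ f) (hL : 0 ≤ L)
    (hD : 3 / δ * (3 + L) ≤ Q) :
    f / δ + 3 * (f / δ) * (Q + L) ≤ f ^ 2 * Q ^ 2 := by
  have hl : 0 < f / δ := by positivity
  have g1 : 3 / δ * (3 + L) * Q ≤ Q ^ 2 := by
    rw [sq]; exact mul_le_mul_of_nonneg_right hD (by linarith)
  have g2 : 1 + 3 * (Q + L) ≤ 3 * ((3 + L) * Q) := by
    linarith [mul_nonneg hL (sub_nonneg.2 hQ)]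
  have g3 := mul_le_mul_of_nonneg_left g2 hl.le
  have g4 : f * (3 / δ * (3 + L) * Q) ≤ f * Q ^ 2 := mul_le_mul_of_nonneg_left g1 (by linarith)
  have g5 : f * Q ^ 2 ≤ f ^ 2 * Q ^ 2 :=
    mul_le_mul_of_nonneg_right (by rw [sq]; exact le_mul_of_one_le_left (by linarith) hf)
      (sq_nonneg Q)
  have g6 : f / δ * (3 * ((3 + L) * Q)) = f * (3 / δ * (3 + L) * Q) := by field_simp
  linarith

lemma density_loss_le {δ Q F L l Z₀ Z R C₁ C₂ D : ℝ} (hδ : 0 < δ) (hδ2 : δ ≤ 1 / 484)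
    (hQ : 0 ≤ Q) (hF : 0 ≤ F) (hL : (1 - δ) * Q ≤ L) (hl : F ≤ l)
    (h0 : (1 / 2 - δ) * L + 1 / 2 * (L + l) - C₁ ≤ Z₀)
    (h1 : Z₀ - R ≤ Z) (h2 : R ≤ 229 * δ * D) (hD : D ≤ Q + F + C₂)
    (hC : C₁ + 229 * δ * C₂ ≤ δ * Q) :
    (1 / 2 - 240 * δ) * (2 * Q + F) ≤ Z := by
  have m1 := mul_le_mul_of_nonneg_left hL (show 0 ≤ 1 - δ by linarith)
  have m2 := mul_le_mul_of_nonneg_left hD (show 0 ≤ 229 * δ by linarith)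
  have m4 : 0 ≤ δ * Q := by positivity
  have m5 : 0 ≤ δ * F := by positivity
  have m6 : 0 ≤ δ ^ 2 * Q := by positivity
  linarith

lemma partial_weight_loss_le {δ l H : ℝ} (hδ : 0 < δ) (hδ2 : δ ≤ 1 / 484) (hH : 1 ≤ H)
    (hl : 1 / δ ≤ l) :
    (1 / 2 - 242 * δ) * H * (l / (l - 1 / 2)) + δ ≤ (1 / 2 - 240 * δ) * H := by
  have h484 : 484 ≤ 1 / δ := by rw [le_div_iff₀ hδ]; linarith
  have hratio : l / (l - 1 / 2) ≤ 1 + δ := by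
    rw [div_le_iff₀ (by linarith)]
    have := mul_le_mul_of_nonneg_left hl hδ.le
    rw [mul_one_div_cancel hδ.ne'] at this
    linarith
  have n1 := mul_le_mul_of_nonneg_left hratio
    (show 0 ≤ (1 / 2 - 242 * δ) * H from mul_nonneg (by linarith) (by linarith))
  have n2 : 0 ≤ δ * (H - 1) := mul_nonneg hδ.le (by linarith)
  have n3 : 0 ≤ δ ^ 2 * H := by positivity
  linarith

lemma eventually_error_lt {δ a : ℝ} (hδ : 0 < δ) :
    ∃ t₀ : ℝ, ∀ t, t₀ ≤ t → a + 2 * t < δ * Real.exp (t / 2) := by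
  have htend : Tendsto (fun t : ℝ => (a + 2 * t) * Real.exp (-(t / 2))) atTop (nhds 0) := by
    have t1 := (Real.tendsto_pow_mul_exp_neg_atTop_nhds_zero 1).comp
      (tendsto_id.atTop_div_const (show (0 : ℝ) < 2 by norm_num))
    have t0 := (Real.tendsto_pow_mul_exp_neg_atTop_nhds_zero 0).comp
      (tendsto_id.atTop_div_const (show (0 : ℝ) < 2 by norm_num))
    have := (t0.const_mul a).add (t1.const_mul 4)
    simp only [mul_zero, add_zero] at this
    refine this.congr (fun t => ?_)
    simp only [Function.comp_apply, id]
    ring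
  obtain ⟨t₀, ht₀⟩ := eventually_atTop.1 (htend.eventually (gt_mem_nhds hδ))
  refine ⟨t₀, fun t ht => ?_⟩
  have := ht₀ t ht
  rwa [Real.exp_neg, ← div_eq_mul_inv, div_lt_iff₀ (Real.exp_pos _)] at this

lemma re_smoothSum_le {N : ℕ} [NeZero N] {χ : DirichletCharacter ℂ N} (hχ : χ ≠ 1)
    (hp : χ.IsPrimitive) (hG : GRHchi χ) {δ Q f t C₂ : ℝ} (hδ : 0 < δ) (hδ2 : δ ≤ 1 / 484)
    (hQ : 1 ≤ Q) (hf : 1 ≤ f) (hN : (1 - δ) * Q ≤ Real.log N) (hN2 : Real.log N ≤ Q)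
    (ht : f ^ 2 * Q ^ 2 ≤ t) (hD : zeroDensity N (f / δ ^ 2) ≤ Q + Real.log f + C₂)
    (hC : 5 + mangoldtMajorant (1 + δ) + mangoldtMajorant 3 + 229 * δ * C₂ ≤ δ * Q)
    (hP : 3 / δ * (3 + (Real.log 3 + (5 + 2 * mangoldtMajorant (3 / 2)))) ≤ Q)
    (hnear : ∀ γ ∈ lowZeros χ (f / δ ^ 2), ‖Complex.exp ((γ * t : ℝ) * Complex.I) - 1‖ ≤
      2 * Real.pi * (δ * (√(1 + |γ|) / √(f / δ ^ 2)))) :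
    (smoothSum χ (f / δ) t).re ≤
      -(Real.exp (t / 2) * ((1 / 2 - 240 * δ) * (2 * Q + Real.log f))) +
        (mangoldtMajorant 3 + 2 * t) := by
  have hlf : 0 ≤ Real.log f := Real.log_nonneg hf
  have hlog3 : 0 ≤ Real.log 3 := Real.log_nonneg (by norm_num)
  have hmaj := mangoldtMajorant_nonneg (3 / 2)
  have ht0 : 0 ≤ t := le_trans (by positivity) ht
  have h484 : 484 ≤ 1 / δ := by rw [le_div_iff₀ hδ]; linarith
  have hl : 1 / δ ≤ f / δ := by gcongr
  have hl3 : 3 ≤ f / δ := by linarith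
  have hT1 : 1 ≤ f / δ ^ 2 := by
    rw [le_div_iff₀ (by positivity), one_mul]
    exact (pow_le_one₀ hδ.le (by linarith)).trans hf
  have hlT : f / δ = δ * (f / δ ^ 2) := by field_simp
  have k1 := norm_smoothSum_add_zeroSum_le hχ hp hG hl3 ht0
  have k2 := (Complex.re_le_norm _).trans k1
  rw [Complex.add_re] at k2
  have k3 := re_zeroSum_ge_of_near hχ hp hG (by linarith) hδ hT1 hlT hnear
  have k4 := re_zeroSum_zero_ge hχ hp hG hl3 hδ (by linarith)
  have k5 := norm_zeroSum_zero_le hχ hp hG (show 1 ≤ f / δ by linarith)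
  have k6 : zeroDensity N 2 ≤ Q + (Real.log 3 + (5 + 2 * mangoldtMajorant (3 / 2))) := by
    rw [zeroDensity, show (2 : ℝ) + 1 = 3 by norm_num]; linarith
  have k7 : f / δ + ‖zeroSum χ (f / δ) 0‖ ≤ t := by
    have e1 := mul_le_mul_of_nonneg_left k6 (show 0 ≤ 3 * (f / δ) by linarith)
    have e2 := le_sq_mul_sq_of_large hδ hQ hf
      (show 0 ≤ Real.log 3 + (5 + 2 * mangoldtMajorant (3 / 2)) by linarith) hP
    linarith
  have hlogl : Real.log f ≤ Real.log (f / δ) := by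
    refine Real.log_le_log (by linarith) ?_
    rw [le_div_iff₀ hδ]
    exact mul_le_of_le_one_right (by linarith) (by linarith)
  have hz0 := zeroDensity_nonneg hχ hp hG hT1
  have k8 : (72 * Real.pi + 2) * δ * zeroDensity N (f / δ ^ 2) ≤
      229 * δ * zeroDensity N (f / δ ^ 2) := by
    have hpi : 72 * Real.pi + 2 ≤ 229 := by have := Real.pi_lt_d2; linarith
    gcongr
  have k9 := density_loss_le hδ hδ2 (by linarith) hlf hN hlogl k4 k3 k8 hD hC
  have k10 : Real.exp (t / 2) * ((1 / 2 - 240 * δ) * (2 * Q + Real.log f)) ≤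
      (zeroSum χ (f / δ) t).re := by
    have := mul_le_mul_of_nonneg_left k9 (Real.exp_pos (t / 2)).le
    rwa [← mul_assoc (Real.exp (t / 2)) (Real.exp (-t / 2)), ← Real.exp_add, neg_div,
      add_neg_cancel, Real.exp_zero, one_mul] at this
  linarith

theorem exists_twistCoeff_sum_le {δ : ℝ} (hδ : 0 < δ) (hδ2 : δ ≤ 1 / 484) :
    ∃ Q₀ : ℝ, 1 ≤ Q₀ ∧ ∀ {ι : Type} {d : ι → ℕ} [∀ i, NeZero (d i)]
    (χ : ∀ i, DirichletCharacter ℂ (d i)) (Q f A : ℝ), Q₀ ≤ Q → 1 ≤ f → f ^ 2 * Q ^ 2 ≤ A →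
    ∀ S : Finset ι, S.Nonempty → (∀ i ∈ S, χ i ≠ 1) → (∀ i ∈ S, (χ i).IsPrimitive) →
    (∀ i ∈ S, GRHchi (χ i)) →
    (∀ i ∈ S, (1 - δ) * Q ≤ Real.log (d i)) → (∀ i ∈ S, Real.log (d i) ≤ Q) →
    ∃ u, A ≤ u ∧ u ≤ A * Real.exp (13 / δ ^ 3 * (S.card * f * (Q + Real.log f))) ∧
      ∑ n ∈ Finset.Ioc 0 ⌊Real.exp u⌋₊, twistCoeff χ S n ≤
        -(S.card * ((1 / 2 - 242 * δ) * (2 * Q + Real.log f)) * Real.exp (u / 2)) := by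
  have hm := mangoldtMajorant_nonneg (3 / 2)
  have hm1 := mangoldtMajorant_nonneg (1 + δ)
  have hm3 := mangoldtMajorant_nonneg 3
  obtain ⟨C₂, hC₂⟩ : ∃ C₂, C₂ = Real.log (2 / δ ^ 2) + (5 + 2 * mangoldtMajorant (3 / 2)) :=
    ⟨_, rfl⟩
  have hC20 : 0 ≤ C₂ := by
    have : 0 ≤ Real.log (2 / δ ^ 2) := by
      refine Real.log_nonneg ?_
      rw [le_div_iff₀ (by positivity)]
      linarith [pow_le_one₀ hδ.le (show δ ≤ 1 by linarith) (n := 2)]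
    linarith
  obtain ⟨t₀, ht₀⟩ := eventually_error_lt (a := mangoldtMajorant 3 + 3 * (Real.log 4 + 4)) hδ
  refine ⟨max (max 1 t₀) (max
    (C₂ + 1 + (5 + mangoldtMajorant (1 + δ) + mangoldtMajorant 3 + 229 * δ * C₂) / δ)
    (3 / δ * (3 + (Real.log 3 + (5 + 2 * mangoldtMajorant (3 / 2)))))),
    le_trans (le_max_left _ _) (le_max_left _ _), ?_⟩
  intro ι d _ χ Q f A hQ hf hA S hS h1 h2 h3 h4 h5
  have hQ1 : 1 ≤ Q := le_trans (le_trans (le_max_left _ _) (le_max_left _ _)) hQ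
  have hQt : t₀ ≤ Q := le_trans (le_trans (le_max_right _ _) (le_max_left _ _)) hQ
  have hQC := le_trans (le_trans (le_max_left _ _) (le_max_right _ _)) hQ
  have hQD := le_trans (le_trans (le_max_right _ _) (le_max_right _ _)) hQ
  clear hQ
  have hQC2 : C₂ ≤ Q := by
    have e : 0 ≤ (5 + mangoldtMajorant (1 + δ) + mangoldtMajorant 3 + 229 * δ * C₂) / δ := by
      positivity
    linarith
  have hQC1 : 5 + mangoldtMajorant (1 + δ) + mangoldtMajorant 3 + 229 * δ * C₂ ≤ δ * Q := by
    rw [mul_comm δ Q, ← div_le_iff₀ hδ]; linarith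
  have hlf : 0 ≤ Real.log f := Real.log_nonneg hf
  have hQA : Q ≤ A := by
    have e1 : Q ≤ Q ^ 2 := by rw [sq]; exact le_mul_of_one_le_left (by linarith) hQ1
    have e2 := mul_le_mul_of_nonneg_right (one_le_pow₀ hf (n := 2)) (sq_nonneg Q)
    linarith
  have hT1 : 1 ≤ f / δ ^ 2 := by
    rw [le_div_iff₀ (by positivity), one_mul]
    exact (pow_le_one₀ hδ.le (by linarith)).trans hf
  have h484 : 484 ≤ 1 / δ := by rw [le_div_iff₀ hδ]; linarith
  have hl : 1 / δ ≤ f / δ := by gcongr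
  have hden : ∀ i ∈ S, zeroDensity (d i) (f / δ ^ 2) ≤ Q + Real.log f + C₂ := by
    intro i hi
    have : Real.log (f / δ ^ 2 + 1) ≤ Real.log f + Real.log (2 / δ ^ 2) := by
      rw [← Real.log_mul (by positivity) (by positivity)]
      refine Real.log_le_log (by positivity) ?_
      have : f * (2 / δ ^ 2) = f / δ ^ 2 + f / δ ^ 2 := by ring
      linarith
    have := h5 i hi
    rw [zeroDensity]; linarith
  obtain ⟨t, ht1, ht2, ht3⟩ := exists_return_time χ h1 h2 h3 hδ hT1 (show 0 ≤ A by linarith) hden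
  have hcard : (1 : ℝ) ≤ S.card := by exact_mod_cast Finset.card_pos.2 hS
  have ht0 : 0 ≤ t := by linarith
  have hub := two_mul_return_time_le hδ hδ2 hQ1 hf hlf (show 0 ≤ A by linarith) hcard hQC2 ht2
  obtain ⟨H, hH⟩ : ∃ H, H = 2 * Q + Real.log f := ⟨_, rfl⟩
  have hHpos : 1 ≤ H := by linarith
  rw [← hH]
  by_contra hcon
  push Not at hcon
  have hb0 : 0 ≤ S.card * ((1 / 2 - 242 * δ) * H) :=
    mul_nonneg (by linarith) (mul_nonneg (by linarith) (by linarith))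
  have hE := smoothWeight_sum_le_of_partial_ge (a := twistCoeff χ S) (Nat.cast_nonneg _) hb0
    (fun x hx => Chebyshev.psi_le_const_mul_self hx) (abs_twistCoeff_le χ S)
    (show 3 ≤ f / δ by linarith) ht0
    (fun u hu1 hu2 => (hcon u (by linarith) (by linarith)).le)
  rw [tsum_twistCoeff χ (show 3 ≤ f / δ by linarith)] at hE
  have hsumle := Finset.sum_le_card_nsmul S _ _ (fun i hi =>
    re_smoothSum_le (h1 i hi) (h2 i hi) (h3 i hi) hδ hδ2 hQ1 hf (h4 i hi) (h5 i hi)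
      (hA.trans ht1) (hden i hi) hQC1 hQD (ht3 i hi))
  rw [nsmul_eq_mul, ← hH] at hsumle
  have hfin := hE.trans hsumle
  have herr := ht₀ t (by linarith)
  have hX : 0 < Real.exp (t / 2) := Real.exp_pos _
  have h6 := mul_le_mul_of_nonneg_left (partial_weight_loss_le hδ hδ2 hHpos hl) hX.le
  have h7 : (S.card : ℝ) * (Real.exp (t / 2) * ((1 / 2 - 240 * δ) * H)) ≤
      S.card * (Real.exp (t / 2) * ((1 / 2 - 242 * δ) * H * (f / δ / (f / δ - 1 / 2))) +
        (mangoldtMajorant 3 + 3 * (Real.log 4 + 4) + 2 * t)) := by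
    linarith
  have h8 := le_of_mul_le_mul_left h7 (by linarith)
  linarith

lemma natCast_add_one_le_rpow {η : ℝ} (hη : 0 < η) (hη1 : η ≤ 1) {p : ℕ} (hp : 2 ≤ p) (a : ℕ) :
    ((a : ℝ) + 1) ≤ 1 / (η * Real.log 2) * ((p : ℝ) ^ a) ^ η := by
  have hl2 : 0 < Real.log 2 := Real.log_pos (by norm_num)
  have hl21 : Real.log 2 < 1 := by have := Real.log_two_lt_d9; linarith
  have hp' : (2 : ℝ) ≤ p := by exact_mod_cast hp
  have h1 : ((p : ℝ) ^ a) ^ η = Real.exp (a * η * Real.log p) := by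
    rw [← Real.rpow_natCast, ← Real.rpow_mul (by positivity), Real.rpow_def_of_pos (by linarith)]
    congr 1; ring
  have h2 : Real.exp (a * (η * Real.log 2)) ≤ Real.exp (a * η * Real.log p) := by
    refine Real.exp_le_exp.2 ?_
    rw [mul_assoc]
    have := Real.log_le_log (by norm_num) hp'
    gcongr
  have h3 := Real.add_one_le_exp (a * (η * Real.log 2))
  rw [h1, one_div, ← div_eq_inv_mul, le_div_iff₀ (by positivity)]
  have : η * Real.log 2 ≤ 1 := mul_le_one₀ hη1 hl2.le hl21.le
  linarith

lemma natCast_add_one_le_rpow_of_large {η : ℝ} {p : ℕ} (hp : (2 : ℝ) ≤ (p : ℝ) ^ η) (a : ℕ) :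
    ((a : ℝ) + 1) ≤ ((p : ℝ) ^ a) ^ η := by
  have h1 : ((p : ℝ) ^ a) ^ η = ((p : ℝ) ^ η) ^ a := by
    rw [← Real.rpow_natCast, ← Real.rpow_mul (by positivity), mul_comm,
      Real.rpow_mul (by positivity), Real.rpow_natCast]
  rw [h1]
  refine le_trans ?_ (pow_le_pow_left₀ (by norm_num) hp a)
  exact_mod_cast Nat.lt_two_pow_self

theorem exists_card_divisors_le_mul_rpow {η : ℝ} (hη : 0 < η) (hη1 : η ≤ 1) :
    ∃ C : ℝ, 0 < C ∧ ∀ n : ℕ, n ≠ 0 → (n.divisors.card : ℝ) ≤ C * (n : ℝ) ^ η := by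
  obtain ⟨P, hP⟩ := exists_nat_ge ((2 : ℝ) ^ (1 / η))
  have hl2 : 0 < Real.log 2 := Real.log_pos (by norm_num)
  obtain ⟨B, hB⟩ : ∃ B, B = 1 / (η * Real.log 2) := ⟨_, rfl⟩
  have hB1 : 1 ≤ B := by
    rw [hB, le_div_iff₀ (by positivity), one_mul]
    exact mul_le_one₀ hη1 hl2.le (by have := Real.log_two_lt_d9; linarith)
  refine ⟨B ^ P, by positivity, fun n hn => ?_⟩
  have hfac : (n : ℝ) ^ η = ∏ p ∈ n.primeFactors, ((p : ℝ) ^ n.factorization p) ^ η := by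
    rw [Real.finsetProd_rpow _ _ (fun p _ => by positivity)]
    congr 1
    conv_lhs => rw [← Nat.prod_factorization_pow_eq_self hn]
    rw [Finsupp.prod]; push_cast; rfl
  rw [Nat.card_divisors hn, hfac]
  push_cast
  have hterm : ∀ p ∈ n.primeFactors, ((n.factorization p : ℝ) + 1) ≤
      (if p < P then B else 1) * ((p : ℝ) ^ n.factorization p) ^ η := by
    intro p hp
    split_ifs with h
    · rw [hB]
      exact natCast_add_one_le_rpow hη hη1 (Nat.prime_of_mem_primeFactors hp).two_le _
    · rw [one_mul]
      refine natCast_add_one_le_rpow_of_large ?_ _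
      have : (2 : ℝ) ^ (1 / η) ≤ p := hP.trans (by exact_mod_cast not_lt.1 h)
      calc (2 : ℝ) = ((2 : ℝ) ^ (1 / η)) ^ η := by
            rw [← Real.rpow_mul (by norm_num), one_div_mul_cancel hη.ne', Real.rpow_one]
        _ ≤ _ := Real.rpow_le_rpow (by positivity) this hη.le
  refine (Finset.prod_le_prod (fun p _ => by positivity) hterm).trans ?_
  rw [Finset.prod_mul_distrib]
  refine mul_le_mul_of_nonneg_right ?_ (Finset.prod_nonneg (fun p _ => by positivity))
  rw [← Finset.prod_filter, Finset.prod_const]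
  refine pow_le_pow_right₀ hB1 ?_
  calc _ ≤ (Finset.range P).card :=
        Finset.card_le_card (fun p hp => Finset.mem_range.2 (Finset.mem_filter.1 hp).2)
    _ = P := Finset.card_range P

lemma le_card_divisors_mul_totient {q : ℕ} (hq : q ≠ 0) :
    q ≤ q.divisors.card * Nat.totient q := by
  conv_lhs => rw [← Nat.sum_totient q]
  refine Finset.sum_le_card_nsmul _ _ _ (fun d hd => ?_)
  exact Nat.le_of_dvd (Nat.totient_pos.2 (Nat.pos_of_ne_zero hq))
    (Nat.totient_dvd_of_dvd (Nat.dvd_of_mem_divisors hd))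

lemma card_dirichletCharacter (q : ℕ) [NeZero q] :
    Fintype.card (DirichletCharacter ℂ q) = Nat.totient q := by
  rw [← Nat.card_eq_fintype_card, DirichletCharacter.card_eq_totient_of_hasEnoughRootsOfUnity]

lemma card_conductor_eq_le (q d : ℕ) [NeZero q] (hd : d ∣ q) :
    (Finset.univ.filter (fun χ : DirichletCharacter ℂ q => χ.conductor = d)).card ≤ d := by
  have hd0 : d ≠ 0 := fun h => NeZero.ne q (Nat.eq_zero_of_zero_dvd (h ▸ hd))
  have : NeZero d := ⟨hd0⟩
  calc _ ≤ ((Finset.univ : Finset (DirichletCharacter ℂ d)).image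
        (DirichletCharacter.changeLevel hd)).card := by
        refine Finset.card_le_card (fun χ hχ => ?_)
        obtain rfl := (Finset.mem_filter.1 hχ).2
        exact Finset.mem_image.2 ⟨χ.primitiveCharacter, Finset.mem_univ _,
          χ.changeLevel_primitiveCharacter⟩
    _ ≤ (Finset.univ : Finset (DirichletCharacter ℂ d)).card := Finset.card_image_le
    _ = Nat.totient d := card_dirichletCharacter d
    _ ≤ d := Nat.totient_le d

lemma card_conductor_le_le (q : ℕ) [NeZero q] {D : ℝ} (hD : 0 ≤ D) :
    ((Finset.univ.filter (fun χ : DirichletCharacter ℂ q => (χ.conductor : ℝ) ≤ D)).card : ℝ) ≤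
      q.divisors.card * D := by
  have hsub : (Finset.univ.filter (fun χ : DirichletCharacter ℂ q => (χ.conductor : ℝ) ≤ D)) ⊆
      (q.divisors.filter (fun d : ℕ => (d : ℝ) ≤ D)).biUnion
        (fun d => Finset.univ.filter (fun χ : DirichletCharacter ℂ q => χ.conductor = d)) := by
    intro χ hχ
    simp only [Finset.mem_biUnion, Finset.mem_filter, Finset.mem_univ, true_and,
      Nat.mem_divisors] at hχ ⊢
    exact ⟨χ.conductor, ⟨⟨χ.conductor_dvd_level, NeZero.ne q⟩, hχ⟩, rfl⟩
  have h1 : ((Finset.univ.filter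
      (fun χ : DirichletCharacter ℂ q => (χ.conductor : ℝ) ≤ D)).card : ℝ) ≤
      ∑ d ∈ q.divisors.filter (fun d : ℕ => (d : ℝ) ≤ D), ((Finset.univ.filter
        (fun χ : DirichletCharacter ℂ q => χ.conductor = d)).card : ℝ) := by
    exact_mod_cast (Finset.card_le_card hsub).trans Finset.card_biUnion_le
  refine h1.trans ((Finset.sum_le_card_nsmul _ _ D (fun d hd => ?_)).trans ?_)
  · obtain ⟨hd1, hd2⟩ := Finset.mem_filter.1 hd
    refine le_trans ?_ hd2
    exact_mod_cast card_conductor_eq_le q d (Nat.dvd_of_mem_divisors hd1)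
  · rw [nsmul_eq_mul]
    refine mul_le_mul_of_nonneg_right ?_ hD
    exact_mod_cast Finset.card_filter_le _ _

/-- All but a proportion `δ` of the characters mod `q` have conductor exceeding `q ^ (1 - δ)`. -/
theorem eventually_card_conductor_le_le {δ : ℝ} (hδ : 0 < δ) (hδ1 : δ ≤ 1) :
    ∃ q₀ : ℕ, ∀ (q : ℕ) [NeZero q], q₀ ≤ q →
      ((Finset.univ.filter (fun χ : DirichletCharacter ℂ q =>
        (χ.conductor : ℝ) ≤ (q : ℝ) ^ (1 - δ))).card : ℝ) ≤ δ * Nat.totient q := by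
  obtain ⟨C, hC, hdiv⟩ := exists_card_divisors_le_mul_rpow (show 0 < δ / 4 by linarith)
    (show δ / 4 ≤ 1 by linarith)
  have ht : Tendsto (fun q : ℕ => (q : ℝ) ^ (δ / 2)) atTop atTop :=
    (tendsto_rpow_atTop (by linarith)).comp tendsto_natCast_atTop_atTop
  obtain ⟨q₀, hq₀⟩ := eventually_atTop.1 (ht.eventually_ge_atTop (C ^ 2 / δ))
  refine ⟨q₀, fun q _ hq => ?_⟩
  have hq0 : (0 : ℝ) < q := by exact_mod_cast Nat.pos_of_ne_zero (NeZero.ne q)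
  refine (card_conductor_le_le q (by positivity)).trans ?_
  have h1 := hdiv q (NeZero.ne q)
  have h2 : (q : ℝ) ≤ q.divisors.card * Nat.totient q := by
    exact_mod_cast le_card_divisors_mul_totient (NeZero.ne q)
  have h3 := hq₀ q hq
  have hτ : (0 : ℝ) < q.divisors.card := by
    exact_mod_cast Finset.card_pos.2 ⟨1, Nat.one_mem_divisors.2 (NeZero.ne q)⟩
  rw [div_le_iff₀ hδ] at h3
  have h4 : (q.divisors.card : ℝ) ^ 2 ≤ C ^ 2 * (q : ℝ) ^ (δ / 2) := by
    calc _ ≤ (C * (q : ℝ) ^ (δ / 4)) ^ 2 := by gcongr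
      _ = _ := by
        rw [mul_pow, ← Real.rpow_natCast ((q : ℝ) ^ (δ / 4)), ← Real.rpow_mul hq0.le]
        congr 2; push_cast; ring
  have h5 : (q : ℝ) ^ (1 - δ) * ((q : ℝ) ^ (δ / 2) * (q : ℝ) ^ (δ / 2)) = q := by
    rw [← Real.rpow_add hq0, ← Real.rpow_add hq0]
    conv_rhs => rw [← Real.rpow_one (q : ℝ)]
    congr 1; ring
  refine le_of_mul_le_mul_left ?_ hτ
  calc (q.divisors.card : ℝ) * (q.divisors.card * (q : ℝ) ^ (1 - δ))
      = (q.divisors.card : ℝ) ^ 2 * (q : ℝ) ^ (1 - δ) := by ring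
    _ ≤ (C ^ 2 * (q : ℝ) ^ (δ / 2)) * (q : ℝ) ^ (1 - δ) := by gcongr
    _ ≤ ((q : ℝ) ^ (δ / 2) * δ * (q : ℝ) ^ (δ / 2)) * (q : ℝ) ^ (1 - δ) := by gcongr
    _ = δ * ((q : ℝ) ^ (1 - δ) * ((q : ℝ) ^ (δ / 2) * (q : ℝ) ^ (δ / 2))) := by ring
    _ = δ * q := by rw [h5]
    _ ≤ δ * (q.divisors.card * Nat.totient q) := by gcongr
    _ = _ := by ring

lemma sum_zmod_eq_sum_range {q : ℕ} [NeZero q] {M : Type*} [AddCommMonoid M] (F : ZMod q → M) :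
    ∑ z, F z = ∑ a ∈ Finset.range q, F (a : ZMod q) := by
  refine Finset.sum_nbij' (fun z => z.val) (fun a => (a : ZMod q)) (fun z _ => ?_)
    (fun _ _ => Finset.mem_univ _) (fun z _ => ?_) (fun a ha => ?_) (fun z _ => ?_)
  · exact Finset.mem_range.2 z.val_lt
  · exact ZMod.natCast_zmod_val z
  · exact ZMod.val_cast_of_lt (Finset.mem_range.1 ha)
  · rw [ZMod.natCast_zmod_val]

lemma sum_normSq_sum_characters {q : ℕ} [NeZero q] (S : Finset (DirichletCharacter ℂ q)) :
    ∑ z : ZMod q, Complex.normSq (∑ χ ∈ S, χ z) = Nat.totient q * S.card := by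
  have h : ((∑ z : ZMod q, Complex.normSq (∑ χ ∈ S, χ z) : ℝ) : ℂ) =
      ∑ χ ∈ S, ∑ ψ ∈ S, ∑ z : ZMod q, (χ * ψ⁻¹) z := by
    push_cast
    have e : ∀ z : ZMod q, (Complex.normSq (∑ χ ∈ S, χ z) : ℂ) =
        ∑ χ ∈ S, ∑ ψ ∈ S, (χ * ψ⁻¹) z := by
      intro z
      rw [← Complex.mul_conj, map_sum, Finset.sum_mul_sum]
      refine Finset.sum_congr rfl (fun χ _ => Finset.sum_congr rfl (fun ψ _ => ?_))
      rw [MulChar.mul_apply, ← MulChar.star_apply' ψ z]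
      rfl
    rw [Finset.sum_congr rfl (fun z _ => e z), Finset.sum_comm]
    exact Finset.sum_congr rfl (fun χ _ => Finset.sum_comm)
  have h2 : ∀ χ ∈ S, ∑ ψ ∈ S, ∑ z : ZMod q, (χ * ψ⁻¹) z = (Nat.totient q : ℂ) := by
    intro χ hχ
    rw [Finset.sum_eq_single_of_mem χ hχ]
    · rw [mul_inv_cancel, MulChar.sum_one_eq_card_units, ZMod.card_units_eq_totient]
    · intro ψ _ hne
      refine MulChar.sum_eq_zero_of_ne_one (fun h => hne ?_)
      rw [mul_inv_eq_one] at h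
      exact h.symm
  rw [Finset.sum_congr rfl h2, Finset.sum_const, nsmul_eq_mul] at h
  rw [mul_comm]
  exact_mod_cast h

lemma sum_character_mul_residue_sum {q : ℕ} [NeZero q] {χ : DirichletCharacter ℂ q} (hχ : χ ≠ 1)
    (w : ℕ → ℝ) (X : ℕ) (m : ℝ) :
    ∑ a ∈ Finset.range q, χ (a : ZMod q) *
      (((∑ n ∈ (Finset.range X).filter (fun n => n % q = a), w n) - m : ℝ) : ℂ) =
      ∑ n ∈ Finset.range X, χ (n : ZMod q) * (w n : ℂ) := by
  have h0 : ∑ a ∈ Finset.range q, χ (a : ZMod q) = 0 := by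
    rw [← sum_zmod_eq_sum_range (fun z => χ z)]
    exact MulChar.sum_eq_zero_of_ne_one hχ
  push_cast
  simp only [mul_sub, Finset.sum_sub_distrib, ← Finset.sum_mul, h0, zero_mul, sub_zero]
  conv_rhs => rw [← Finset.sum_fiberwise_of_maps_to (g := fun n => n % q) (t := Finset.range q)
    (fun n _ => Finset.mem_range.2 (Nat.mod_lt _ (Nat.pos_of_ne_zero (NeZero.ne q))))]
  refine Finset.sum_congr rfl (fun a _ => ?_)
  rw [Finset.mul_sum]
  refine Finset.sum_congr rfl (fun n hn => ?_)
  rw [← (Finset.mem_filter.1 hn).2, ZMod.natCast_mod]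

/-- Twisted sums over a set of nonprincipal characters are controlled by the variance over
reduced residue classes. -/
theorem sq_sum_re_le_variance {q : ℕ} [NeZero q] (S : Finset (DirichletCharacter ℂ q))
    (hS : ∀ χ ∈ S, χ ≠ 1) (w : ℕ → ℝ) (X : ℕ) (m : ℝ) :
    (∑ χ ∈ S, ∑ n ∈ Finset.range X, (χ (n : ZMod q)).re * w n) ^ 2 ≤
      (∑ a ∈ (Finset.range q).filter (fun a => Nat.Coprime a q),
        ((∑ n ∈ (Finset.range X).filter (fun n => n % q = a), w n) - m) ^ 2) *
      (Nat.totient q * S.card) := by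
  have h1 : ∑ χ ∈ S, ∑ n ∈ Finset.range X, (χ (n : ZMod q)).re * w n =
      ∑ a ∈ (Finset.range q).filter (fun a => Nat.Coprime a q),
        ((∑ n ∈ (Finset.range X).filter (fun n => n % q = a), w n) - m) *
        (∑ χ ∈ S, χ (a : ZMod q)).re := by
    have e1 : ∀ χ ∈ S, ∑ n ∈ Finset.range X, (χ (n : ZMod q)).re * w n =
        ∑ a ∈ Finset.range q, (χ (a : ZMod q)).re *
          ((∑ n ∈ (Finset.range X).filter (fun n => n % q = a), w n) - m) := by
      intro χ hχ
      have := congrArg Complex.re (sum_character_mul_residue_sum (hS χ hχ) w X m)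
      simp only [Complex.re_sum, Complex.re_mul_ofReal] at this
      exact this.symm
    rw [Finset.sum_congr rfl e1, Finset.sum_comm, Finset.sum_filter]
    refine Finset.sum_congr rfl (fun a _ => ?_)
    split_ifs with ha
    · rw [Complex.re_sum, ← Finset.sum_mul, mul_comm]
    · refine Finset.sum_eq_zero (fun χ _ => ?_)
      rw [MulChar.map_nonunit χ (fun h => ha ((ZMod.isUnit_iff_coprime a q).1 h))]
      simp
  rw [h1]
  refine (Finset.sum_mul_sq_le_sq_mul_sq _ _ _).trans
    (mul_le_mul_of_nonneg_left ?_ (Finset.sum_nonneg (fun _ _ => sq_nonneg _)))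
  rw [← sum_normSq_sum_characters S, sum_zmod_eq_sum_range]
  refine (Finset.sum_le_sum_of_subset_of_nonneg (Finset.filter_subset _ _)
    (fun _ _ _ => sq_nonneg _)).trans (Finset.sum_le_sum (fun a _ => ?_))
  rw [Complex.normSq_apply, sq]
  linarith [mul_self_nonneg (∑ χ ∈ S, χ (a : ZMod q)).im]

lemma sum_vonMangoldt_not_coprime_le (q X : ℕ) [NeZero q] :
    ∑ n ∈ Finset.range (X + 1), (if Nat.Coprime n q then 0 else ArithmeticFunction.vonMangoldt n) ≤
      (q + 1) * (Nat.log 2 X + 1) * Real.log X := by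
  have hlogX : 0 ≤ Real.log X := Real.log_natCast_nonneg X
  have hsub : (Finset.range (X + 1)).filter (fun n => IsPrimePow n ∧ ¬ Nat.Coprime n q) ⊆
      (Finset.range (q + 1) ×ˢ Finset.range (Nat.log 2 X + 1)).image (fun z => z.1 ^ z.2) := by
    intro n hn
    obtain ⟨hnX, ⟨p, k, hp, hk, rfl⟩, hco⟩ := Finset.mem_filter.1 hn
    have hp' := hp.nat_prime
    have hpq : p ∣ q := by
      by_contra h
      exact hco (Nat.Coprime.pow_left k ((Nat.Prime.coprime_iff_not_dvd hp').2 h))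
    refine Finset.mem_image.2 ⟨(p, k), Finset.mem_product.2 ⟨Finset.mem_range.2
      (Nat.lt_succ_of_le (Nat.le_of_dvd (Nat.pos_of_ne_zero (NeZero.ne q)) hpq)),
      Finset.mem_range.2 (Nat.lt_succ_of_le ?_)⟩, rfl⟩
    exact Nat.le_log_of_pow_le (by norm_num) ((Nat.pow_le_pow_left hp'.two_le k).trans
      (Nat.lt_succ_iff.1 (Finset.mem_range.1 hnX)))
  have h1 : ∑ n ∈ Finset.range (X + 1),
      (if Nat.Coprime n q then 0 else ArithmeticFunction.vonMangoldt n) ≤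
      ∑ n ∈ (Finset.range (X + 1)).filter (fun n => IsPrimePow n ∧ ¬ Nat.Coprime n q),
        Real.log X := by
    rw [Finset.sum_filter]
    refine Finset.sum_le_sum (fun n hn => ?_)
    by_cases hc : Nat.Coprime n q
    · rw [if_pos hc]
      split_ifs
      exacts [hlogX, le_rfl]
    by_cases hp : IsPrimePow n
    · simp only [hc, hp, if_false, not_false_eq_true, and_self, if_true]
      refine ArithmeticFunction.vonMangoldt_le_log.trans (Real.log_le_log ?_ ?_)
      · exact_mod_cast hp.pos
      · exact_mod_cast Nat.lt_succ_iff.1 (Finset.mem_range.1 hn)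
    · simp [hc, hp, ArithmeticFunction.vonMangoldt_apply]
  refine h1.trans ?_
  rw [Finset.sum_const, nsmul_eq_mul]
  refine mul_le_mul_of_nonneg_right ?_ hlogX
  have := (Finset.card_le_card hsub).trans Finset.card_image_le
  rw [Finset.card_product, Finset.card_range, Finset.card_range] at this
  exact_mod_cast this

lemma primitiveCharacter_apply_of_coprime {q n : ℕ} [NeZero q] (χ : DirichletCharacter ℂ q)
    (h : Nat.Coprime n q) : χ.primitiveCharacter (n : ZMod χ.conductor) = χ (n : ZMod q) := by
  have := χ.primitiveCharacter_apply_of_isCoprime (a := (n : ℤ)) (Nat.isCoprime_iff_coprime.2 h)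
  simpa using this

/-- Passing from the primes in progressions mod `q` to the primitive twists of the von Mangoldt
function. -/
theorem sum_characters_le_sum_twistCoeff {q : ℕ} [NeZero q] (S : Finset (DirichletCharacter ℂ q))
    {w : ℕ → ℝ} (hw : ∀ n, w n ≤ ArithmeticFunction.vonMangoldt n) (X : ℕ) :
    ∑ χ ∈ S, ∑ n ∈ Finset.range (X + 1), (χ (n : ZMod q)).re * w n ≤
      ∑ n ∈ Finset.Ioc 0 X, twistCoeff
        (fun χ : DirichletCharacter ℂ q => χ.primitiveCharacter) S n +
      S.card * (∑ n ∈ Finset.range (X + 1), (ArithmeticFunction.vonMangoldt n - w n) +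
        (q + 1) * (Nat.log 2 X + 1) * Real.log X) := by
  have h0 : ∑ n ∈ Finset.Ioc 0 X, twistCoeff
      (fun χ : DirichletCharacter ℂ q => χ.primitiveCharacter) S n =
      ∑ χ ∈ S, ∑ n ∈ Finset.range (X + 1), (χ.primitiveCharacter (n : ZMod χ.conductor)).re *
        ArithmeticFunction.vonMangoldt n := by
    rw [Finset.sum_comm]
    refine Finset.sum_subset (fun n hn => ?_) (fun n hn hn' => ?_)
    · rw [Finset.mem_range]; have := (Finset.mem_Ioc.1 hn).2; omega
    · have : n = 0 := by
        rw [Finset.mem_Ioc] at hn'; rw [Finset.mem_range] at hn; omega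
      simp [this, twistCoeff]
  rw [h0, ← nsmul_eq_mul, ← Finset.sum_const, ← Finset.sum_add_distrib]
  refine Finset.sum_le_sum (fun χ _ => ?_)
  refine le_trans ?_ (add_le_add_right
    (add_le_add_right (sum_vonMangoldt_not_coprime_le q X) _) _)
  rw [← Finset.sum_add_distrib, ← Finset.sum_add_distrib]
  refine Finset.sum_le_sum (fun n _ => ?_)
  have hL := ArithmeticFunction.vonMangoldt_nonneg (n := n)
  have h1 := abs_le.1 ((Complex.abs_re_le_norm _).trans
    (DirichletCharacter.norm_le_one χ.primitiveCharacter (n : ZMod χ.conductor)))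
  split_ifs with hc
  · rw [primitiveCharacter_apply_of_coprime χ hc] at h1 ⊢
    have := mul_nonneg (show 0 ≤ 1 + (χ (n : ZMod q)).re by linarith [h1.1])
      (sub_nonneg.2 (hw n))
    linarith
  · rw [MulChar.map_nonunit χ (fun h => hc ((ZMod.isUnit_iff_coprime n q).1 h))]
    have := mul_nonneg (show 0 ≤ 1 + (χ.primitiveCharacter (n : ZMod χ.conductor)).re by
      linarith [h1.1]) hL
    have := hw n
    simp only [Complex.zero_re, zero_mul]
    linarith

lemma exists_large_conductor_characters {q : ℕ} [NeZero q] {δ : ℝ} {K : ℕ}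
    (hδ1 : δ ≤ 1)
    (hc : ((Finset.univ.filter (fun χ : DirichletCharacter ℂ q =>
      (χ.conductor : ℝ) ≤ (q : ℝ) ^ (1 - δ))).card : ℝ) ≤ δ * Nat.totient q)
    (hK : (K : ℝ) ≤ (1 - δ) * Nat.totient q) :
    ∃ S : Finset (DirichletCharacter ℂ q), S.card = K ∧ (∀ χ ∈ S, χ ≠ 1) ∧
      ∀ χ ∈ S, (1 - δ) * Real.log q ≤ Real.log χ.conductor := by
  have hq1 : (1 : ℝ) ≤ q := by exact_mod_cast Nat.one_le_iff_ne_zero.2 (NeZero.ne q)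
  have hsplit := Finset.card_filter_add_card_filter_not (s := Finset.univ)
    (fun χ : DirichletCharacter ℂ q => (χ.conductor : ℝ) ≤ (q : ℝ) ^ (1 - δ))
  rw [Finset.card_univ, card_dirichletCharacter] at hsplit
  have hle : K ≤ (Finset.univ.filter (fun χ : DirichletCharacter ℂ q =>
      ¬ (χ.conductor : ℝ) ≤ (q : ℝ) ^ (1 - δ))).card := by
    have : ((Finset.univ.filter (fun χ : DirichletCharacter ℂ q =>
      (χ.conductor : ℝ) ≤ (q : ℝ) ^ (1 - δ))).card : ℝ) +
      ((Finset.univ.filter (fun χ : DirichletCharacter ℂ q =>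
      ¬ (χ.conductor : ℝ) ≤ (q : ℝ) ^ (1 - δ))).card : ℝ) = Nat.totient q := by
      exact_mod_cast hsplit
    have : (K : ℝ) ≤ ((Finset.univ.filter (fun χ : DirichletCharacter ℂ q =>
      ¬ (χ.conductor : ℝ) ≤ (q : ℝ) ^ (1 - δ))).card : ℝ) := by linarith
    exact_mod_cast this
  obtain ⟨S, hS, hcard⟩ := Finset.exists_subset_card_eq hle
  have hmem : ∀ χ ∈ S, (q : ℝ) ^ (1 - δ) < χ.conductor := fun χ hχ =>
    not_le.1 (Finset.mem_filter.1 (hS hχ)).2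
  refine ⟨S, hcard, fun χ hχ h => ?_, fun χ hχ => ?_⟩
  · have := hmem χ hχ
    rw [h, DirichletCharacter.conductor_one] at this
    have h1 := Real.one_le_rpow hq1 (show 0 ≤ 1 - δ by linarith)
    push_cast at this
    linarith
  · rw [← Real.log_rpow (by linarith)]
    exact Real.log_le_log (by positivity) (hmem χ hχ).le

lemma primitiveCharacter_ne_one {q : ℕ} [NeZero q] {χ : DirichletCharacter ℂ q} (hχ : χ ≠ 1) :
    χ.primitiveCharacter ≠ 1 := by
  intro h
  have := χ.changeLevel_primitiveCharacter
  rw [h, map_one] at this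
  exact hχ this.symm

lemma eventually_cube_le_exp : ∃ u₀ : ℝ, ∀ u, u₀ ≤ u → 6 * u ^ 3 ≤ Real.exp (u / 2) := by
  have t := (Real.tendsto_pow_mul_exp_neg_atTop_nhds_zero 3).comp
    (tendsto_id.atTop_div_const (show (0 : ℝ) < 2 by norm_num))
  obtain ⟨u₀, hu₀⟩ := eventually_atTop.1
    (t.eventually (gt_mem_nhds (show (0 : ℝ) < 1 / 48 by norm_num)))
  refine ⟨u₀, fun u hu => ?_⟩
  have := hu₀ u hu
  simp only [Function.comp_apply, id] at this
  rw [Real.exp_neg, ← div_eq_mul_inv, div_lt_iff₀ (Real.exp_pos _)] at this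
  have e : (u / 2) ^ 3 = u ^ 3 / 8 := by ring
  rw [e] at this
  linarith

lemma prime_power_error_le {q : ℕ} {u : ℝ} (hu1 : 1 ≤ u) (hqu : (q : ℝ) ≤ u) :
    ((q : ℝ) + 1) * (Nat.log 2 ⌊Real.exp u⌋₊ + 1) * Real.log ⌊Real.exp u⌋₊ ≤ 6 * u ^ 3 := by
  have hX1 : 1 ≤ ⌊Real.exp u⌋₊ := Nat.le_floor (by
    push_cast; exact Real.one_le_exp (by linarith))
  have hX0 : (0 : ℝ) < ⌊Real.exp u⌋₊ := by exact_mod_cast hX1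
  have hlog : Real.log ⌊Real.exp u⌋₊ ≤ u := by
    rw [Real.log_le_iff_le_exp hX0]
    exact Nat.floor_le (Real.exp_pos u).le
  have hlog0 : 0 ≤ Real.log ⌊Real.exp u⌋₊ := Real.log_natCast_nonneg _
  have h2 : (Nat.log 2 ⌊Real.exp u⌋₊ : ℝ) ≤ 2 * u := by
    have h := Real.natLog_le_logb ⌊Real.exp u⌋₊ 2
    rw [Real.logb] at h
    push_cast at h
    refine h.trans ?_
    have hl2 := Real.log_two_gt_d9
    rw [div_le_iff₀ (by linarith)]
    have := mul_le_mul_of_nonneg_left hl2.le (show 0 ≤ 2 * u by linarith)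
    linarith
  calc _ ≤ (2 * u) * (3 * u) * u := by
        gcongr <;> linarith
    _ = _ := by ring

theorem exists_variance_ge {δ : ℝ} (hδ : 0 < δ) (hδ2 : δ ≤ 1 / 486) (C : ℝ)
    (hG : ∀ (N : ℕ) (χ : DirichletCharacter ℂ N), χ ≠ 1 → GRHchi χ) :
    ∃ q₀ : ℕ, ∀ q : ℕ, q₀ ≤ q → ∀ (f A : ℝ) (K : ℕ), 1 ≤ f → 1 ≤ K →
      (K : ℝ) ≤ (1 - δ) * Nat.totient q → f ^ 2 * Real.log q ^ 2 ≤ A → (q : ℝ) ≤ A →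
      ∃ u, A ≤ u ∧
        u ≤ A * Real.exp (13 / δ ^ 3 * (K * f * (Real.log q + Real.log f))) ∧
        ∀ (w : ℕ → ℝ) (m : ℝ), (∀ n, w n ≤ ArithmeticFunction.vonMangoldt n) →
          ∑ n ∈ Finset.range (⌊Real.exp u⌋₊ + 1), (ArithmeticFunction.vonMangoldt n - w n) ≤
            C * Real.exp (u / 2) →
          K * ((1 / 2 - 243 * δ) * (2 * Real.log q + Real.log f)) ^ 2 * Real.exp u ≤
            Nat.totient q * ∑ a ∈ (Finset.range q).filter (fun a => Nat.Coprime a q),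
              ((∑ n ∈ (Finset.range (⌊Real.exp u⌋₊ + 1)).filter (fun n => n % q = a), w n) -
                m) ^ 2 := by
  obtain ⟨Q₀, hQ₀, hmain⟩ := exists_twistCoeff_sum_le hδ (show δ ≤ 1 / 484 by linarith)
  obtain ⟨q₁, hq₁⟩ := eventually_card_conductor_le_le hδ (show δ ≤ 1 by linarith)
  obtain ⟨u₀, hu₀⟩ := eventually_cube_le_exp
  obtain ⟨q₀, hq₀⟩ := eventually_atTop.1 (((Real.tendsto_log_atTop.comp
    tendsto_natCast_atTop_atTop).eventually_ge_atTop (max Q₀ ((C + 1) / δ))).and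
    ((tendsto_natCast_atTop_atTop.eventually_ge_atTop u₀).and
      ((eventually_ge_atTop q₁).and (eventually_ge_atTop 1))))
  refine ⟨q₀, fun q hq f A K hf hK hKφ hA hqA => ?_⟩
  obtain ⟨hQ, hqu, hqq, hq1⟩ := hq₀ q hq
  have : NeZero q := ⟨by omega⟩
  have : ∀ χ : DirichletCharacter ℂ q, NeZero χ.conductor := fun χ => ⟨χ.conductor_ne_zero⟩
  simp only [Function.comp_apply, max_le_iff] at hQ
  have hq1' : (1 : ℝ) ≤ q := by exact_mod_cast hq1
  have hlf : 0 ≤ Real.log f := Real.log_nonneg hf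
  obtain ⟨S, hcard, hS1, hS2⟩ := exists_large_conductor_characters (by linarith) (hq₁ q hqq) hKφ
  have hSne : S.Nonempty := Finset.card_pos.1 (by omega)
  obtain ⟨u, hu1, hu2, hu3⟩ := hmain
    (fun χ : DirichletCharacter ℂ q => χ.primitiveCharacter) (Real.log q) f A hQ.1 hf hA S hSne
    (fun χ hχ => primitiveCharacter_ne_one (hS1 χ hχ))
    (fun χ _ => χ.primitiveCharacter_isPrimitive)
    (fun χ hχ => hG _ _ (primitiveCharacter_ne_one (hS1 χ hχ))) hS2
    (fun χ _ => Real.log_le_log (by exact_mod_cast Nat.pos_of_ne_zero χ.conductor_ne_zero)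
      (by exact_mod_cast Nat.le_of_dvd hq1 χ.conductor_dvd_level))
  rw [hcard] at hu2 hu3
  refine ⟨u, hu1, hu2, fun w m hw hwC => ?_⟩
  have hqu' : (q : ℝ) ≤ u := hqA.trans hu1
  have hcs := sq_sum_re_le_variance S hS1 w (⌊Real.exp u⌋₊ + 1) m
  have hle := sum_characters_le_sum_twistCoeff S hw ⌊Real.exp u⌋₊
  have herr := (prime_power_error_le (hq1'.trans hqu') hqu').trans (hu₀ u (by linarith))
  rw [hcard] at hcs hle
  have hK0 : (1 : ℝ) ≤ K := by exact_mod_cast hK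
  generalize (∑ a ∈ (Finset.range q).filter (fun a => Nat.Coprime a q),
    ((∑ n ∈ (Finset.range (⌊Real.exp u⌋₊ + 1)).filter (fun n => n % q = a), w n) - m) ^ 2) = V
    at hcs ⊢
  have hX : Real.exp u = Real.exp (u / 2) ^ 2 := by
    rw [← Real.exp_nat_mul]; congr 1; push_cast; ring
  have hXp := Real.exp_pos (u / 2)
  have e1 := mul_le_mul_of_nonneg_left (add_le_add hwC herr) (show (0 : ℝ) ≤ K by linarith)
  have e2 : C + 1 ≤ δ * (2 * Real.log q + Real.log f) := by
    have := (div_le_iff₀ hδ).1 hQ.2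
    have : 0 ≤ δ * Real.log f := by positivity
    have : 0 ≤ δ * Real.log q := mul_nonneg hδ.le (by linarith)
    linarith
  have e3 := mul_le_mul_of_nonneg_left (mul_le_mul_of_nonneg_right e2 hXp.le)
    (show (0 : ℝ) ≤ K by linarith)
  generalize (∑ χ ∈ S, ∑ n ∈ Finset.range (⌊Real.exp u⌋₊ + 1), (χ (n : ZMod q)).re * w n) = B
    at hcs hle
  have e4 : K * ((1 / 2 - 243 * δ) * (2 * Real.log q + Real.log f)) * Real.exp (u / 2) ≤ -B := by
    linarith
  have e5 : 0 ≤ K * ((1 / 2 - 243 * δ) * (2 * Real.log q + Real.log f)) * Real.exp (u / 2) :=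
    mul_nonneg (mul_nonneg (by linarith) (mul_nonneg (by linarith) (by linarith))) hXp.le
  have e6 := pow_le_pow_left₀ e5 e4 2
  rw [neg_sq] at e6
  rw [hX]
  refine le_of_mul_le_mul_left ?_ (show (0 : ℝ) < K by linarith)
  calc _ = (K * ((1 / 2 - 243 * δ) * (2 * Real.log q + Real.log f)) * Real.exp (u / 2)) ^ 2 := by
        ring
    _ ≤ _ := e6.trans hcs
    _ = _ := by ring

lemma quarter_sub_le {ε δ : ℝ} (hδ : δ = ε / 484) (hε : 0 < ε) (hε2 : ε ≤ 1 / 4) :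
    1 / 4 - 2 * ε ≤ (1 - δ - ε) * (1 / 2 - 243 * δ) ^ 2 := by
  have h1 : 1 / 4 - 243 * δ ≤ (1 / 2 - 243 * δ) ^ 2 := by nlinarith [sq_nonneg (243 * δ)]
  have h2 := mul_le_mul_of_nonneg_left h1 (show 0 ≤ 1 - δ - ε by linarith)
  have h3 : 0 ≤ ε ^ 2 := sq_nonneg ε
  rw [hδ] at h2 ⊢
  linarith

lemma exists_numeric_parameters {ε δ φ g Q f F : ℝ} (hε : 0 < ε) (hε2 : ε ≤ 1 / 4)
    (hδ : 0 < δ) (hδ2 : δ ≤ 1 / 486) (hφ : 0 < φ) (hQ : 0 < Q) (hg1 : Q / (ε * φ) ≤ g)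
    (hg2 : g ≤ Q) (hf : 1 ≤ f) (hF : 0 ≤ F) :
    ∃ K : ℕ, 1 ≤ K ∧ (K : ℝ) ≤ (1 - δ) * φ ∧ (1 - δ - ε) * (φ * g / Q) ≤ K ∧
      K * f * (Q + F) ≤ φ * f * g * (1 + F / Q) ∧ Q ≤ φ * f * g * (1 + F / Q) ∧
      f ^ 2 * Q ^ 2 ≤ Real.exp (φ * f * g * (1 + F / Q)) := by
  obtain ⟨y, hy⟩ : ∃ y, y = φ * g / Q := ⟨_, rfl⟩
  have hyε : 1 ≤ ε * y := by
    rw [div_le_iff₀ (by positivity)] at hg1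
    rw [hy, ← mul_div_assoc, le_div_iff₀ hQ]; linarith
  have hy4 : 4 ≤ y := by
    by_contra h
    have := mul_lt_mul_of_pos_left (not_le.1 h) hε
    linarith
  have hyφ : y ≤ φ := by
    rw [hy, div_le_iff₀ hQ]; exact mul_le_mul_of_nonneg_left hg2 hφ.le
  have hM : φ * f * g * (1 + F / Q) = y * f * (Q + F) := by
    rw [hy]; field_simp
  have h0 : 0 ≤ (1 - δ) * y := mul_nonneg (by linarith) (by linarith)
  have hfl := Nat.floor_le h0
  have hfl2 := Nat.lt_floor_add_one ((1 - δ) * y)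
  have hfQ : 4 * (f * Q) ≤ y * f * (Q + F) := by
    have e1 : 4 * (f * Q) ≤ y * (f * Q) := mul_le_mul_of_nonneg_right hy4 (by positivity)
    have e2 : 0 ≤ y * f * F := by positivity
    linarith
  rw [hM, ← hy]
  refine ⟨⌊(1 - δ) * y⌋₊, ?_, ?_, by linarith, ?_, ?_, ?_⟩
  · refine Nat.le_floor ?_
    push_cast
    have := mul_le_mul_of_nonneg_left hy4 (show 0 ≤ 1 - δ by linarith)
    linarith
  · exact hfl.trans (mul_le_mul_of_nonneg_left hyφ (by linarith))
  · have : (⌊(1 - δ) * y⌋₊ : ℝ) ≤ y := by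
      have : 0 ≤ δ * y := by positivity
      linarith
    gcongr
  · have := le_mul_of_one_le_left hQ.le hf
    linarith
  · calc f ^ 2 * Q ^ 2 = (f * Q) ^ 2 := by ring
      _ ≤ Real.exp (f * Q) ^ 2 := by
        refine pow_le_pow_left₀ (by positivity) ?_ 2
        linarith [Real.add_one_le_exp (f * Q)]
      _ = Real.exp (2 * (f * Q)) := by rw [← Real.exp_nat_mul]; push_cast; rfl
      _ ≤ _ := Real.exp_le_exp.2 (by linarith [show 0 ≤ f * Q by positivity])

theorem exists_variance_ratio_ge {ε : ℝ} (hε : 0 < ε) (hε2 : ε ≤ 1 / 4) (C : ℝ) {f g : ℕ → ℝ}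
    (hf : ∀ q, 1 ≤ f q)
    (hg : ∀ᶠ q : ℕ in atTop, Real.log q / (ε * Nat.totient q) ≤ g q ∧ g q ≤ Real.log q)
    (hG : ∀ (N : ℕ) (χ : DirichletCharacter ℂ N), χ ≠ 1 → GRHchi χ) :
    ∃ q₀ : ℕ, ∀ q : ℕ, q₀ ≤ q → ∃ u : ℝ,
      1 * (Nat.totient q * f q * g q * (1 + Real.log (f q) / Real.log q)) ≤
        Real.log (Real.log (Real.exp u)) ∧
      Real.log (Real.log (Real.exp u)) ≤ (1 + 13 / (ε / 484) ^ 3) *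
        (Nat.totient q * f q * g q * (1 + Real.log (f q) / Real.log q)) ∧
      ∀ (w : ℕ → ℝ) (m : ℝ), (∀ n, w n ≤ ArithmeticFunction.vonMangoldt n) →
        ∑ n ∈ Finset.range (⌊Real.exp u⌋₊ + 1), (ArithmeticFunction.vonMangoldt n - w n) ≤
          C * Real.exp (u / 2) →
        (1 / 4 - 2 * ε) * (g q * Real.log ((q : ℝ) ^ 2 * f q) ^ 2 / Real.log q) ≤
          (∑ a ∈ (Finset.range q).filter (fun a => Nat.Coprime a q),
            ((∑ n ∈ (Finset.range (⌊Real.exp u⌋₊ + 1)).filter (fun n => n % q = a), w n) -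
              m) ^ 2) / Real.exp u := by
  obtain ⟨δ, hδ⟩ : ∃ δ, δ = ε / 484 := ⟨_, rfl⟩
  have hδ0 : 0 < δ := by rw [hδ]; positivity
  have hδ2 : δ ≤ 1 / 486 := by rw [hδ]; linarith
  obtain ⟨q₁, hq₁⟩ := exists_variance_ge hδ0 hδ2 C hG
  obtain ⟨q₀, hq₀⟩ := eventually_atTop.1
    (hg.and ((eventually_ge_atTop q₁).and (eventually_ge_atTop 2)))
  refine ⟨q₀, fun q hq => ?_⟩
  obtain ⟨⟨hg1, hg2⟩, hqq, hq2⟩ := hq₀ q hq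
  have hq2' : (2 : ℝ) ≤ q := by exact_mod_cast hq2
  have hQ : 0 < Real.log q := Real.log_pos (by linarith)
  have hφ : (0 : ℝ) < Nat.totient q := by exact_mod_cast Nat.totient_pos.2 (by omega)
  have hF : 0 ≤ Real.log (f q) := Real.log_nonneg (hf q)
  obtain ⟨K, hK1, hK2, hK3, hK4, hK5, hK6⟩ :=
    exists_numeric_parameters hε hε2 hδ0 hδ2 hφ hQ hg1 hg2 (hf q) hF
  have hqA : (q : ℝ) ≤ Real.exp
      (Nat.totient q * f q * g q * (1 + Real.log (f q) / Real.log q)) := by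
    rw [← Real.log_le_iff_le_exp (by linarith)]; exact hK5
  obtain ⟨u, hu1, hu2, hu3⟩ := hq₁ q hqq (f q) _ K (hf q) hK1 hK2 hK6 hqA
  have hu0 : 0 < u := (Real.exp_pos _).trans_le hu1
  rw [← hδ]
  refine ⟨u, ?_, ?_, fun w m hw hwC => ?_⟩
  · rw [Real.log_exp, one_mul]
    exact (Real.le_log_iff_exp_le hu0).2 hu1
  · rw [Real.log_exp]
    rw [← Real.exp_add, ← Real.log_le_iff_le_exp hu0] at hu2
    have := mul_le_mul_of_nonneg_left hK4 (show 0 ≤ 13 / δ ^ 3 by positivity)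
    linarith
  · have h := hu3 w m hw hwC
    have hlog : Real.log ((q : ℝ) ^ 2 * f q) = 2 * Real.log q + Real.log (f q) := by
      rw [Real.log_mul (by positivity) (by linarith [hf q]), Real.log_pow]; push_cast; rfl
    rw [hlog, le_div_iff₀ (Real.exp_pos _)]
    have hg0 : 0 ≤ g q := le_trans (by positivity) hg1
    refine le_of_mul_le_mul_left (le_trans ?_ h) hφ
    have e1 := mul_le_mul_of_nonneg_right (quarter_sub_le hδ hε hε2)
      (show 0 ≤ (Nat.totient q * g q / Real.log q) *
        ((2 * Real.log q + Real.log (f q)) ^ 2 * Real.exp u) by positivity)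
    have e2 := mul_le_mul_of_nonneg_right hK3
      (show 0 ≤ ((1 / 2 - 243 * δ) * (2 * Real.log q + Real.log (f q))) ^ 2 * Real.exp u by
        positivity)
    calc _ = (1 / 4 - 2 * ε) * ((Nat.totient q * g q / Real.log q) *
        ((2 * Real.log q + Real.log (f q)) ^ 2 * Real.exp u)) := by ring
      _ ≤ _ := e1
      _ = (1 - δ - ε) * (Nat.totient q * g q / Real.log q) *
        (((1 / 2 - 243 * δ) * (2 * Real.log q + Real.log (f q))) ^ 2 * Real.exp u) := by ring
      _ ≤ _ := e2
      _ = _ := by ring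

lemma thetaQA_eq (x : ℝ) (q a : ℕ) :
    thetaQA x q a = ∑ n ∈ (Finset.range (⌊x⌋₊ + 1)).filter (fun n => n % q = a),
      (if n.Prime then Real.log n else 0) := by
  rw [thetaQA, ← Finset.sum_filter, Finset.filter_filter]
  refine Finset.sum_congr ?_ (fun _ _ => rfl)
  ext n
  simp only [Finset.mem_filter, and_comm (a := n.Prime)]

lemma primeLog_le_vonMangoldt (n : ℕ) :
    (if n.Prime then Real.log n else 0) ≤ ArithmeticFunction.vonMangoldt n := by
  split_ifs with h
  · rw [ArithmeticFunction.vonMangoldt_apply_prime h]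
  · exact ArithmeticFunction.vonMangoldt_nonneg

lemma sum_vonMangoldt_sub_primeLog (x : ℝ) :
    ∑ n ∈ Finset.range (⌊x⌋₊ + 1),
      (ArithmeticFunction.vonMangoldt n - if n.Prime then Real.log n else 0) =
      Chebyshev.psi x - Chebyshev.theta x := by
  rw [Chebyshev.psi, Chebyshev.theta, Finset.sum_filter, ← Finset.sum_sub_distrib]
  symm
  refine Finset.sum_subset (fun n hn => ?_) (fun n hn hn' => ?_)
  · rw [Finset.mem_range]; have := (Finset.mem_Ioc.1 hn).2; omega
  · have : n = 0 := by
      rw [Finset.mem_Ioc] at hn'; rw [Finset.mem_range] at hn; omega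
    simp [this]

theorem GRH_true_hard_case :
    ∃ ε₀ : ℝ, 0 < ε₀ ∧ ∃ F₀ : ℝ, 0 < F₀ ∧ ∀ ε : ℝ, 0 < ε → ε ≤ ε₀ →
    ∃ c₁ : ℝ, 0 < c₁ ∧ ∃ c₂ : ℝ, 0 < c₂ ∧ ∀ f g : ℕ → ℝ,
    (∀ q, F₀ ≤ f q) → (∀ q, 0 < g q) →
    (∀ᶠ q : ℕ in atTop, Real.log q / (ε * Nat.totient q) ≤ g q ∧ g q ≤ Real.log q) →
    (GRH → ∃ q₀ : ℕ, ∀ q : ℕ, q₀ ≤ q → ∃ x : ℝ,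
      c₁ * (Nat.totient q * f q * g q * (1 + Real.log (f q) / Real.log q)) ≤
        Real.log (Real.log x) ∧
      Real.log (Real.log x) ≤
        c₂ * (Nat.totient q * f q * g q * (1 + Real.log (f q) / Real.log q)) ∧
      (1 / 4 - 2 * ε) * (g q * Real.log ((q : ℝ) ^ 2 * f q) ^ 2 / Real.log q) ≤
        Gvar x q / x) ∧
    ((∀ (N : ℕ) (χ : DirichletCharacter ℂ N), χ ≠ 1 → GRHchi χ) →
      ∃ q₀ : ℕ, ∀ q : ℕ, q₀ ≤ q → ∃ x : ℝ,
      c₁ * (Nat.totient q * f q * g q * (1 + Real.log (f q) / Real.log q)) ≤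
        Real.log (Real.log x) ∧
      Real.log (Real.log x) ≤
        c₂ * (Nat.totient q * f q * g q * (1 + Real.log (f q) / Real.log q)) ∧
      (1 / 4 - 2 * ε) * (g q * Real.log ((q : ℝ) ^ 2 * f q) ^ 2 / Real.log q) ≤
        Vvar x q / x) := by
  refine ⟨1 / 4, by norm_num, 1, one_pos, fun ε hε hε2 => ⟨1, one_pos,
    1 + 13 / (ε / 484) ^ 3, by positivity, fun f g hf _ hg => ⟨fun hG => ?_, fun hG => ?_⟩⟩⟩
  · obtain ⟨C, hC⟩ := Chebyshev.psi_sub_theta_le_mul_sqrt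
    obtain ⟨q₀, hq₀⟩ := exists_variance_ratio_ge hε hε2 C hf hg (fun N χ _ => hG N χ)
    refine ⟨q₀, fun q hq => ?_⟩
    obtain ⟨u, hu1, hu2, hu3⟩ := hq₀ q hq
    refine ⟨Real.exp u, hu1, hu2, ?_⟩
    have h := hu3 _ (Real.exp u / Nat.totient q) primeLog_le_vonMangoldt
      (by rw [sum_vonMangoldt_sub_primeLog, Real.exp_half]; exact hC _)
    simpa only [Gvar, thetaQA_eq] using h
  · obtain ⟨q₀, hq₀⟩ := exists_variance_ratio_ge hε hε2 0 hf hg hG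
    refine ⟨q₀, fun q hq => ?_⟩
    obtain ⟨u, hu1, hu2, hu3⟩ := hq₀ q hq
    refine ⟨Real.exp u, hu1, hu2, ?_⟩
    exact hu3 _ _ (fun _ => le_rfl) (by simp)
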